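/- For every ψ ∈ Ψ₁ (modulo p), every zero ρ of the function s ↦ L(s,ψ)L(s,χψ) lying in Ω satisfies Re ρ = 1/2, and ρ is a zero of L(s,ψ)L(s,χψ) of order exactly one (in particular, L(s,ψ) and L(s,χψ) have no common zero in Ω). -/

import Mathlib

open scoped Classical

noncomputable section

/-- The Dirichlet L-function of `χ` (extended to modulus `0` by `0`, a case never used below). -/
def Lfun {N : ℕ} (χ : DirichletCharacter ℂ N) (s : ℂ) : ℂ :=
  if h : N = 0 then 0
  else
    haveI : NeZero N := ⟨h⟩
    DirichletCharacter.LFunction χ s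

/-- A Dirichlet character is *real* if all of its values are real numbers. -/
def IsRealChar {N : ℕ} (χ : DirichletCharacter ℂ N) : Prop :=
  ∀ a : ZMod N, (χ a).im = 0

/-- `𝓛 = log D`. -/
def bigL (D : ℕ) : ℝ := Real.log D

/-- `P = exp (𝓛 ^ 9)`. -/
def bigP (D : ℕ) : ℝ := Real.exp (bigL D ^ 9)

/-- Assumption (A): `L(1, χ) < 𝓛 ^ (-2022)`. -/
def AssumptionA (D : ℕ) (χ : DirichletCharacter ℂ D) : Prop :=
  (Lfun χ 1).re < bigL D ^ (-2022 : ℤ)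

/-- `p ~ P`, i.e. `p` is a prime with `P < p < P * (1 + 𝓛 ^ (-68))`. -/
def SimP (D p : ℕ) : Prop :=
  p.Prime ∧ bigP D < (p : ℝ) ∧ (p : ℝ) < bigP D * (1 + bigL D ^ (-68 : ℤ))

/-- The finite set of primes `p ~ P`. -/
def primesP (D : ℕ) : Finset ℕ :=
  (Finset.range ⌈2 * bigP D⌉₊).filter (SimP D)

/-- `𝒫 = ∑_{p ~ P} p`. -/
def calP (D : ℕ) : ℝ := ∑ p ∈ primesP D, (p : ℝ)

/-- `ν(n) = ∑_{d ∣ n} χ(d)`. -/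
def nuF (D : ℕ) (χ : DirichletCharacter ℂ D) (n : ℕ) : ℂ :=
  ∑ d ∈ n.divisors, χ (d : ZMod D)

/-- `υ(n) = ∑_{ab = n} μ(a) μ(b) χ(b)`. -/
def upsF (D : ℕ) (χ : DirichletCharacter ℂ D) (n : ℕ) : ℂ :=
  ∑ d ∈ n.divisors,
    ((ArithmeticFunction.moebius (n / d) : ℤ) : ℂ) * ((ArithmeticFunction.moebius d : ℤ) : ℂ) *
      χ (d : ZMod D)

/-- `t₀ = 𝓛 ^ 519`. -/
def t0 (D : ℕ) : ℝ := bigL D ^ 519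

/-- `s₀ = 1/2 + 2 π i t₀`. -/
def s0 (D : ℕ) : ℂ := 1 / 2 + 2 * (Real.pi : ℂ) * Complex.I * (t0 D : ℂ)

/-- `𝓛₁ = 𝓛 ^ 405`. -/
def bigL1 (D : ℕ) : ℝ := bigL D ^ 405

/-- `ν` truncated to `n ≤ D ^ 4`, as an arithmetic function. -/
def nuT (D : ℕ) (χ : DirichletCharacter ℂ D) : ArithmeticFunction ℂ :=
  ⟨fun n => if n = 0 then 0 else if n ≤ D ^ 4 then nuF D χ n else 0, by simp⟩

/-- `υ` truncated to `n ≤ D ^ 4`, as an arithmetic function. -/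
def upsT (D : ℕ) (χ : DirichletCharacter ℂ D) : ArithmeticFunction ℂ :=
  ⟨fun n => if n = 0 then 0 else if n ≤ D ^ 4 then upsF D χ n else 0, by simp⟩

/-- `ν₂₀`, the 20-fold Dirichlet convolution of the truncation of `ν`. -/
def nu20 (D : ℕ) (χ : DirichletCharacter ℂ D) (n : ℕ) : ℂ := (nuT D χ ^ 20) n

/-- `υ₂₀`, the 20-fold Dirichlet convolution of the truncation of `υ`. -/
def ups20 (D : ℕ) (χ : DirichletCharacter ℂ D) (n : ℕ) : ℂ := (upsT D χ ^ 20) n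

/-- `ς(n) = ∑_{lm = n, l ≤ D⁴, m ≤ D⁴} ν(l) υ(m)`. -/
def sigF (D : ℕ) (χ : DirichletCharacter ℂ D) (n : ℕ) : ℂ :=
  ∑ d ∈ n.divisors,
    if d ≤ D ^ 4 ∧ n / d ≤ D ^ 4 then nuF D χ d * upsF D χ (n / d) else 0

/-- `X₁(x, ψ) = ∑_{n ≤ x} ν₂₀(n) ψ(n) n^{-s₀}`. -/
def X1 (D : ℕ) (χ : DirichletCharacter ℂ D) {p : ℕ} (ψ : DirichletCharacter ℂ p) (x : ℝ) : ℂ :=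
  ∑ n ∈ Finset.Icc 1 ⌊x⌋₊, nu20 D χ n * ψ (n : ZMod p) * (n : ℂ) ^ (-s0 D)

/-- `X₂(x, ψ) = ∑_{n ≤ x} υ₂₀(n) ψ(n) n^{-s₀}`. -/
def X2 (D : ℕ) (χ : DirichletCharacter ℂ D) {p : ℕ} (ψ : DirichletCharacter ℂ p) (x : ℝ) : ℂ :=
  ∑ n ∈ Finset.Icc 1 ⌊x⌋₊, ups20 D χ n * ψ (n : ZMod p) * (n : ℂ) ^ (-s0 D)

/-- `X₃(x, ψ) = ∑_{D⁴ < n ≤ x} ν(n) ψ(n) n^{-s₀}`. -/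
def X3 (D : ℕ) (χ : DirichletCharacter ℂ D) {p : ℕ} (ψ : DirichletCharacter ℂ p) (x : ℝ) : ℂ :=
  ∑ n ∈ Finset.Ioc (D ^ 4) ⌊x⌋₊, nuF D χ n * ψ (n : ZMod p) * (n : ℂ) ^ (-s0 D)

/-- `X₄(x, ψ) = ∑_{D⁴ < n ≤ x} ς(n) ψ(n) n^{-s₀}`. -/
def X4 (D : ℕ) (χ : DirichletCharacter ℂ D) {p : ℕ} (ψ : DirichletCharacter ℂ p) (x : ℝ) : ℂ :=
  ∑ n ∈ Finset.Ioc (D ^ 4) ⌊x⌋₊, sigF D χ n * ψ (n : ZMod p) * (n : ℂ) ^ (-s0 D)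

/-- Inequality (3.4). -/
def Ineq1 (D : ℕ) (χ : DirichletCharacter ℂ D) {p : ℕ} (ψ : DirichletCharacter ℂ p) : Prop :=
  ‖X1 D χ ψ ((D : ℝ) ^ 80)‖ + ‖X2 D χ ψ ((D : ℝ) ^ 80)‖ +
      (∫ x in (1 : ℝ)..((D : ℝ) ^ 80), (‖X1 D χ ψ x‖ + ‖X2 D χ ψ x‖) / x) <
    bigL D ^ 1171

/-- Inequality (3.5). -/
def Ineq2 (D : ℕ) (χ : DirichletCharacter ℂ D) {p : ℕ} (ψ : DirichletCharacter ℂ p) : Prop :=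
  ‖X3 D χ ψ (bigP D ^ 2)‖ + (∫ x in ((D : ℝ) ^ 4)..(bigP D ^ 2), ‖X3 D χ ψ x‖ / x) <
    bigL D ^ (-585 : ℤ)

/-- Inequality (3.6). -/
def Ineq3 (D : ℕ) (χ : DirichletCharacter ℂ D) {p : ℕ} (ψ : DirichletCharacter ℂ p) : Prop :=
  ‖X4 D χ ψ ((D : ℝ) ^ 8)‖ + (∫ x in ((D : ℝ) ^ 4)..((D : ℝ) ^ 8), ‖X4 D χ ψ x‖ / x) <
    bigL D ^ (-633 : ℤ)

/-- Membership in `Ψ₁`: `ψ` is a primitive character mod `p` with `p ~ P` satisfying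
(3.4), (3.5) and (3.6). -/
def MemPsi1 (D : ℕ) (χ : DirichletCharacter ℂ D) {p : ℕ} (ψ : DirichletCharacter ℂ p) : Prop :=
  SimP D p ∧ ψ.IsPrimitive ∧ Ineq1 D χ ψ ∧ Ineq2 D χ ψ ∧ Ineq3 D χ ψ

/-- `F(s, ψ) = ∑_{n ≤ D⁴} ν(n) ψ(n) n^{-s}`. -/
def Ffun (D : ℕ) (χ : DirichletCharacter ℂ D) {p : ℕ} (ψ : DirichletCharacter ℂ p) (s : ℂ) : ℂ :=
  ∑ n ∈ Finset.Icc 1 (D ^ 4), nuF D χ n * ψ (n : ZMod p) * (n : ℂ) ^ (-s)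

/-- `G(s, ψ) = ∑_{n ≤ D⁴} υ(n) ψ(n) n^{-s}`. -/
def Gfun (D : ℕ) (χ : DirichletCharacter ℂ D) {p : ℕ} (ψ : DirichletCharacter ℂ p) (s : ℂ) : ℂ :=
  ∑ n ∈ Finset.Icc 1 (D ^ 4), upsF D χ n * ψ (n : ZMod p) * (n : ℂ) ^ (-s)

/-- `F'(s, ψ) = -∑_{n ≤ D⁴} ν(n) ψ(n) (log n) n^{-s}`, the derivative of `F` in `s`. -/
def Ffun' (D : ℕ) (χ : DirichletCharacter ℂ D) {p : ℕ} (ψ : DirichletCharacter ℂ p) (s : ℂ) : ℂ :=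
  -∑ n ∈ Finset.Icc 1 (D ^ 4),
    nuF D χ n * ψ (n : ZMod p) * ((Real.log n : ℝ) : ℂ) * (n : ℂ) ^ (-s)

/-- `F(1 - s, ψ̄) = ∑_{n ≤ D⁴} ν(n) conj(ψ(n)) n^{s - 1}`, as a function of `s`. -/
def FfunBar (D : ℕ) (χ : DirichletCharacter ℂ D) {p : ℕ} (ψ : DirichletCharacter ℂ p)
    (s : ℂ) : ℂ :=
  ∑ n ∈ Finset.Icc 1 (D ^ 4),
    nuF D χ n * (starRingEnd ℂ) (ψ (n : ZMod p)) * (n : ℂ) ^ (s - 1)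

/-- The region `Ω`. -/
def InOmega (D : ℕ) (s : ℂ) : Prop :=
  |(s - s0 D).re| < 1 / 2 ∧ |(s - s0 D).im| < bigL1 D + 2

/-- The region `Ω₁`. -/
def InOmega1 (D : ℕ) (s : ℂ) : Prop :=
  1 / 2 - Real.log (bigL D) / (100 * bigL D) < s.re ∧
    s.re < 1 + Real.log (bigL D) / (100 * bigL D) ∧
    |s.im - 2 * Real.pi * t0 D| < bigL1 D + 5

/-- The region `Ω₂`. -/
def InOmega2 (D : ℕ) (s : ℂ) : Prop :=
  1 / 2 - (bigL D)⁻¹ < s.re ∧ s.re < 1 + (bigL D)⁻¹ ∧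
    |s.im - 2 * Real.pi * t0 D| < bigL1 D + 4

/-- `α = π / log P`. -/
def alphaD (D : ℕ) : ℝ := Real.pi / Real.log (bigP D)

/-- The region `Ω₃`. -/
def InOmega3 (D : ℕ) (s : ℂ) : Prop :=
  1 / 2 - alphaD D < s.re ∧ s.re < 1 + alphaD D ∧
    |s.im - 2 * Real.pi * t0 D| < bigL1 D + 3

/-- The Gauss sum `τ(θ) = ∑_{a mod k} θ(a) e(a/k)`. -/
def tauSum {k : ℕ} (θ : DirichletCharacter ℂ k) : ℂ :=
  ∑ a ∈ Finset.range k,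
    θ (a : ZMod k) * Complex.exp (2 * (Real.pi : ℂ) * Complex.I * (a : ℂ) / (k : ℂ))

/-- The factor `Z(s, θ)` from the functional equation. -/
def Zfun {k : ℕ} (θ : DirichletCharacter ℂ k) (s : ℂ) : ℂ :=
  if θ (-1) = 1 then
    tauSum θ * (Real.pi : ℂ) ^ (s - 1 / 2) * (k : ℂ) ^ (-s) *
      Complex.Gamma ((1 - s) / 2) / Complex.Gamma (s / 2)
  else
    -Complex.I * tauSum θ * (Real.pi : ℂ) ^ (s - 1 / 2) * (k : ℂ) ^ (-s) *
      Complex.Gamma ((2 - s) / 2) / Complex.Gamma ((1 + s) / 2)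

/-- The product character `χψ` modulo `D * p`, i.e. `n ↦ χ(n) ψ(n)`. -/
def chiPsi (D : ℕ) (χ : DirichletCharacter ℂ D) {p : ℕ} (ψ : DirichletCharacter ℂ p) :
    DirichletCharacter ℂ (D * p) :=
  DirichletCharacter.changeLevel (dvd_mul_right D p) χ *
    DirichletCharacter.changeLevel (dvd_mul_left p D) ψ

/-- `Z̃(s, ψ) = Z(s, ψ) Z(s, χψ)`. -/
def Ztilde (D : ℕ) (χ : DirichletCharacter ℂ D) {p : ℕ} (ψ : DirichletCharacter ℂ p)
    (s : ℂ) : ℂ :=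
  Zfun ψ s * Zfun (chiPsi D χ ψ) s

/-- `T = exp (𝓛 ^ 1.1)`. -/
def bigT (D : ℕ) : ℝ := Real.exp (bigL D ^ (1.1 : ℝ))

/-- `P₄ = P T⁻² t₀`. -/
def P4 (D : ℕ) : ℝ := bigP D * bigT D ^ (-2 : ℤ) * t0 D

/-- The smooth weight `g(x) = π^{-1/2} ∫_{-∞}^{𝓛^{15} log x} e^{-u²} du`. -/
def gfun (D : ℕ) (x : ℝ) : ℝ :=
  Real.pi ^ (-(1 : ℝ) / 2) * ∫ u in Set.Iio (bigL D ^ 15 * Real.log x), Real.exp (-u ^ 2)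

/-- `g*(y) = g(y)` for `y > 1/2`, and `0` otherwise. -/
def gstar (D : ℕ) (y : ℝ) : ℝ := if 1 / 2 < y then gfun D y else 0

/-- `K(s, ψ) = ∑_n ψ(n) n^{-s} g*(P₄ / n)`. -/
def Kfun (D : ℕ) {p : ℕ} (ψ : DirichletCharacter ℂ p) (s : ℂ) : ℂ :=
  ∑' n : ℕ, ψ (n : ZMod p) * (n : ℂ) ^ (-s) * ((gstar D (P4 D / n) : ℝ) : ℂ)

/-- `N(1 - s, ψ̄) = ∑_n conj(ψ(n)) n^{s-1} g*(T² / n)`, as a function of `s`. -/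
def Nfun (D : ℕ) {p : ℕ} (ψ : DirichletCharacter ℂ p) (s : ℂ) : ℂ :=
  ∑' n : ℕ,
    (starRingEnd ℂ) (ψ (n : ZMod p)) * (n : ℂ) ^ (s - 1) * ((gstar D (bigT D ^ 2 / n) : ℝ) : ℂ)

/-- `𝔞 = (6/π²) L'(1,χ)² ∏_{q ∣ D} q/(q+1)`. -/
def fraka (D : ℕ) (χ : DirichletCharacter ℂ D) : ℂ :=
  6 / (Real.pi : ℂ) ^ 2 * deriv (Lfun χ) 1 ^ 2 * ∏ q ∈ D.primeFactors, (q : ℂ) / ((q : ℂ) + 1)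

local notation "conj" => starRingEnd ℂ


/-- Logarithmic derivative bound from upper bounds (Borel–Carathéodory). -/
theorem zz_logderiv_bound {f : ℂ → ℂ} {a : ℂ} {R M : ℝ} (hR : 0 < R) (hM : 0 < M)
    (hf : DifferentiableOn ℂ f (Metric.ball a R)) (hne : ∀ z ∈ Metric.ball a R, f z ≠ 0)
    (hb : ∀ z ∈ Metric.ball a R, ‖f z‖ ≤ Real.exp M * ‖f a‖) :
    ‖deriv f a / f a‖ ≤ 4 * M / R := by
  have ha : a ∈ Metric.ball a R := Metric.mem_ball_self hR
  have hd : DifferentiableOn ℂ (fun z => deriv f z / f z) (Metric.ball a R) :=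
    (hf.deriv Metric.isOpen_ball).div hf hne
  obtain ⟨g, hga, hg⟩ := hd.isExactOn_ball.with_val_at a 0
  -- f = f a * exp g
  have hconst : ∀ z ∈ Metric.ball a R, f z = f a * Complex.exp (g z) := by
    intro z hz
    have h1 : ∀ w ∈ Metric.ball a R, HasDerivAt (fun w => f w * Complex.exp (-g w)) 0 w := by
      intro w hw
      have hfw : HasDerivAt f (deriv f w) w :=
        (hf.differentiableAt (Metric.isOpen_ball.mem_nhds hw)).hasDerivAt
      have := hfw.mul ((hg w hw).neg.cexp)
      have hw0 := hne w hw
      have e1 : f w * (Complex.exp (-g w) * -(deriv f w / f w)) = -(Complex.exp (-g w) * deriv f w) := by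
        field_simp
      have e2 : deriv f w * Complex.exp (-g w) + f w * (Complex.exp (-g w) * -(deriv f w / f w)) = 0 := by
        rw [e1]; ring
      simp only [Pi.neg_apply] at this
      rw [e2] at this
      exact this
    have h2 : (fun w => f w * Complex.exp (-g w)) z = (fun w => f w * Complex.exp (-g w)) a := by
      refine (convex_ball a R).is_const_of_fderivWithin_eq_zero (𝕜 := ℂ)
        (fun w hw => (h1 w hw).differentiableAt.differentiableWithinAt) ?_ hz ha
      intro w hw
      have := (h1 w hw).hasFDerivAt.hasFDerivWithinAt (s := Metric.ball a R)
      rw [this.fderivWithin (Metric.isOpen_ball.uniqueDiffWithinAt hw)]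
      ext; simp
    simp only [hga, neg_zero, Complex.exp_zero, mul_one] at h2
    rw [← h2, mul_assoc, ← Complex.exp_add]; simp
  have hre : ∀ z ∈ Metric.ball a R, (g z).re ≤ M := by
    intro z hz
    have h1 := hb z hz
    rw [hconst z hz, norm_mul, Complex.norm_exp, mul_comm] at h1
    have h2 := le_of_mul_le_mul_right h1 (norm_pos_iff.mpr (hne a ha))
    exact Real.exp_le_exp.mp h2
  have key : ∀ z : ℂ, z ∈ Metric.ball (0:ℂ) R → ‖g (a + z)‖ ≤ 2 * M * ‖z‖ / (R - ‖z‖) := by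
    intro z hz
    have hm : ∀ w ∈ Metric.ball (0:ℂ) R, a + w ∈ Metric.ball a R := by
      intro w hw; simpa [Metric.mem_ball, dist_eq_norm] using hw
    have := Complex.borelCaratheodory_zero (f := fun z => g (a + z)) (M := M) (R := R) (z := z) hM
      (fun w hw => by
        have h := (hg (a+w) (hm w hw)).differentiableAt
        exact (h.comp w (by fun_prop : DifferentiableAt ℂ (fun w => a + w) w)).differentiableWithinAt)
      (fun w hw => hre _ (hm w hw)) hR hz (by simpa using hga)
    exact this
  have hder : ‖deriv g a‖ ≤ (2 * M) / (R/2) := by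
    refine Complex.norm_deriv_le_of_forall_mem_sphere_norm_le (by positivity) ?_ ?_
    · refine DifferentiableOn.diffContOnCl (fun w hw => ?_)
      have : w ∈ Metric.ball a R := by
        rw [closure_ball a (by positivity)] at hw
        exact Metric.closedBall_subset_ball (by linarith) hw
      exact (hg w this).differentiableAt.differentiableWithinAt
    · intro z hz
      have hz' : ‖z - a‖ = R/2 := by simpa [dist_eq_norm] using hz
      have := key (z - a) (by simp [hz']; linarith)
      rw [hz', add_sub_cancel] at this
      refine this.trans (le_of_eq ?_)
      field_simp; ring
  rw [(hg a ha).deriv] at hder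
  refine hder.trans (le_of_eq ?_)
  field_simp; norm_num

/-- Growth from logarithmic derivative bounds. -/
theorem zz_growth {f : ℂ → ℂ} {a b : ℂ} {M : ℝ} (hM : 0 ≤ M) (hfa : f a ≠ 0)
    (hf : ∀ z ∈ segment ℝ a b, DifferentiableAt ℂ f z)
    (hb : ∀ z ∈ segment ℝ a b, ‖deriv f z‖ ≤ M * ‖f z‖) :
    ‖f b - f a‖ ≤ ‖f a‖ * (Real.exp (M * ‖b - a‖) - 1) := by
  set γ : ℝ → ℂ := fun t => a + t * (b - a) with hγ
  have hmem : ∀ t ∈ Set.Icc (0:ℝ) 1, γ t ∈ segment ℝ a b := by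
    intro t ht
    rw [segment_eq_image']
    exact ⟨t, ht, by simp [hγ]⟩
  have hγd : ∀ t : ℝ, HasDerivAt γ (b - a) t := by
    intro t
    have : HasDerivAt (fun t : ℝ => (t:ℂ)) 1 t := Complex.ofRealCLM.hasDerivAt
    simpa [hγ] using (this.mul_const (b-a)).const_add a
  have hd : ∀ t ∈ Set.Icc (0:ℝ) 1,
      HasDerivAt (fun t => f (γ t) - f a) ((b - a) * deriv f (γ t)) t := by
    intro t ht
    have := HasDerivAt.scomp t ((hf _ (hmem t ht)).hasDerivAt) (hγd t)
    simpa [Function.comp] using this.sub_const (f a)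
  set K := M * ‖b - a‖ with hK
  have hK0 : 0 ≤ K := by positivity
  have := norm_le_gronwallBound_of_norm_deriv_right_le (f := fun t => f (γ t) - f a)
    (f' := fun t => (b - a) * deriv f (γ t)) (δ := 0) (K := K) (ε := K * ‖f a‖) (a := 0) (b := 1)
    (fun t ht => (hd t ht).continuousAt.continuousWithinAt)
    (fun t ht => (hd t ⟨ht.1, ht.2.le⟩).hasDerivWithinAt)
    (by simp [hγ]) (fun t ht => by
      rw [norm_mul]
      have h1 := hb _ (hmem t ⟨ht.1, ht.2.le⟩)
      have h2 : ‖f (γ t)‖ ≤ ‖f (γ t) - f a‖ + ‖f a‖ := by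
        simpa using norm_add_le (f (γ t) - f a) (f a)
      calc ‖b - a‖ * ‖deriv f (γ t)‖ ≤ ‖b - a‖ * (M * (‖f (γ t) - f a‖ + ‖f a‖)) := by
            gcongr; exact h1.trans (by gcongr)
        _ = _ := by rw [hK]; ring) 1 (by simp)
  have h3 : γ 1 = b := by simp [hγ]
  rw [h3] at this
  refine this.trans ?_
  rcases hK0.eq_or_lt with h | h
  · rw [← h, gronwallBound_K0]; simp
  · rw [gronwallBound_of_K_ne_0 h.ne']
    simp
    field_simp
    exact le_refl _

/-- Gaussian-localised maximum modulus principle in a rectangle. -/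
theorem zz_gauss_max {E : ℂ → ℂ} {s₁ : ℂ} {x h A B : ℝ} (hx : 1 ≤ x) (hh : 1 ≤ h)
    (hA : 0 ≤ A)
    (h1 : -3/2 ≤ s₁.re) (h2 : s₁.re ≤ 5/2)
    (hd : ∀ z : ℂ, -3/2 ≤ z.re → z.re ≤ 5/2 → |z.im - s₁.im| ≤ h → DifferentiableAt ℂ E z)
    (hr : ∀ z : ℂ, z.re = 5/2 → |z.im - s₁.im| ≤ h → ‖E z‖ * x ^ 2 ≤ A)
    (hl : ∀ z : ℂ, z.re = -3/2 → |z.im - s₁.im| ≤ h → ‖E z‖ ≤ A * x ^ 2)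
    (hc : ∀ z : ℂ, -3/2 ≤ z.re → z.re ≤ 5/2 → |z.im - s₁.im| = h → ‖E z‖ ≤ B)
    (hBA : B * x ^ 2 * Real.exp (- h ^ 2) ≤ A) :
    ‖E s₁‖ ≤ Real.exp 16 * A * x ^ (1/2 - s₁.re) := by
  have hx0 : 0 < x := by linarith
  set U : Set ℂ := (Set.Ioo (-3/2 : ℝ) (5/2)) ×ℂ (Set.Ioo (s₁.im - h) (s₁.im + h)) with hU
  set g : ℂ → ℂ := fun z => E z * (x:ℂ) ^ (z - 1/2) * Complex.exp ((z - s₁)^2) with hg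
  have hclos : closure U = (Set.Icc (-3/2 : ℝ) (5/2)) ×ℂ (Set.Icc (s₁.im - h) (s₁.im + h)) := by
    rw [hU, Complex.closure_reProdIm, closure_Ioo (by norm_num), closure_Ioo (by linarith)]
  have hcl : ∀ z ∈ closure U, -3/2 ≤ z.re ∧ z.re ≤ 5/2 ∧ |z.im - s₁.im| ≤ h := by
    intro z hz
    rw [hclos, Complex.mem_reProdIm] at hz
    refine ⟨hz.1.1, hz.1.2, ?_⟩
    rw [abs_le]; constructor <;> linarith [hz.2.1, hz.2.2]
  have hbd : Bornology.IsBounded U :=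
    (Metric.isBounded_Ioo _ _).reProdIm (Metric.isBounded_Ioo _ _)
  have hdg : DiffContOnCl ℂ g U := by
    refine DifferentiableOn.diffContOnCl (fun z hz => ?_)
    obtain ⟨a, b, c⟩ := hcl z hz
    have := hd z a b c
    have hxx : (x:ℂ) ≠ 0 := by exact_mod_cast hx0.ne'
    refine DifferentiableAt.differentiableWithinAt ?_
    refine DifferentiableAt.mul (this.mul ?_) (by fun_prop)
    exact DifferentiableAt.const_cpow (by fun_prop) (Or.inl hxx)
  have hnorm : ∀ z : ℂ, ‖g z‖ = ‖E z‖ * x ^ (z.re - 1/2) *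
      Real.exp ((z.re - s₁.re)^2 - (z.im - s₁.im)^2) := by
    intro z
    simp only [hg, norm_mul]
    rw [Complex.norm_cpow_eq_rpow_re_of_pos hx0, Complex.norm_exp]
    congr 2
    · simp
    · simp [pow_two]
  have hfr : ∀ z ∈ frontier U, ‖g z‖ ≤ Real.exp 16 * A := by
    intro z hz
    have hzc : z ∈ closure U := frontier_subset_closure hz
    obtain ⟨a, b, c⟩ := hcl z hzc
    have hzU : z ∉ U := by
      have : IsOpen U := isOpen_Ioo.reProdIm isOpen_Ioo
      rw [this.frontier_eq] at hz; exact hz.2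
    have hsq : (z.re - s₁.re)^2 ≤ 16 := by nlinarith
    rw [hnorm]
    have h16 : (1:ℝ) ≤ Real.exp 16 := Real.one_le_exp (by norm_num)
    by_cases hr5 : z.re = 5/2
    · have h5 : x ^ (z.re - 1/2) = x ^ 2 := by
        rw [hr5, ← Real.rpow_natCast]; norm_num
      rw [h5, mul_comm (Real.exp 16)]
      refine mul_le_mul (hr z hr5 c) (Real.exp_le_exp.mpr ?_) (Real.exp_nonneg _) hA
      nlinarith [sq_nonneg (z.im - s₁.im)]
    by_cases hl5 : z.re = -3/2
    · have h5 : x ^ (z.re - 1/2) = (x ^ 2)⁻¹ := by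
        rw [hl5, ← Real.rpow_natCast, ← Real.rpow_neg hx0.le]; norm_num
      rw [h5, mul_comm (Real.exp 16)]
      refine mul_le_mul ?_ (Real.exp_le_exp.mpr ?_) (Real.exp_nonneg _) hA
      · rw [← div_eq_mul_inv, div_le_iff₀ (by positivity)]; exact hl z hl5 c
      · nlinarith [sq_nonneg (z.im - s₁.im)]
    have him : |z.im - s₁.im| = h := by
      by_contra hne
      apply hzU
      have hlt := lt_of_le_of_ne c hne
      rw [abs_lt] at hlt
      rw [hU, Complex.mem_reProdIm]
      exact ⟨⟨lt_of_le_of_ne a (Ne.symm hl5), lt_of_le_of_ne b hr5⟩, by linarith [hlt.1], by linarith [hlt.2]⟩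
    have hB := hc z a b him
    have hB0 : 0 ≤ B := (norm_nonneg _).trans hB
    have h6 : x ^ (z.re - 1/2) ≤ x ^ 2 := by
      rw [← Real.rpow_natCast]
      apply Real.rpow_le_rpow_of_exponent_le hx
      norm_num; linarith
    have h7 : (z.im - s₁.im)^2 = h^2 := by rw [← him, sq_abs]
    calc ‖E z‖ * x ^ (z.re - 1/2) * Real.exp ((z.re - s₁.re)^2 - (z.im - s₁.im)^2)
        ≤ B * x ^ 2 * Real.exp (16 - h^2) := by
          have h9 : Real.exp ((z.re - s₁.re)^2 - (z.im - s₁.im)^2) ≤ Real.exp (16 - h^2) :=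
            Real.exp_le_exp.mpr (by rw [h7]; linarith)
          exact mul_le_mul (mul_le_mul hB h6 (by positivity) hB0) h9 (Real.exp_nonneg _)
            (by positivity)
      _ = Real.exp 16 * (B * x^2 * Real.exp (-h^2)) := by
          rw [sub_eq_add_neg, Real.exp_add]; ring
      _ ≤ _ := by gcongr
  have hs : s₁ ∈ closure U := by
    rw [hclos, Complex.mem_reProdIm]
    exact ⟨⟨h1, h2⟩, by linarith, by linarith⟩
  have := Complex.norm_le_of_forall_mem_frontier_norm_le hbd hdg hfr hs
  rw [hnorm] at this
  simp only [sub_self, ne_eq, OfNat.ofNat_ne_zero, not_false_eq_true, zero_pow, Real.exp_zero,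
    mul_one] at this
  have h8 : x ^ (s₁.re - 1/2) * x ^ (1/2 - s₁.re) = 1 := by
    rw [← Real.rpow_add hx0]; simp
  calc ‖E s₁‖ = ‖E s₁‖ * x ^ (s₁.re - 1/2) * x ^ (1/2 - s₁.re) := by rw [mul_assoc, h8, mul_one]
    _ ≤ _ := by gcongr

/-- A function with derivative of positive real part on a convex set is injective. -/
theorem zz_inj {f : ℂ → ℂ} {a b : ℂ}
    (hf : ∀ z ∈ segment ℝ a b, DifferentiableAt ℂ f z)
    (hre : ∀ z ∈ segment ℝ a b, 0 < (deriv f z).re) (hab : f a = f b) : a = b := by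
  by_contra hne
  set γ : ℝ → ℂ := fun t => a + t * (b - a) with hγ
  have hmem : ∀ t ∈ Set.Icc (0:ℝ) 1, γ t ∈ segment ℝ a b := by
    intro t ht
    rw [segment_eq_image']
    exact ⟨t, ht, by simp [hγ]⟩
  have hγd : ∀ t : ℝ, HasDerivAt γ (b - a) t := by
    intro t
    have : HasDerivAt (fun t : ℝ => (t:ℂ)) 1 t := Complex.ofRealCLM.hasDerivAt
    simpa [hγ] using (this.mul_const (b-a)).const_add a
  have hba : b - a ≠ 0 := sub_ne_zero.mpr (Ne.symm hne)
  have hd : ∀ t ∈ Set.Icc (0:ℝ) 1,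
      HasDerivAt (fun t => (f (γ t) / (b - a)).re) (deriv f (γ t)).re t := by
    intro t ht
    have h1 := HasDerivAt.scomp t ((hf _ (hmem t ht)).hasDerivAt) (hγd t)
    have h2 := h1.div_const (b - a)
    have h3 : HasDerivAt (fun t => (f (γ t) / (b - a))) (deriv f (γ t)) t := by
      have e : (b - a) • deriv f (γ t) / (b - a) = deriv f (γ t) := by
        rw [smul_eq_mul]; field_simp
      rw [e] at h2
      exact h2
    exact Complex.reCLM.hasFDerivAt.comp_hasDerivAt t h3
  obtain ⟨c, hc, hc2⟩ := exists_hasDerivAt_eq_slope (fun t => (f (γ t) / (b - a)).re)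
    (fun t => (deriv f (γ t)).re) (by norm_num : (0:ℝ) < 1)
    (fun t ht => (hd t ht).continuousAt.continuousWithinAt) (fun t ht => hd t ⟨ht.1.le, ht.2.le⟩)
  have h0 := hre _ (hmem c ⟨hc.1.le, hc.2.le⟩)
  simp only [hc2] at h0
  simp [hγ, hab] at h0


/-- Partial sums of a sequence from `m`. -/
def zzX (c : ℕ → ℂ) (m : ℕ) (t : ℝ) : ℂ := ∑ n ∈ Finset.Ioc m ⌊t⌋₊, c n

theorem zzX_intble (c : ℕ → ℂ) (m : ℕ) {a b : ℝ} (ha : 0 < a) (hab : a ≤ b) :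
    IntervalIntegrable (fun x => ‖zzX c m x‖ / x) MeasureTheory.volume a b := by
  rw [intervalIntegrable_iff_integrableOn_Ioc_of_le hab]
  have hm : Measurable (fun x : ℝ => ‖zzX c m x‖ / x) := by
    refine Measurable.div ?_ measurable_id
    have : Measurable (fun k : ℕ => ‖∑ n ∈ Finset.Ioc m k, c n‖) := measurable_from_nat
    exact this.comp Nat.measurable_floor
  refine MeasureTheory.Measure.integrableOn_of_bounded (M := (∑ n ∈ Finset.Ioc m ⌊b⌋₊, ‖c n‖) / a)
    (by simp) hm.aestronglyMeasurable ?_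
  refine (MeasureTheory.ae_restrict_iff' measurableSet_Ioc).mpr (Filter.Eventually.of_forall ?_)
  intro x hx
  have hx0 : 0 < x := ha.trans hx.1
  rw [norm_div, norm_norm, Real.norm_of_nonneg hx0.le]
  refine div_le_div₀ ?_ ?_ ha ?_
  · exact Finset.sum_nonneg (fun _ _ => norm_nonneg _)
  · refine (norm_sum_le _ _).trans (Finset.sum_le_sum_of_subset_of_nonneg ?_ (fun _ _ _ => norm_nonneg _))
    exact Finset.Ioc_subset_Ioc_right (Nat.floor_le_floor hx.2)
  · exact hx.1.le

theorem zz_abel (c : ℕ → ℂ) (m : ℕ) {a b : ℝ} (ha : 0 < a) (hab : a ≤ b) (hm : m ≤ ⌊a⌋₊)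
    (w : ℂ) (K : ℝ) (hK : ∀ x, a ≤ x → x ≤ b → x ^ (-w.re) ≤ K) :
    ‖(∑ n ∈ Finset.Ioc ⌊a⌋₊ ⌊b⌋₊, c n * (n:ℂ) ^ (-w)) + zzX c m a * (a:ℂ) ^ (-w)‖ ≤
      K * (1 + ‖w‖) * (‖zzX c m b‖ + ∫ x in a..b, ‖zzX c m x‖ / x) := by
  have hb : 0 < b := ha.trans_le hab
  set c' : ℕ → ℂ := fun n => if m < n then c n else 0 with hc'
  have hsum : ∀ t : ℝ, ∑ k ∈ Finset.Icc 0 ⌊t⌋₊, c' k = zzX c m t := by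
    intro t
    rw [zzX, hc', ← Finset.sum_filter]
    congr 1
    ext k; simp; tauto
  have hder : ∀ t : ℝ, 0 < t → HasDerivAt (fun t : ℝ => (t:ℂ) ^ (-w)) (-w * (t:ℂ) ^ (-w - 1)) t := by
    intro t ht
    by_cases hw : w = 0
    · simp only [hw, neg_zero, Complex.cpow_zero, zero_mul]
      exact hasDerivAt_const _ _
    · exact hasDerivAt_ofReal_cpow_const ht.ne' (neg_ne_zero.mpr hw)
  have hdiff : ∀ t ∈ Set.Icc a b, DifferentiableAt ℝ (fun t : ℝ => (t:ℂ) ^ (-w)) t :=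
    fun t ht => (hder t (ha.trans_le ht.1)).differentiableAt
  have hintg : MeasureTheory.IntegrableOn (deriv (fun t : ℝ => (t:ℂ) ^ (-w))) (Set.Icc a b) := by
    have : ContinuousOn (fun t : ℝ => -w * (t:ℂ) ^ (-w - 1)) (Set.Icc a b) := by
      intro t ht
      have ht0 := ha.trans_le ht.1
      refine ContinuousAt.continuousWithinAt ?_
      refine continuousAt_const.mul ?_
      exact Complex.continuousAt_ofReal_cpow_const _ _ (Or.inr ht0.ne')
    refine (this.integrableOn_Icc).congr_fun ?_ measurableSet_Icc
    intro t ht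
    exact (hder t (ha.trans_le ht.1)).deriv.symm
  have key := sum_mul_eq_sub_sub_integral_mul c' ha.le hab hdiff hintg
  simp only [hsum] at key
  have e1 : ∑ k ∈ Finset.Ioc ⌊a⌋₊ ⌊b⌋₊, ((k:ℝ):ℂ) ^ (-w) * c' k =
      ∑ n ∈ Finset.Ioc ⌊a⌋₊ ⌊b⌋₊, c n * (n:ℂ) ^ (-w) := by
    refine Finset.sum_congr rfl (fun k hk => ?_)
    have : m < k := lt_of_le_of_lt hm (Finset.mem_Ioc.mp hk).1
    simp [hc', this, mul_comm]
  rw [e1] at key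
  rw [key]
  have e2 : (b:ℂ) ^ (-w) * zzX c m b - (a:ℂ) ^ (-w) * zzX c m a -
      (∫ t in Set.Ioc a b, deriv (fun t : ℝ => (t:ℂ) ^ (-w)) t * zzX c m t) + zzX c m a * (a:ℂ) ^ (-w)
      = (b:ℂ) ^ (-w) * zzX c m b -
      (∫ t in Set.Ioc a b, deriv (fun t : ℝ => (t:ℂ) ^ (-w)) t * zzX c m t) := by ring
  rw [e2]
  have hK0 : 0 ≤ K := (Real.rpow_nonneg ha.le _).trans (hK a le_rfl hab)
  have hI0 : 0 ≤ ∫ x in a..b, ‖zzX c m x‖ / x := by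
    refine intervalIntegral.integral_nonneg hab (fun x hx => ?_)
    have := ha.trans_le hx.1
    positivity
  have i1 : ‖(b:ℂ) ^ (-w) * zzX c m b‖ ≤ K * ‖zzX c m b‖ := by
    rw [norm_mul, Complex.norm_cpow_eq_rpow_re_of_pos hb]
    gcongr
    simpa using hK b hab le_rfl
  have i2 : ‖∫ t in Set.Ioc a b, deriv (fun t : ℝ => (t:ℂ) ^ (-w)) t * zzX c m t‖ ≤
      K * ‖w‖ * ∫ x in a..b, ‖zzX c m x‖ / x := by
    rw [← intervalIntegral.integral_of_le hab, ← intervalIntegral.integral_const_mul]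
    refine intervalIntegral.norm_integral_le_of_norm_le hab ?_ ((zzX_intble c m ha hab).const_mul _)
    refine Filter.Eventually.of_forall (fun t ht => ?_)
    have ht0 : 0 < t := ha.trans ht.1
    rw [(hder t ht0).deriv, norm_mul, norm_mul, norm_neg, Complex.norm_cpow_eq_rpow_re_of_pos ht0]
    have h1 := hK t ht.1.le ht.2
    have h2 : t ^ ((-w - 1).re) = t ^ (-w.re) / t := by
      simp only [Complex.sub_re, Complex.neg_re, Complex.one_re]
      rw [Real.rpow_sub ht0, Real.rpow_one]
    rw [h2]
    calc ‖w‖ * (t ^ (-w.re) / t) * ‖zzX c m t‖ ≤ ‖w‖ * (K / t) * ‖zzX c m t‖ := by gcongr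
      _ = _ := by ring
  refine (norm_sub_le _ _).trans ((add_le_add i1 i2).trans ?_)
  have := norm_nonneg w
  have := norm_nonneg (zzX c m b)
  have h3 : 0 ≤ K * ‖w‖ * ‖zzX c m b‖ := by positivity
  have h4 : 0 ≤ K * ∫ x in a..b, ‖zzX c m x‖ / x := by positivity
  nlinarith

/-- Choosing a good truncation point. -/
theorem zz_avg (c : ℕ → ℂ) (m : ℕ) {a b X δ : ℝ} (ha : 0 < a) (haX : a ≤ X) (hXb : 2 * X ≤ b)
    (hδ : (∫ x in a..b, ‖zzX c m x‖ / x) < δ) :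
    ∃ x, X ≤ x ∧ x ≤ 2 * X ∧ ‖zzX c m x‖ ≤ 2 * δ := by
  by_contra hcon
  push Not at hcon
  have hX : 0 < X := ha.trans_le haX
  have hX2 : X ≤ 2 * X := by linarith
  have i0 := zzX_intble c m ha haX
  have i1 := zzX_intble c m hX hX2
  have i2 := zzX_intble c m (by linarith) hXb
  have hnn : ∀ u v : ℝ, 0 < u → u ≤ v → 0 ≤ ∫ x in u..v, ‖zzX c m x‖ / x := by
    intro u v hu huv
    refine intervalIntegral.integral_nonneg huv (fun x hx => ?_)
    have := hu.trans_le hx.1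
    positivity
  have h1 : (∫ x in a..b, ‖zzX c m x‖ / x) = (∫ x in a..X, ‖zzX c m x‖ / x) +
      (∫ x in X..(2*X), ‖zzX c m x‖ / x) + ∫ x in (2*X)..b, ‖zzX c m x‖ / x := by
    rw [intervalIntegral.integral_add_adjacent_intervals i0 i1,
      intervalIntegral.integral_add_adjacent_intervals (i0.trans i1) i2]
  have hδ0 : 0 < δ := lt_of_le_of_lt (hnn a b ha (by linarith)) hδ
  have h2 : (∫ x in X..(2*X), (δ / X : ℝ)) ≤ ∫ x in X..(2*X), ‖zzX c m x‖ / x := by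
    refine intervalIntegral.integral_mono_on hX2 (by simp) i1 (fun x hx => ?_)
    have hx0 := hX.trans_le hx.1
    rw [div_le_div_iff₀ hX hx0]
    have := (hcon x hx.1 hx.2).le
    calc δ * x ≤ δ * (2 * X) := by gcongr; exact hx.2
      _ = 2 * δ * X := by ring
      _ ≤ _ := by gcongr
  have h3 : (∫ x in X..(2*X), (δ / X : ℝ)) = δ := by
    rw [intervalIntegral.integral_const]; simp; field_simp; ring
  have := hnn a X ha haX
  have := hnn (2*X) b (by linarith) hXb
  linarith

/-- Product of twisted Dirichlet polynomials. -/
theorem zz_dp_mul (f g : ArithmeticFunction ℂ) (φ : ℕ → ℂ) (N M : ℕ)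
    (hf : ∀ n, N < n → f n = 0) (hg : ∀ n, M < n → g n = 0)
    (hφ : ∀ a b, a ≠ 0 → b ≠ 0 → φ (a * b) = φ a * φ b) :
    (∑ n ∈ Finset.Icc 1 (N * M), (f * g) n * φ n) =
      (∑ n ∈ Finset.Icc 1 N, f n * φ n) * (∑ n ∈ Finset.Icc 1 M, g n * φ n) := by
  rw [Finset.sum_mul_sum, ← Finset.sum_product']
  simp_rw [ArithmeticFunction.mul_apply, Finset.sum_mul]
  rw [Finset.sum_sigma']
  symm
  refine Finset.sum_of_injOn (fun q : ℕ × ℕ => (⟨q.1 * q.2, q⟩ : (_ : ℕ) × ℕ × ℕ)) ?_ ?_ ?_ ?_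
  · intro x _ y _ h
    simp only [Sigma.mk.injEq, heq_eq_eq] at h
    exact h.2
  · intro q hq
    simp only [Finset.coe_product, Set.mem_prod, Finset.mem_coe, Finset.mem_Icc] at hq
    simp only [Finset.mem_coe, Finset.mem_sigma, Finset.mem_Icc, Nat.mem_divisorsAntidiagonal]
    refine ⟨⟨?_, Nat.mul_le_mul hq.1.2 hq.2.2⟩, ?_⟩
    · exact Nat.mul_pos hq.1.1 hq.2.1
    · exact ⟨trivial, (Nat.mul_pos hq.1.1 hq.2.1).ne'⟩
  · rintro ⟨n, q⟩ hq hnq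
    simp only [Finset.mem_sigma, Finset.mem_Icc, Nat.mem_divisorsAntidiagonal] at hq
    obtain ⟨⟨h1, h2⟩, h3, h4⟩ := hq
    have hq0 : q.1 ≠ 0 ∧ q.2 ≠ 0 := by
      constructor <;> · intro h; apply h4; rw [← h3, h]; simp
    by_cases hN : N < q.1
    · simp [hf _ hN]
    by_cases hM : M < q.2
    · simp [hg _ hM]
    exfalso
    apply hnq
    refine ⟨q, ?_, ?_⟩
    · simp only [Finset.coe_product, Set.mem_prod, Finset.mem_coe, Finset.mem_Icc]
      omega
    · simp [h3]
  · intro q hq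
    simp only [Finset.mem_product, Finset.mem_Icc] at hq
    simp only
    rw [hφ _ _ (by omega) (by omega)]; ring

theorem zz_dp_supp (f g : ArithmeticFunction ℂ) (N M : ℕ)
    (hf : ∀ n, N < n → f n = 0) (hg : ∀ n, M < n → g n = 0) :
    ∀ n, N * M < n → (f * g) n = 0 := by
  intro n hn
  rw [ArithmeticFunction.mul_apply]
  refine Finset.sum_eq_zero (fun q hq => ?_)
  rw [Nat.mem_divisorsAntidiagonal] at hq
  by_cases hN : N < q.1
  · simp [hf _ hN]
  by_cases hM : M < q.2
  · simp [hg _ hM]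
  exfalso
  push Not at hN hM
  have := Nat.mul_le_mul hN hM
  omega

theorem zz_dp_pow (f : ArithmeticFunction ℂ) (φ : ℕ → ℂ) (N : ℕ)
    (hf : ∀ n, N < n → f n = 0) (h1 : φ 1 = 1)
    (hφ : ∀ a b, a ≠ 0 → b ≠ 0 → φ (a * b) = φ a * φ b) (k : ℕ) :
    (∀ n, N ^ k < n → (f ^ k) n = 0) ∧
    (∑ n ∈ Finset.Icc 1 (N ^ k), (f ^ k) n * φ n) = (∑ n ∈ Finset.Icc 1 N, f n * φ n) ^ k := by
  induction k with
  | zero =>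
    constructor
    · intro n hn
      simp only [pow_zero] at hn ⊢
      exact ArithmeticFunction.one_apply_ne (by omega)
    · simp [h1]
  | succ k ih =>
    refine ⟨?_, ?_⟩
    · rw [pow_succ, pow_succ]
      exact zz_dp_supp _ _ _ _ ih.1 hf
    · rw [pow_succ, pow_succ, zz_dp_mul _ _ φ _ _ ih.1 hf hφ, ih.2, pow_succ]


/-- `D` is sufficiently large. -/
def zzBig (D : ℕ) : Prop := (10:ℝ) ^ 100 ≤ bigL D ∧ bigL D ^ 20000 ≤ Real.exp (bigL D)

theorem zzBig.pos {D : ℕ} (h : zzBig D) : 0 < bigL D := lt_of_lt_of_le (by norm_num) h.1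
theorem zzBig.one {D : ℕ} (h : zzBig D) : 1 ≤ bigL D := le_trans (by norm_num) h.1

theorem zzBig.D_pos {D : ℕ} (h : zzBig D) : 0 < D := by
  rcases Nat.eq_zero_or_pos D with h0 | h0
  · have := h.pos; simp [bigL, h0] at this
  · exact h0

theorem zzBig.exp {D : ℕ} (h : zzBig D) : Real.exp (bigL D) = D :=
  Real.exp_log (by exact_mod_cast h.D_pos)

theorem zzBig.D_one {D : ℕ} (h : zzBig D) : (1:ℝ) ≤ D := by exact_mod_cast h.D_pos

theorem zzBig_ev : ∃ D₀ : ℕ, ∀ D : ℕ, D₀ ≤ D → zzBig D := by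
  have h1 : Filter.Tendsto (fun D : ℕ => bigL D) Filter.atTop Filter.atTop :=
    Real.tendsto_log_atTop.comp tendsto_natCast_atTop_atTop
  have h2 : ∀ᶠ x : ℝ in Filter.atTop, (10:ℝ) ^ 100 ≤ x ∧ x ^ 20000 ≤ Real.exp x := by
    refine (Filter.eventually_ge_atTop _).and ?_
    have := (Real.isLittleO_pow_exp_atTop (n := 20000)).bound (by norm_num : (0:ℝ) < 1)
    filter_upwards [this] with x hx
    rw [Real.norm_eq_abs, Real.norm_eq_abs, Real.abs_exp, one_mul] at hx
    exact (le_abs_self _).trans hx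
  exact Filter.eventually_atTop.mp (h1.eventually h2)

theorem s0_re (D : ℕ) : (s0 D).re = 1/2 := by simp [s0]
theorem s0_im (D : ℕ) : (s0 D).im = 2 * Real.pi * t0 D := by simp [s0]

theorem zz_nu_norm (D : ℕ) (χ : DirichletCharacter ℂ D) (n : ℕ) : ‖nuF D χ n‖ ≤ n := by
  refine (norm_sum_le _ _).trans ?_
  calc ∑ d ∈ n.divisors, ‖χ (d : ZMod D)‖ ≤ ∑ d ∈ n.divisors, (1:ℝ) :=
        Finset.sum_le_sum (fun d _ => DirichletCharacter.norm_le_one χ _)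
    _ = (n.divisors.card : ℝ) := by simp
    _ ≤ n := by exact_mod_cast Nat.card_divisors_le_self n

theorem zz_nu_real {D : ℕ} {χ : DirichletCharacter ℂ D} (hχ : IsRealChar χ) (n : ℕ) :
    (starRingEnd ℂ) (nuF D χ n) = nuF D χ n := by
  rw [nuF, map_sum]
  refine Finset.sum_congr rfl (fun d _ => ?_)
  exact Complex.conj_eq_iff_im.mpr (hχ _)

/-- twisted power -/
def zzphi {p : ℕ} (ψ : DirichletCharacter ℂ p) (s : ℂ) (n : ℕ) : ℂ :=
  ψ (n : ZMod p) * (n : ℂ) ^ (-s)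

theorem zzphi_one {p : ℕ} (ψ : DirichletCharacter ℂ p) (s : ℂ) : zzphi ψ s 1 = 1 := by
  simp [zzphi]

theorem zzphi_mul {p : ℕ} (ψ : DirichletCharacter ℂ p) (s : ℂ) (a b : ℕ) :
    zzphi ψ s (a * b) = zzphi ψ s a * zzphi ψ s b := by
  simp only [zzphi, Nat.cast_mul, map_mul]
  rw [Complex.natCast_mul_natCast_cpow]; ring

theorem zz_phi_split {p : ℕ} (ψ : DirichletCharacter ℂ p) (s s' : ℂ) {n : ℕ} (hn : n ≠ 0) (c : ℂ) :
    c * zzphi ψ s n = c * ψ (n : ZMod p) * (n:ℂ) ^ (-s') * (n:ℂ) ^ (-(s - s')) := by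
  have : (n:ℂ) ^ (-s) = (n:ℂ) ^ (-s') * (n:ℂ) ^ (-(s - s')) := by
    rw [← Complex.cpow_add _ _ (by exact_mod_cast hn)]; congr 1; ring
  rw [zzphi, this]; ring

theorem nuT_apply (D : ℕ) (χ : DirichletCharacter ℂ D) (n : ℕ) :
    nuT D χ n = if n = 0 then 0 else if n ≤ D ^ 4 then nuF D χ n else 0 := rfl
theorem upsT_apply (D : ℕ) (χ : DirichletCharacter ℂ D) (n : ℕ) :
    upsT D χ n = if n = 0 then 0 else if n ≤ D ^ 4 then upsF D χ n else 0 := rfl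

theorem zz_F_dp (D : ℕ) (χ : DirichletCharacter ℂ D) {p : ℕ} (ψ : DirichletCharacter ℂ p) (s : ℂ) :
    Ffun D χ ψ s = ∑ n ∈ Finset.Icc 1 (D ^ 4), nuT D χ n * zzphi ψ s n := by
  refine Finset.sum_congr rfl (fun n hn => ?_)
  rw [Finset.mem_Icc] at hn
  rw [nuT_apply, if_neg (by omega), if_pos hn.2, zzphi, mul_assoc]

theorem zz_G_dp (D : ℕ) (χ : DirichletCharacter ℂ D) {p : ℕ} (ψ : DirichletCharacter ℂ p) (s : ℂ) :
    Gfun D χ ψ s = ∑ n ∈ Finset.Icc 1 (D ^ 4), upsT D χ n * zzphi ψ s n := by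
  refine Finset.sum_congr rfl (fun n hn => ?_)
  rw [Finset.mem_Icc] at hn
  rw [upsT_apply, if_neg (by omega), if_pos hn.2, zzphi, mul_assoc]

theorem nuT_supp (D : ℕ) (χ : DirichletCharacter ℂ D) (n : ℕ) (hn : D ^ 4 < n) : nuT D χ n = 0 := by
  rw [nuT_apply, if_neg (by omega), if_neg (by omega)]
theorem upsT_supp (D : ℕ) (χ : DirichletCharacter ℂ D) (n : ℕ) (hn : D ^ 4 < n) :
    upsT D χ n = 0 := by
  rw [upsT_apply, if_neg (by omega), if_neg (by omega)]

theorem zz_F20 (D : ℕ) (χ : DirichletCharacter ℂ D) {p : ℕ} (ψ : DirichletCharacter ℂ p) (s : ℂ) :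
    Ffun D χ ψ s ^ 20 = ∑ n ∈ Finset.Icc 1 (D ^ 80), nu20 D χ n * zzphi ψ s n := by
  rw [zz_F_dp, ← (zz_dp_pow (nuT D χ) (zzphi ψ s) (D^4) (nuT_supp D χ) (zzphi_one ψ s)
    (fun a b _ _ => zzphi_mul ψ s a b) 20).2, ← pow_mul]
  rfl

theorem zz_G20 (D : ℕ) (χ : DirichletCharacter ℂ D) {p : ℕ} (ψ : DirichletCharacter ℂ p) (s : ℂ) :
    Gfun D χ ψ s ^ 20 = ∑ n ∈ Finset.Icc 1 (D ^ 80), ups20 D χ n * zzphi ψ s n := by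
  rw [zz_G_dp, ← (zz_dp_pow (upsT D χ) (zzphi ψ s) (D^4) (upsT_supp D χ) (zzphi_one ψ s)
    (fun a b _ _ => zzphi_mul ψ s a b) 20).2, ← pow_mul]
  rfl

/-- `χ` as an arithmetic function. -/
def zzchiA (D : ℕ) (χ : DirichletCharacter ℂ D) : ArithmeticFunction ℂ :=
  ⟨fun n => if n = 0 then 0 else χ n, by simp⟩
theorem zzchiA_apply (D : ℕ) (χ : DirichletCharacter ℂ D) {n : ℕ} (hn : n ≠ 0) :
    zzchiA D χ n = χ n := if_neg hn
/-- `μχ` as an arithmetic function. -/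
def zzmuchiA (D : ℕ) (χ : DirichletCharacter ℂ D) : ArithmeticFunction ℂ :=
  ⟨fun n => if n = 0 then 0 else (ArithmeticFunction.moebius n : ℂ) * χ n, by simp⟩
theorem zzmuchiA_apply (D : ℕ) (χ : DirichletCharacter ℂ D) {n : ℕ} (hn : n ≠ 0) :
    zzmuchiA D χ n = (ArithmeticFunction.moebius n : ℂ) * χ n := if_neg hn
/-- `ν` as arithmetic function -/
def zznu (D : ℕ) (χ : DirichletCharacter ℂ D) : ArithmeticFunction ℂ :=
  (ArithmeticFunction.zeta : ArithmeticFunction ℂ) * zzchiA D χ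
/-- `υ` as arithmetic function -/
def zzups (D : ℕ) (χ : DirichletCharacter ℂ D) : ArithmeticFunction ℂ :=
  ((ArithmeticFunction.moebius : ArithmeticFunction ℤ) : ArithmeticFunction ℂ) * zzmuchiA D χ

theorem zznu_apply (D : ℕ) (χ : DirichletCharacter ℂ D) (n : ℕ) : zznu D χ n = nuF D χ n := by
  rw [zznu, ArithmeticFunction.coe_zeta_mul_apply, nuF]
  refine Finset.sum_congr rfl (fun d hd => ?_)
  have : d ≠ 0 := (Nat.pos_of_mem_divisors hd).ne'
  rw [zzchiA_apply _ _ this]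

theorem zzups_apply (D : ℕ) (χ : DirichletCharacter ℂ D) (n : ℕ) : zzups D χ n = upsF D χ n := by
  rw [zzups, mul_comm, ArithmeticFunction.mul_apply, upsF,
    Nat.sum_divisorsAntidiagonal (fun a b => zzmuchiA D χ a *
      ((ArithmeticFunction.moebius : ArithmeticFunction ℤ) : ArithmeticFunction ℂ) b)]
  refine Finset.sum_congr rfl (fun d hd => ?_)
  have : d ≠ 0 := (Nat.pos_of_mem_divisors hd).ne'
  rw [zzmuchiA_apply _ _ this, ArithmeticFunction.intCoe_apply]; ring

theorem zz_conv_one (D : ℕ) (χ : DirichletCharacter ℂ D) : zznu D χ * zzups D χ = 1 := by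
  rw [zznu, zzups, mul_mul_mul_comm, ArithmeticFunction.coe_zeta_mul_coe_moebius, one_mul]
  ext n
  rcases Nat.eq_zero_or_pos n with rfl | hn
  · simp
  rw [ArithmeticFunction.mul_apply]
  have : ∀ q ∈ n.divisorsAntidiagonal, zzchiA D χ q.1 * zzmuchiA D χ q.2 =
        χ n * (((ArithmeticFunction.zeta : ArithmeticFunction ℂ) q.1) *
          (((ArithmeticFunction.moebius : ArithmeticFunction ℤ) : ArithmeticFunction ℂ) q.2)) := by
    intro q hq
    rw [Nat.mem_divisorsAntidiagonal] at hq
    have h1 : q.1 ≠ 0 := by rintro h; rw [h] at hq; omega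
    have h2 : q.2 ≠ 0 := by rintro h; rw [h] at hq; omega
    rw [zzchiA_apply _ _ h1, zzmuchiA_apply _ _ h2, ← hq.1, ArithmeticFunction.intCoe_apply,
      ArithmeticFunction.natCoe_apply, ArithmeticFunction.zeta_apply_ne h1]
    push_cast
    rw [map_mul]; ring
  rw [Finset.sum_congr rfl this, ← Finset.mul_sum, ← ArithmeticFunction.mul_apply,
    ArithmeticFunction.coe_zeta_mul_coe_moebius]
  by_cases h : n = 1
  · simp [h]
  · simp [ArithmeticFunction.one_apply_ne h]

theorem zz_sig (D : ℕ) (χ : DirichletCharacter ℂ D) {n : ℕ} (hn : n ≠ 0) :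
    (nuT D χ * upsT D χ) n = sigF D χ n := by
  rw [ArithmeticFunction.mul_apply, sigF,
    Nat.sum_divisorsAntidiagonal (fun a b => nuT D χ a * upsT D χ b)]
  refine Finset.sum_congr rfl (fun d hd => ?_)
  have h1 : d ≠ 0 := (Nat.pos_of_mem_divisors hd).ne'
  have h2 : n / d ≠ 0 := (Nat.div_pos (Nat.divisor_le hd) (Nat.pos_of_mem_divisors hd)).ne'
  rw [nuT_apply, upsT_apply, if_neg h1, if_neg h2]
  by_cases h3 : d ≤ D ^ 4 <;> by_cases h4 : n / d ≤ D ^ 4 <;> simp [h3, h4]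

theorem zz_sig_low (D : ℕ) (χ : DirichletCharacter ℂ D) {n : ℕ} (hn : n ≠ 0) (hD : n ≤ D ^ 4) :
    (nuT D χ * upsT D χ) n = (1 : ArithmeticFunction ℂ) n := by
  rw [← zz_conv_one D χ, ArithmeticFunction.mul_apply, ArithmeticFunction.mul_apply]
  refine Finset.sum_congr rfl (fun q hq => ?_)
  rw [Nat.mem_divisorsAntidiagonal] at hq
  have h1 : q.1 ≠ 0 := by rintro h; rw [h] at hq; omega
  have h2 : q.2 ≠ 0 := by rintro h; rw [h] at hq; omega
  have h3 : q.1 ≤ n := Nat.le_of_dvd (by omega) ⟨_, hq.1.symm⟩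
  have h4 : q.2 ≤ n := Nat.le_of_dvd (by omega) ⟨q.1, by rw [mul_comm]; exact hq.1.symm⟩
  rw [zznu_apply, zzups_apply, nuT_apply, upsT_apply, if_neg h1, if_neg h2, if_pos (by omega),
    if_pos (by omega)]

theorem zz_FG {D : ℕ} (hD : 0 < D) (χ : DirichletCharacter ℂ D) {p : ℕ} (ψ : DirichletCharacter ℂ p)
    (s : ℂ) : Ffun D χ ψ s * Gfun D χ ψ s =
      1 + ∑ n ∈ Finset.Ioc (D ^ 4) (D ^ 8), sigF D χ n * zzphi ψ s n := by
  rw [zz_F_dp, zz_G_dp, ← zz_dp_mul _ _ (zzphi ψ s) _ _ (nuT_supp D χ) (upsT_supp D χ)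
    (fun a b _ _ => zzphi_mul ψ s a b), ← pow_add]
  have hD4 : 1 ≤ D ^ 4 := Nat.one_le_pow _ _ hD
  have hsplit : Finset.Icc 1 (D ^ (4 + 4)) = Finset.Icc 1 (D^4) ∪ Finset.Ioc (D^4) (D^8) := by
    have : D ^ 4 ≤ D ^ 8 := Nat.pow_le_pow_right hD (by norm_num)
    ext n; simp; omega
  rw [hsplit, Finset.sum_union (by
    rw [Finset.disjoint_left]; intro n hn hn'; simp at hn hn'; omega)]
  congr 1
  · rw [Finset.sum_eq_single_of_mem 1 (by simp; omega)]
    · rw [zz_sig_low D χ one_ne_zero hD4, zzphi_one]; simp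
    · intro n hn hn1
      rw [Finset.mem_Icc] at hn
      rw [zz_sig_low D χ (by omega) hn.2, ArithmeticFunction.one_apply_ne hn1, zero_mul]
  · refine Finset.sum_congr rfl (fun n hn => ?_)
    rw [Finset.mem_Ioc] at hn
    rw [zz_sig D χ (by omega)]


/-- The basic region. -/
def zzV (D : ℕ) (s : ℂ) : Prop :=
  1/2 - 1 / bigL D ≤ s.re ∧ s.re ≤ 1 + 1 / bigL D ∧ |s.im - 2 * Real.pi * t0 D| ≤ bigL D ^ 405 + 5

theorem zz_rpow_le {D : ℕ} (hD : zzBig D) {x u : ℝ} (k : ℕ) (hx : 1 ≤ x) (hxD : x ≤ (D:ℝ) ^ k)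
    (hu : - (1 / bigL D) ≤ u) : x ^ (-u) ≤ Real.exp k := by
  have hL := hD.pos
  have hx0 : 0 < x := by linarith
  rw [Real.rpow_def_of_pos hx0]
  apply Real.exp_le_exp.mpr
  have h0 : 0 ≤ Real.log x := Real.log_nonneg hx
  have h1 : Real.log x ≤ k * bigL D := by
    have := Real.log_le_log hx0 hxD
    rwa [Real.log_pow] at this
  calc Real.log x * -u ≤ Real.log x * (1 / bigL D) := by gcongr; linarith
    _ ≤ (k * bigL D) * (1 / bigL D) := by gcongr
    _ = k := by field_simp

theorem zz_pow_ge {D : ℕ} (hD : zzBig D) {k : ℕ} (hk : 1 ≤ k) : (10:ℝ)^100 ≤ bigL D ^ k :=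
  hD.1.trans (le_self_pow₀ hD.one (by omega))

theorem zz_w_norm {D : ℕ} (hD : zzBig D) {s : ℂ} (hs : zzV D s) :
    1 + ‖s - s0 D‖ ≤ 2 * bigL D ^ 405 := by
  have h1 := Complex.norm_le_abs_re_add_abs_im (s - s0 D)
  rw [Complex.sub_re, Complex.sub_im, s0_re, s0_im] at h1
  have h2 := hs.2.2
  have h3 : 1 / bigL D ≤ 1 := by rw [div_le_one hD.pos]; exact hD.one
  have h4 : |s.re - 1/2| ≤ 2 := by
    rw [abs_le]; constructor <;> linarith [hs.1, hs.2.1]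
  have := zz_pow_ge hD (k := 405) (by norm_num)
  norm_num at this
  linarith

theorem zz_poly_bound {D : ℕ} (hD : zzBig D) {p : ℕ} (ψ : DirichletCharacter ℂ p) (f : ℕ → ℂ)
    (k : ℕ) {s : ℂ} (hs : zzV D s) :
    ‖∑ n ∈ Finset.Icc 1 (D ^ k), f n * zzphi ψ s n‖ ≤ Real.exp k * (2 * bigL D ^ 405) *
      (‖∑ n ∈ Finset.Icc 1 ⌊(D:ℝ)^k⌋₊, f n * ψ n * (n:ℂ) ^ (-s0 D)‖ +
       ∫ x in (1:ℝ)..(D:ℝ)^k, ‖∑ n ∈ Finset.Icc 1 ⌊x⌋₊, f n * ψ n * (n:ℂ) ^ (-s0 D)‖ / x) := by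
  set c : ℕ → ℂ := fun n => f n * ψ n * (n:ℂ) ^ (-s0 D) with hc
  have hIcc : ∀ m : ℕ, Finset.Icc 1 m = Finset.Ioc 0 m := fun m => by ext n; simp; omega
  have h1D : (1:ℝ) ≤ (D:ℝ)^k := one_le_pow₀ hD.D_one
  have hfl : ⌊(D:ℝ)^k⌋₊ = D ^ k := by rw [← Nat.cast_pow, Nat.floor_natCast]
  have key := zz_abel c 0 (a := 1) (b := (D:ℝ)^k) one_pos h1D (by simp) (s - s0 D) (Real.exp k)
    (fun x hx hxD => zz_rpow_le hD k hx hxD (by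
      rw [Complex.sub_re, s0_re]; linarith [hs.1]))
  simp only [zzX, ← hIcc, Nat.floor_one] at key
  have h2 : (∑ n ∈ Finset.Ioc 1 ⌊(D:ℝ)^k⌋₊, c n * (n:ℂ) ^ (-(s - s0 D))) +
      (∑ n ∈ Finset.Icc 1 1, c n) * ((1:ℝ):ℂ) ^ (-(s - s0 D)) =
      ∑ n ∈ Finset.Icc 1 (D ^ k), f n * zzphi ψ s n := by
    rw [hfl]
    have e : Finset.Icc 1 (D ^ k) = insert 1 (Finset.Ioc 1 (D^k)) := by
      have : 1 ≤ D ^ k := Nat.one_le_pow _ _ hD.D_pos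
      ext n; simp; omega
    rw [e, Finset.sum_insert (by simp), add_comm]
    congr 1
    · simp [hc, zzphi]
    · refine Finset.sum_congr rfl (fun n hn => ?_)
      rw [Finset.mem_Ioc] at hn
      rw [zz_phi_split ψ s (s0 D) (by omega)]
  rw [h2] at key
  refine key.trans ?_
  gcongr
  · have : 0 ≤ ∫ x in (1:ℝ)..(D:ℝ)^k, ‖∑ n ∈ Finset.Icc 1 ⌊x⌋₊, c n‖ / x := by
      refine intervalIntegral.integral_nonneg h1D (fun x hx => ?_)
      have : 0 < x := by linarith [hx.1]
      positivity
    positivity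
  · exact zz_w_norm hD hs

theorem zz_exp80 {D : ℕ} (hD : zzBig D) : 2 * Real.exp 80 ≤ bigL D := by
  refine le_trans ?_ hD.1
  have : Real.exp 80 = Real.exp 1 ^ 80 := by rw [← Real.exp_nat_mul]; norm_num
  rw [this]
  calc 2 * Real.exp 1 ^ 80 ≤ 2 * 3 ^ 80 := by
        gcongr; linarith [Real.exp_one_lt_d9]
    _ ≤ _ := by norm_num

theorem zz_F20_bound {D : ℕ} (hD : zzBig D) {χ : DirichletCharacter ℂ D} {p : ℕ}
    {ψ : DirichletCharacter ℂ p} (h : Ineq1 D χ ψ) {s : ℂ} (hs : zzV D s) :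
    ‖Ffun D χ ψ s‖ ≤ bigL D ^ 79 ∧ ‖Gfun D χ ψ s‖ ≤ bigL D ^ 79 := by
  have hL := hD.pos
  have h1D : (1:ℝ) ≤ (D:ℝ)^80 := one_le_pow₀ hD.D_one
  have hF := zz_poly_bound hD ψ (nu20 D χ) 80 hs
  have hG := zz_poly_bound hD ψ (ups20 D χ) 80 hs
  rw [← zz_F20] at hF
  rw [← zz_G20] at hG
  have hIcc : ∀ m : ℕ, Finset.Icc 1 m = Finset.Ioc 0 m := fun m => by ext n; simp; omega
  have e1 : ∀ x, X1 D χ ψ x = ∑ n ∈ Finset.Icc 1 ⌊x⌋₊, nu20 D χ n * ψ n * (n:ℂ) ^ (-s0 D) :=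
    fun x => rfl
  have e2 : ∀ x, X2 D χ ψ x = ∑ n ∈ Finset.Icc 1 ⌊x⌋₊, ups20 D χ n * ψ n * (n:ℂ) ^ (-s0 D) :=
    fun x => rfl
  simp only [← e1] at hF
  simp only [← e2] at hG
  have i1 : IntervalIntegrable (fun x => ‖X1 D χ ψ x‖ / x) MeasureTheory.volume 1 ((D:ℝ)^80) := by
    have := zzX_intble (fun n => nu20 D χ n * ψ n * (n:ℂ) ^ (-s0 D)) 0 one_pos h1D
    simp only [zzX, ← hIcc] at this
    exact this
  have i2 : IntervalIntegrable (fun x => ‖X2 D χ ψ x‖ / x) MeasureTheory.volume 1 ((D:ℝ)^80) := by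
    have := zzX_intble (fun n => ups20 D χ n * ψ n * (n:ℂ) ^ (-s0 D)) 0 one_pos h1D
    simp only [zzX, ← hIcc] at this
    exact this
  have hnn : ∀ Y : ℝ → ℂ, 0 ≤ ∫ x in (1:ℝ)..((D:ℝ)^80), ‖Y x‖ / x := by
    intro Y
    refine intervalIntegral.integral_nonneg h1D (fun x hx => ?_)
    have : 0 < x := by linarith [hx.1]
    positivity
  rw [Ineq1] at h
  simp only [add_div] at h
  rw [intervalIntegral.integral_add i1 i2] at h
  have n1 := hnn (X1 D χ ψ)
  have n2 := hnn (X2 D χ ψ)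
  have n3 := norm_nonneg (X1 D χ ψ ((D:ℝ)^80))
  have n4 := norm_nonneg (X2 D χ ψ ((D:ℝ)^80))
  have fin : ∀ z : ℂ, ∀ T : ℝ, T ≤ bigL D ^ 1171 →
      ‖z ^ 20‖ ≤ Real.exp (80:ℕ) * (2 * bigL D ^ 405) * T → ‖z‖ ≤ bigL D ^ 79 := by
    intro z T hT hz
    rw [norm_pow] at hz
    refine le_of_pow_le_pow_left₀ (n := 20) (by norm_num) (by positivity) (hz.trans ?_)
    have h80 := zz_exp80 hD
    calc Real.exp (80:ℕ) * (2 * bigL D ^ 405) * T ≤ Real.exp (80:ℕ) * (2 * bigL D ^ 405) * bigL D ^ 1171 := by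
          gcongr
      _ = (2 * Real.exp 80) * bigL D ^ 1576 := by push_cast; ring
      _ ≤ bigL D * bigL D ^ 1576 := by gcongr
      _ = bigL D ^ 1577 := by ring
      _ ≤ bigL D ^ 1580 := pow_le_pow_right₀ hD.one (by norm_num)
      _ = _ := by rw [← pow_mul]
  exact ⟨fin _ _ (by linarith) hF, fin _ _ (by linarith) hG⟩

theorem zz_FG_bound {D : ℕ} (hD : zzBig D) {χ : DirichletCharacter ℂ D} {p : ℕ}
    {ψ : DirichletCharacter ℂ p} (h : Ineq3 D χ ψ) {s : ℂ} (hs : zzV D s) :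
    ‖Ffun D χ ψ s * Gfun D χ ψ s - 1‖ ≤ 1/2 := by
  have hL := hD.pos
  have h1D : (1:ℝ) ≤ (D:ℝ)^4 := one_le_pow₀ hD.D_one
  have h48 : (D:ℝ)^4 ≤ (D:ℝ)^8 := pow_le_pow_right₀ hD.D_one (by norm_num)
  have f4 : ⌊(D:ℝ)^4⌋₊ = D ^ 4 := by rw [← Nat.cast_pow, Nat.floor_natCast]
  have f8 : ⌊(D:ℝ)^8⌋₊ = D ^ 8 := by rw [← Nat.cast_pow, Nat.floor_natCast]
  rw [zz_FG hD.D_pos, add_sub_cancel_left]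
  have key := zz_abel (fun n => sigF D χ n * ψ n * (n:ℂ) ^ (-s0 D)) (D^4) (a := (D:ℝ)^4)
    (b := (D:ℝ)^8) (by linarith) h48 (by rw [f4]) (s - s0 D) (Real.exp (8:ℕ))
    (fun x hx hxD => zz_rpow_le hD 8 (by linarith) hxD (by
      rw [Complex.sub_re, s0_re]; linarith [hs.1]))
  simp only [zzX] at key
  rw [f4, f8] at key
  simp only [Finset.Ioc_self, Finset.sum_empty, zero_mul, add_zero] at key
  have e1 : ∑ n ∈ Finset.Ioc (D ^ 4) (D ^ 8), sigF D χ n * zzphi ψ s n =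
      ∑ n ∈ Finset.Ioc (D ^ 4) (D ^ 8), sigF D χ n * ψ n * (n:ℂ) ^ (-s0 D) * (n:ℂ) ^ (-(s - s0 D)) := by
    refine Finset.sum_congr rfl (fun n hn => ?_)
    rw [Finset.mem_Ioc] at hn
    rw [zz_phi_split ψ s (s0 D) (by omega)]
  rw [e1]
  refine key.trans ?_
  rw [Ineq3] at h
  simp only [X4] at h
  rw [f8] at h
  have hw := zz_w_norm hD hs
  have h80 := zz_exp80 hD
  have h8 : Real.exp (8:ℕ) ≤ bigL D := by
    refine le_trans ?_ h80
    have : Real.exp (8:ℕ) ≤ Real.exp 80 := Real.exp_le_exp.mpr (by norm_num)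
    linarith [Real.exp_pos 80]
  calc _ ≤ bigL D * (2 * bigL D ^ 405) * bigL D ^ (-633 : ℤ) := by
        gcongr
        refine add_nonneg (norm_nonneg _) (intervalIntegral.integral_nonneg h48 (fun x hx => ?_))
        have : 0 < x := by linarith [hx.1]
        positivity
    _ = 2 * bigL D ^ (-227 : ℤ) := by
        have : bigL D ^ (-227:ℤ) = bigL D ^ (406:ℤ) * bigL D ^ (-633:ℤ) := by
          rw [← zpow_add₀ hL.ne']; norm_num
        rw [this, show bigL D ^ (406:ℤ) = bigL D ^ (406:ℕ) from zpow_natCast _ _]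
        ring
    _ ≤ 1/2 := by
        rw [zpow_neg, ← div_eq_mul_inv, div_le_iff₀ (by positivity)]
        have := zz_pow_ge hD (k := 227) (by norm_num)
        norm_num at this
        rw [show bigL D ^ (227:ℤ) = bigL D ^ (227:ℕ) from zpow_natCast _ _]
        linarith

theorem zz_F_lower {D : ℕ} (hD : zzBig D) {χ : DirichletCharacter ℂ D} {p : ℕ}
    {ψ : DirichletCharacter ℂ p} (h : MemPsi1 D χ ψ) {s : ℂ} (hs : zzV D s) :
    1 ≤ bigL D ^ 80 * ‖Ffun D χ ψ s‖ := by
  have hL := hD.pos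
  obtain ⟨-, -, h1, h2, h3⟩ := h
  have a := zz_FG_bound hD h3 hs
  have b := (zz_F20_bound hD h1 hs).2
  have c : 1/2 ≤ ‖Ffun D χ ψ s * Gfun D χ ψ s‖ := by
    have := norm_sub_norm_le (1:ℂ) (1 - Ffun D χ ψ s * Gfun D χ ψ s)
    rw [norm_sub_rev 1] at this
    rw [show (1:ℂ) - (1 - Ffun D χ ψ s * Gfun D χ ψ s) = Ffun D χ ψ s * Gfun D χ ψ s by ring] at this
    simp only [norm_one] at this
    linarith
  rw [norm_mul] at c
  have d : 1/2 ≤ ‖Ffun D χ ψ s‖ * bigL D ^ 79 := c.trans (by gcongr)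
  have e := hD.1
  norm_num at e
  calc (1:ℝ) ≤ bigL D * (1/2) := by linarith
    _ ≤ bigL D * (‖Ffun D χ ψ s‖ * bigL D ^ 79) := by gcongr
    _ = _ := by ring

theorem zz_F_diff {D : ℕ} {χ : DirichletCharacter ℂ D} {p : ℕ}
    {ψ : DirichletCharacter ℂ p} : Differentiable ℂ (Ffun D χ ψ) := by
  intro s
  unfold Ffun
  refine DifferentiableAt.fun_sum (fun n hn => ?_)
  rw [Finset.mem_Icc] at hn
  refine DifferentiableAt.const_mul ?_ _
  exact DifferentiableAt.const_cpow (by fun_prop) (Or.inl (by norm_cast; omega))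

theorem zz_F_ne {D : ℕ} (hD : zzBig D) {χ : DirichletCharacter ℂ D} {p : ℕ}
    {ψ : DirichletCharacter ℂ p} (h : MemPsi1 D χ ψ) {s : ℂ} (hs : zzV D s) :
    Ffun D χ ψ s ≠ 0 := by
  intro h0
  have := zz_F_lower hD h hs
  rw [h0] at this
  norm_num at this

theorem zz_log_le {D : ℕ} (hD : zzBig D) : 20000 * Real.log (bigL D) ≤ bigL D := by
  have := Real.log_le_log (pow_pos hD.pos _) hD.2
  rw [Real.log_pow, Real.log_exp] at this
  exact_mod_cast this

theorem zz_F_logderiv {D : ℕ} (hD : zzBig D) {χ : DirichletCharacter ℂ D} {p : ℕ}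
    {ψ : DirichletCharacter ℂ p} (h : MemPsi1 D χ ψ) {s : ℂ}
    (h1 : 1/2 - 1 / (2 * bigL D) ≤ s.re) (h2 : s.re ≤ 1)
    (h3 : |s.im - 2 * Real.pi * t0 D| ≤ bigL D ^ 405 + 4) :
    ‖deriv (Ffun D χ ψ) s / Ffun D χ ψ s‖ ≤ bigL D ^ 3 := by
  have hL := hD.pos
  have hL1 := hD.1
  norm_num at hL1
  have hsmall : 1 / (2 * bigL D) ≤ 1 := by rw [div_le_one (by positivity)]; linarith
  have hhalf : 1 / (2 * bigL D) + 1 / (2 * bigL D) = 1 / bigL D := by field_simp; norm_num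
  have hball : ∀ z ∈ Metric.ball s (1 / (2 * bigL D)), zzV D z := by
    intro z hz
    rw [Metric.mem_ball, dist_eq_norm] at hz
    have a := (Complex.abs_re_le_norm (z - s)).trans hz.le
    have b := (Complex.abs_im_le_norm (z - s)).trans hz.le
    rw [Complex.sub_re, abs_le] at a
    rw [Complex.sub_im, abs_le] at b
    rw [abs_le] at h3
    refine ⟨by linarith [a.1], by linarith [a.2, (by positivity : 0 < 1/(2 * bigL D))], ?_⟩
    rw [abs_le]; constructor <;> linarith [b.1, b.2, h3.1, h3.2]
  have hs : zzV D s := hball s (Metric.mem_ball_self (by positivity))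
  have := zz_logderiv_bound (f := Ffun D χ ψ) (a := s) (R := 1 / (2 * bigL D)) (M := bigL D)
    (by positivity) hL zz_F_diff.differentiableOn (fun z hz => zz_F_ne hD h (hball z hz))
    (fun z hz => by
      have u := (zz_F20_bound hD h.2.2.1 (hball z hz)).1
      have l := zz_F_lower hD h hs
      have l2 : bigL D ^ 159 ≤ Real.exp (bigL D) :=
        (pow_le_pow_right₀ hD.one (by norm_num)).trans hD.2
      calc _ ≤ bigL D ^ 79 * 1 := by rw [mul_one]; exact u
        _ ≤ bigL D ^ 79 * (bigL D ^ 80 * ‖Ffun D χ ψ s‖) := by gcongr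
        _ = bigL D ^ 159 * ‖Ffun D χ ψ s‖ := by ring
        _ ≤ _ := by gcongr)
  refine this.trans ?_
  rw [div_div_eq_mul_div, div_one]
  nlinarith [mul_pos hL hL]

theorem zz_phi_norm {p : ℕ} (ψ : DirichletCharacter ℂ p) (s : ℂ) {n : ℕ} (hn : n ≠ 0) :
    ‖zzphi ψ s n‖ ≤ (n:ℝ) ^ (-s.re) := by
  rw [zzphi, norm_mul, Complex.norm_natCast_cpow_of_pos (by omega), Complex.neg_re]
  have := DirichletCharacter.norm_le_one ψ (n : ZMod p)
  have : 0 ≤ (n:ℝ) ^ (-s.re) := by positivity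
  nlinarith

theorem zz_F_crude {D : ℕ} (hD : zzBig D) {χ : DirichletCharacter ℂ D} {p : ℕ}
    {ψ : DirichletCharacter ℂ p} {s : ℂ} (hs : -3/2 ≤ s.re) :
    ‖Ffun D χ ψ s‖ ≤ (D:ℝ) ^ 16 := by
  have h1 := hD.D_one
  have e : Ffun D χ ψ s = ∑ n ∈ Finset.Icc 1 (D ^ 4), nuF D χ n * zzphi ψ s n := by
    simp only [Ffun, zzphi, mul_assoc]
  rw [e]
  refine (norm_sum_le _ _).trans ?_
  have : ∀ n ∈ Finset.Icc 1 (D ^ 4), ‖nuF D χ n * zzphi ψ s n‖ ≤ (D:ℝ) ^ 12 := by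
    intro n hn
    rw [Finset.mem_Icc] at hn
    have hn1 : (1:ℝ) ≤ n := by exact_mod_cast hn.1
    have hn4 : (n:ℝ) ≤ (D:ℝ)^4 := by exact_mod_cast hn.2
    rw [norm_mul]
    have a := zz_nu_norm D χ n
    have b := zz_phi_norm ψ s (n := n) (by omega)
    have c : (n:ℝ) ^ (-s.re) ≤ (n:ℝ)^(2:ℕ) := by
      rw [← Real.rpow_natCast]
      exact Real.rpow_le_rpow_of_exponent_le hn1 (by push_cast; linarith)
    calc _ ≤ (n:ℝ) * (n:ℝ)^2 := by gcongr; exact b.trans c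
      _ = (n:ℝ)^3 := by ring
      _ ≤ ((D:ℝ)^4)^3 := by gcongr
      _ = _ := by ring
  refine (Finset.sum_le_sum this).trans ?_
  simp only [Finset.sum_const, Nat.card_Icc, add_tsub_cancel_right, nsmul_eq_mul, Nat.cast_pow]
  exact le_of_eq (by ring)



theorem zz_rcpow_conj {r : ℝ} (hr : 0 ≤ r) (z : ℂ) : (r:ℂ) ^ (conj z) = conj ((r:ℂ) ^ z) := by
  have := Complex.conj_cpow (r:ℂ) z (by rw [Complex.arg_ofReal_of_nonneg hr]; exact Real.pi_pos.ne)
  rw [Complex.conj_ofReal] at this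
  rw [this]; simp

theorem zz_ncpow_conj (n : ℕ) (z : ℂ) : (n:ℂ) ^ (conj z) = conj ((n:ℂ) ^ z) := by
  have := zz_rcpow_conj (Nat.cast_nonneg n) z
  simpa using this

theorem zz_L_conj {k : ℕ} [NeZero k] {θ : DirichletCharacter ℂ k} (hθ : θ ≠ 1) (s : ℂ) :
    DirichletCharacter.LFunction θ⁻¹ (conj s) = conj (DirichletCharacter.LFunction θ s) := by
  have hθ' : θ⁻¹ ≠ 1 := by simpa using hθ
  have hd1 : Differentiable ℂ (DirichletCharacter.LFunction θ⁻¹) :=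
    DirichletCharacter.differentiable_LFunction hθ'
  have hd2 : Differentiable ℂ (conj ∘ DirichletCharacter.LFunction θ ∘ conj) := by
    intro z
    have := ((DirichletCharacter.differentiable_LFunction hθ) (conj z)).conj_conj
    simpa using this
  have key : DirichletCharacter.LFunction θ⁻¹ = conj ∘ DirichletCharacter.LFunction θ ∘ conj := by
    refine AnalyticOnNhd.eq_of_eventuallyEq (𝕜 := ℂ) (z₀ := 2)
      (hd1.differentiableOn.analyticOnNhd isOpen_univ) (hd2.differentiableOn.analyticOnNhd isOpen_univ) ?_
    have hopen : IsOpen {z : ℂ | 1 < z.re} := isOpen_lt continuous_const Complex.continuous_re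
    filter_upwards [hopen.mem_nhds (by norm_num : (2:ℂ) ∈ {z : ℂ | 1 < z.re})] with z hz
    simp only [Function.comp]
    rw [DirichletCharacter.LFunction_eq_LSeries _ hz,
      DirichletCharacter.LFunction_eq_LSeries _ (by simpa using hz), LSeries, LSeries,
      Complex.conj_tsum]
    congr 1
    ext n
    rcases eq_or_ne n 0 with rfl | hn
    · simp
    rw [LSeries.term_of_ne_zero hn, LSeries.term_of_ne_zero hn, map_div₀,
      ← MulChar.star_apply' θ, ← zz_ncpow_conj, Complex.conj_conj]
    rfl
  rw [key]; simp

/-- The archimedean factor in the functional equation. -/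
def zzg (δ : ℂ) (s : ℂ) : ℂ := Complex.Gammaℝ (1 - s + δ) / Complex.Gammaℝ (s + δ)

theorem zz_GammaR_ne {s : ℂ} (hs : s.im ≠ 0) : Complex.Gammaℝ s ≠ 0 := by
  intro h
  obtain ⟨n, hn⟩ := Complex.Gammaℝ_eq_zero_iff.mp h
  apply hs; rw [hn]; simp

theorem zz_GammaR_conj (s : ℂ) : Complex.Gammaℝ (conj s) = conj (Complex.Gammaℝ s) := by
  rw [Complex.Gammaℝ_def, Complex.Gammaℝ_def, map_mul, ← Complex.Gamma_conj]
  congr 1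
  · rw [← zz_rcpow_conj Real.pi_pos.le]
    congr 1
    rw [map_div₀, map_neg, Complex.conj_ofNat]
  · congr 1
    rw [map_div₀, Complex.conj_ofNat]

theorem zzg_ne {δ s : ℂ} (hδ : δ.im = 0) (hs : s.im ≠ 0) : zzg δ s ≠ 0 :=
  div_ne_zero (zz_GammaR_ne (by simpa [hδ] using hs)) (zz_GammaR_ne (by simpa [hδ] using hs))

theorem zzg_refl {δ s : ℂ} (hδ : δ.im = 0) (hs : s.im ≠ 0) :
    zzg δ s * conj (zzg δ (1 - conj s)) = 1 := by
  have hδ' : conj δ = δ := Complex.conj_eq_iff_im.mpr hδ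
  have a : Complex.Gammaℝ (1 - s + δ) ≠ 0 := zz_GammaR_ne (by simpa [hδ] using hs)
  have b : Complex.Gammaℝ (s + δ) ≠ 0 := zz_GammaR_ne (by simpa [hδ] using hs)
  rw [zzg, zzg, map_div₀, ← zz_GammaR_conj, ← zz_GammaR_conj]
  simp only [map_add, map_sub, map_one, Complex.conj_conj, hδ', sub_sub_cancel]
  field_simp

theorem zz_GammaR_diff {s : ℂ} (hs : s.im ≠ 0) : DifferentiableAt ℂ Complex.Gammaℝ s := by
  have h := (Complex.differentiable_Gammaℝ_inv s).inv (inv_ne_zero (zz_GammaR_ne hs))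
  refine h.congr_of_eventuallyEq (Filter.Eventually.of_forall (fun z => ?_))
  simp

theorem zzg_diff {δ s : ℂ} (hδ : δ.im = 0) (hs : s.im ≠ 0) : DifferentiableAt ℂ (zzg δ) s := by
  unfold zzg
  refine DifferentiableAt.div ?_ ?_ (zz_GammaR_ne (by simpa [hδ] using hs))
  · exact DifferentiableAt.comp (g := Complex.Gammaℝ) (f := fun s => 1 - s + δ) s
      (zz_GammaR_diff (by simpa [hδ] using hs)) (by fun_prop)
  · exact DifferentiableAt.comp (g := Complex.Gammaℝ) (f := fun s => s + δ) s
      (zz_GammaR_diff (by simpa [hδ] using hs)) (by fun_prop)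

theorem zz_prim_ne_one {k : ℕ} (hk : 1 < k) {θ : DirichletCharacter ℂ k} (hθ : θ.IsPrimitive) :
    θ ≠ 1 := by
  rintro rfl
  haveI : NeZero k := ⟨by omega⟩
  have : DirichletCharacter.conductor (1 : DirichletCharacter ℂ k) = k := hθ
  rw [DirichletCharacter.conductor_one] at this
  omega

theorem zz_FE {k : ℕ} [NeZero k] (hk : 1 < k) {θ : DirichletCharacter ℂ k} (hθ : θ.IsPrimitive) :
    ∃ ε δ : ℂ, ‖ε‖ = 1 ∧ (δ = 0 ∨ δ = 1) ∧ ∀ s : ℂ, s.im ≠ 0 →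
      DirichletCharacter.LFunction θ s = ε * (k:ℂ) ^ (1/2 - s) * zzg δ s *
        conj (DirichletCharacter.LFunction θ (1 - conj s)) := by
  have hθ1 := zz_prim_ne_one hk hθ
  obtain ⟨δ, hδ, h1, h2⟩ : ∃ δ : ℂ, (δ = 0 ∨ δ = 1) ∧
      (∀ s, DirichletCharacter.gammaFactor θ s = Complex.Gammaℝ (s + δ)) ∧
      (∀ s, DirichletCharacter.gammaFactor θ⁻¹ s = Complex.Gammaℝ (s + δ)) := by
    rcases θ.even_or_odd with h | h
    · refine ⟨0, Or.inl rfl, fun s => by rw [h.gammaFactor_def, add_zero], fun s => ?_⟩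
      have : θ⁻¹.Even := by
        have h' : θ (-1) = 1 := h
        rw [DirichletCharacter.Even, ← MulChar.star_apply', h']; simp
      rw [this.gammaFactor_def, add_zero]
    · refine ⟨1, Or.inr rfl, fun s => by rw [h.gammaFactor_def], fun s => ?_⟩
      have : θ⁻¹.Odd := by
        have h' : θ (-1) = -1 := h
        rw [DirichletCharacter.Odd, ← MulChar.star_apply', h']; simp
      rw [this.gammaFactor_def]
  have hδi : δ.im = 0 := by rcases hδ with h | h <;> simp [h]
  set ε := DirichletCharacter.rootNumber θ with hε
  have hFE : ∀ s : ℂ, s.im ≠ 0 →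
      DirichletCharacter.LFunction θ s = ε * (k:ℂ) ^ (1/2 - s) * zzg δ s *
        conj (DirichletCharacter.LFunction θ (1 - conj s)) := by
    intro s hs
    have e0 := DirichletCharacter.IsPrimitive.completedLFunction_one_sub hθ (1 - s)
    rw [sub_sub_cancel] at e0
    rw [← zz_L_conj hθ1, DirichletCharacter.LFunction_eq_completed_div_gammaFactor θ s
      (Or.inr (by omega)), e0, h1, DirichletCharacter.LFunction_eq_completed_div_gammaFactor θ⁻¹ _
      (Or.inr (by omega)), h2, zzg]
    simp only [map_sub, map_one, Complex.conj_conj]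
    have a : Complex.Gammaℝ (1 - s + δ) ≠ 0 := zz_GammaR_ne (by simpa [hδi] using hs)
    have b : Complex.Gammaℝ (s + δ) ≠ 0 := zz_GammaR_ne (by simpa [hδi] using hs)
    rw [show (1:ℂ) - s - 1/2 = 1/2 - s by ring]
    rw [hε]
    field_simp
  refine ⟨ε, δ, ?_, hδ, hFE⟩
  -- |ε| = 1
  set s : ℂ := 2 + Complex.I with hs
  have him : s.im ≠ 0 := by simp [hs]
  have him' : (1 - conj s).im ≠ 0 := by simp [hs]
  have hne : DirichletCharacter.LFunction θ s ≠ 0 := by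
    rw [DirichletCharacter.LFunction_eq_LSeries _ (by simp [hs])]
    exact DirichletCharacter.LSeries_ne_zero_of_one_lt_re θ (by simp [hs])
  have e1 := hFE s him
  have e2 := hFE _ him'
  rw [show (1:ℂ) - conj (1 - conj s) = s by simp] at e2
  rw [e2] at e1
  simp only [map_mul, Complex.conj_conj] at e1
  have hk0 : (k:ℂ) ≠ 0 := by exact_mod_cast NeZero.ne k
  have hkk : (k:ℂ) ^ (1/2 - s) * conj ((k:ℂ) ^ (1/2 - (1 - conj s))) = 1 := by
    rw [← zz_ncpow_conj, ← Complex.cpow_add _ _ hk0]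
    simp only [map_sub, map_one, Complex.conj_conj, map_div₀, map_ofNat]
    rw [show (1/2 - s + (1/2 - (1 - s)) : ℂ) = 0 by ring, Complex.cpow_zero]
  have hgg := zzg_refl hδi him
  have e3 : DirichletCharacter.LFunction θ s = (ε * conj ε) * DirichletCharacter.LFunction θ s := by
    calc _ = (ε * conj ε) * ((k:ℂ) ^ (1/2 - s) * conj ((k:ℂ) ^ (1/2 - (1 - conj s)))) *
          (zzg δ s * conj (zzg δ (1 - conj s))) * DirichletCharacter.LFunction θ s := by
          conv_lhs => rw [e1]
          ring
      _ = _ := by rw [hkk, hgg]; ring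
  have e4 : ε * conj ε = 1 := by
    have := mul_right_cancel₀ hne ((one_mul _).trans e3)
    exact this.symm
  rw [Complex.mul_conj] at e4
  have e5 : Complex.normSq ε = 1 := by exact_mod_cast e4
  rw [Complex.normSq_eq_norm_sq] at e5
  nlinarith [norm_nonneg ε]



theorem zz_beta_le {u v : ℂ} (hu : 1 ≤ u.re) (hv : 1 < v.re) : ‖Complex.betaIntegral u v‖ ≤ 1 := by
  have := intervalIntegral.norm_integral_le_of_norm_le_const (a := (0:ℝ)) (b := 1) (C := 1)
    (f := fun x : ℝ => (x:ℂ) ^ (u - 1) * (1 - (x:ℂ)) ^ (v - 1)) (by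
      intro x hx
      rw [Set.uIoc_of_le zero_le_one] at hx
      rw [norm_mul]
      have h1 : ‖(x:ℂ) ^ (u - 1)‖ ≤ 1 := by
        rw [Complex.norm_cpow_eq_rpow_re_of_pos hx.1]
        exact Real.rpow_le_one hx.1.le hx.2 (by simpa using hu)
      have h2 : ‖(1 - (x:ℂ)) ^ (v - 1)‖ ≤ 1 := by
        rcases hx.2.lt_or_eq with h | h
        · rw [show (1 - (x:ℂ)) = ((1 - x : ℝ) : ℂ) by push_cast; ring,
            Complex.norm_cpow_eq_rpow_re_of_pos (by linarith)]
          exact Real.rpow_le_one (by linarith) (by linarith [hx.1]) (by simpa using hv.le)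
        · have : v - 1 ≠ 0 := by
            intro h0
            have := congrArg Complex.re h0
            simp at this; linarith
          rw [h]; simp [Complex.zero_cpow this]
      nlinarith [norm_nonneg ((x:ℂ) ^ (u - 1)), norm_nonneg ((1 - (x:ℂ)) ^ (v - 1))])
  simpa [Complex.betaIntegral] using this

theorem zz_Gamma_step {z : ℂ} (hz : 1 ≤ |z.im|) : ‖Complex.Gamma z‖ ≤ ‖Complex.Gamma (z + 1)‖ := by
  have h0 : z ≠ 0 := by rintro rfl; simp at hz; linarith
  rw [Complex.Gamma_add_one z h0, norm_mul]
  have := hz.trans (Complex.abs_im_le_norm z)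
  nlinarith [norm_nonneg (Complex.Gamma z)]

theorem zz_Gamma_up {z : ℂ} {B : ℝ} (hz : 1 ≤ |z.im|) (k : ℕ) (hB : ∀ j < k, ‖z + j‖ ≤ B) :
    ‖Complex.Gamma (z + k)‖ ≤ B ^ k * ‖Complex.Gamma z‖ := by
  induction k with
  | zero => simp
  | succ k ih =>
    have h1 := ih (fun j hj => hB j (by omega))
    have h0 : z + k ≠ 0 := by
      intro h
      have := congrArg Complex.im h
      simp at this; rw [this] at hz; simp at hz; linarith
    have hk := hB k (by omega)
    rw [Nat.cast_succ, ← add_assoc, Complex.Gamma_add_one _ h0, norm_mul, pow_succ]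
    calc ‖z + k‖ * ‖Complex.Gamma (z + k)‖ ≤ B * (B ^ k * ‖Complex.Gamma z‖) := by
          gcongr
          exact (norm_nonneg _).trans hk
      _ = _ := by ring

theorem zz_Gamma_cmp {z z' : ℂ} (him : z.im = z'.im) (hy : 1 ≤ z.im) (h1 : -1 ≤ z.re) (h2 : z.re ≤ 3)
    (h3 : -1 ≤ z'.re) (h4 : z'.re ≤ 3) :
    ‖Complex.Gamma z‖ ≤ (z.im + 11) ^ 8 * ‖Complex.Gamma z'‖ := by
  have hya : 1 ≤ |z.im| := hy.trans (le_abs_self _)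
  have a1 := zz_Gamma_step hya
  have a2 := zz_Gamma_step (z := z + 1) (by simpa using hya)
  rw [add_assoc] at a2
  norm_num at a2
  set v : ℝ := z'.re - z.re + 6 with hv
  have hv2 : 2 ≤ v := by rw [hv]; linarith
  have hb := Complex.Gamma_mul_Gamma_eq_betaIntegral (s := z + 2) (t := (v:ℂ)) (by simp; linarith)
    (by simp; linarith)
  have e : z + 2 + (v:ℂ) = z' + (8:ℕ) := by
    apply Complex.ext
    · simp [hv]; ring
    · simp [him]
  rw [e] at hb
  have hb' := congrArg norm hb
  rw [norm_mul, norm_mul, Complex.Gamma_ofReal, Complex.norm_real] at hb'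
  have hG1 : 1 ≤ ‖Real.Gamma v‖ := by
    refine le_trans ?_ (le_abs_self _)
    rw [← Real.Gamma_two]
    exact Real.Gamma_strictMonoOn_Ici.monotoneOn (by simp) (by simpa using hv2) hv2
  have hbeta := zz_beta_le (u := z + 2) (v := (v:ℂ)) (by simp; linarith) (by simp; linarith)
  have a3 : ‖Complex.Gamma (z + 2)‖ ≤ ‖Complex.Gamma (z' + (8:ℕ))‖ := by
    calc ‖Complex.Gamma (z + 2)‖ ≤ ‖Complex.Gamma (z + 2)‖ * ‖Real.Gamma v‖ :=
          le_mul_of_one_le_right (norm_nonneg _) hG1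
      _ = _ := hb'
      _ ≤ _ := mul_le_of_le_one_right (norm_nonneg _) hbeta
  have a4 := zz_Gamma_up (z := z') (B := z.im + 11) (by rw [← him]; exact hya) 8 (by
    intro j hj
    have hj' : (j:ℝ) ≤ 7 := by exact_mod_cast (by omega : j ≤ 7)
    have hj0 : (0:ℝ) ≤ j := Nat.cast_nonneg j
    refine (Complex.norm_le_abs_re_add_abs_im _).trans ?_
    simp only [Complex.add_re, Complex.natCast_re, Complex.add_im, Complex.natCast_im, add_zero]
    rw [← him, abs_of_pos (by linarith : 0 < z.im)]
    have : |z'.re + j| ≤ 10 := by rw [abs_le]; constructor <;> linarith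
    linarith)
  exact (a1.trans a2).trans (a3.trans a4)

theorem zzg_norm {δ : ℝ} {s : ℂ} :
    ‖zzg δ s‖ = Real.pi ^ (s.re - 1/2) * (‖Complex.Gamma ((((1 - s.re + δ)/2 : ℝ) : ℂ) + ((s.im/2 : ℝ) : ℂ) * Complex.I)‖ /
      ‖Complex.Gamma ((((s.re + δ)/2 : ℝ) : ℂ) + ((s.im/2 : ℝ) : ℂ) * Complex.I)‖) := by
  rw [zzg, norm_div, Complex.Gammaℝ_def, Complex.Gammaℝ_def, norm_mul, norm_mul,
    Complex.norm_cpow_eq_rpow_re_of_pos Real.pi_pos, Complex.norm_cpow_eq_rpow_re_of_pos Real.pi_pos]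
  have e1 : ‖Complex.Gamma ((1 - s + δ) / 2)‖ =
      ‖Complex.Gamma ((((1 - s.re + δ)/2 : ℝ) : ℂ) + ((s.im/2 : ℝ) : ℂ) * Complex.I)‖ := by
    rw [← Complex.norm_conj, ← Complex.Gamma_conj]
    congr 2
    rw [map_div₀, Complex.conj_ofNat, map_add, map_sub, map_one, Complex.conj_ofReal]
    apply Complex.ext <;> simp
  have e2 : (s + δ) / 2 = (((s.re + δ)/2 : ℝ) : ℂ) + ((s.im/2 : ℝ) : ℂ) * Complex.I := by
    apply Complex.ext <;> simp
  rw [e1, e2, mul_div_mul_comm]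
  congr 1
  rw [← Real.rpow_sub Real.pi_pos]
  congr 1
  simp
  ring

theorem zz_pi_pow : Real.pi ^ (5/2 : ℝ) ≤ 32 := by
  have h4 : Real.pi ≤ 4 := Real.pi_le_four
  calc Real.pi ^ (5/2 : ℝ) ≤ 4 ^ (5/2:ℝ) := Real.rpow_le_rpow Real.pi_pos.le h4 (by norm_num)
    _ = 32 := by
      rw [show (4:ℝ) = 2 ^ (2:ℝ) by norm_num, ← Real.rpow_mul (by norm_num)]
      norm_num

theorem zzg_upper {δ : ℂ} (hδ : δ = 0 ∨ δ = 1) {s : ℂ} (h1 : -2 ≤ s.re) (h2 : s.re ≤ 3)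
    (ht : 2 ≤ s.im) : ‖zzg δ s‖ ≤ 32 * (s.im / 2 + 11) ^ 8 := by
  obtain ⟨d, hd, hd0, hd1⟩ : ∃ d : ℝ, δ = (d:ℂ) ∧ 0 ≤ d ∧ d ≤ 1 := by
    rcases hδ with h | h
    · exact ⟨0, by simp [h], le_rfl, zero_le_one⟩
    · exact ⟨1, by simp [h], zero_le_one, le_rfl⟩
  rw [hd, zzg_norm]
  have hp : Real.pi ^ (s.re - 1/2) ≤ 32 := by
    refine le_trans ?_ zz_pi_pow
    exact Real.rpow_le_rpow_of_exponent_le (by linarith [Real.pi_gt_three]) (by linarith)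
  have hG := zz_Gamma_cmp (z := (((1 - s.re + d)/2 : ℝ) : ℂ) + ((s.im/2 : ℝ) : ℂ) * Complex.I)
    (z' := (((s.re + d)/2 : ℝ) : ℂ) + ((s.im/2 : ℝ) : ℂ) * Complex.I) (by simp) (by simp; linarith)
    (by simp; linarith) (by simp; linarith) (by simp; linarith) (by simp; linarith)
  have him : ((((1 - s.re + d)/2 : ℝ) : ℂ) + ((s.im/2 : ℝ) : ℂ) * Complex.I).im = s.im / 2 := by simp
  rw [him] at hG
  have h0 : 0 < s.im / 2 + 11 := by linarith
  refine mul_le_mul hp ?_ (by positivity) (by norm_num)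
  refine div_le_of_le_mul₀ (norm_nonneg _) (by positivity) hG

theorem zzg_right {δ : ℂ} (hδ : δ = 0 ∨ δ = 1) {s : ℂ} (h1 : s.re = 5/2) (ht : 2 ≤ s.im) :
    (s.im / 2) ^ 2 * ‖zzg δ s‖ ≤ Real.pi ^ 2 ∧ Real.pi ^ 2 ≤ (s.im/2 + 1) ^ 2 * ‖zzg δ s‖ := by
  obtain ⟨d, hd, hd0, hd1⟩ : ∃ d : ℝ, δ = (d:ℂ) ∧ 0 ≤ d ∧ d ≤ 1 := by
    rcases hδ with h | h
    · exact ⟨0, by simp [h], le_rfl, zero_le_one⟩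
    · exact ⟨1, by simp [h], zero_le_one, le_rfl⟩
  rw [hd, zzg_norm]
  set y := s.im / 2 with hy
  have hy1 : 1 ≤ y := by linarith
  set z : ℂ := (((1 - s.re + d)/2 : ℝ) : ℂ) + (y : ℂ) * Complex.I with hz
  have hzim : z.im = y := by simp [hz]
  have hzre : z.re = -3/4 + d/2 := by simp [hz, h1]; ring
  have e : (((s.re + d)/2 : ℝ) : ℂ) + (y : ℂ) * Complex.I = z + 1 + 1 := by
    apply Complex.ext
    · simp [hz, h1]; ring
    · simp [hz]
  have hz0 : z ≠ 0 := by intro h; rw [h] at hzim; simp at hzim; linarith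
  have hz1 : z + 1 ≠ 0 := by
    intro h; have := congrArg Complex.im h; simp [hzim] at this; linarith
  rw [e, Complex.Gamma_add_one _ hz1, Complex.Gamma_add_one _ hz0, norm_mul, norm_mul]
  have hGne : Complex.Gamma z ≠ 0 := by
    apply Complex.Gamma_ne_zero
    intro m h; rw [h] at hzim; simp at hzim; linarith
  have hG0 : 0 < ‖Complex.Gamma z‖ := norm_pos_iff.mpr hGne
  have hp : Real.pi ^ (s.re - 1/2) = Real.pi ^ 2 := by
    rw [h1, ← Real.rpow_natCast]; norm_num
  rw [hp]
  have l1 : y ≤ ‖z‖ := by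
    have := Complex.abs_im_le_norm z; rw [hzim] at this; exact (le_abs_self _).trans this
  have l2 : y ≤ ‖z + 1‖ := by
    have := Complex.abs_im_le_norm (z + 1); simp [hzim] at this; exact (le_abs_self _).trans this
  have u1 : ‖z‖ ≤ y + 1 := by
    refine (Complex.norm_le_abs_re_add_abs_im _).trans ?_
    rw [hzim, hzre, abs_of_pos (by linarith : 0 < y)]
    have : |(-3/4 + d/2 : ℝ)| ≤ 1 := by rw [abs_le]; constructor <;> linarith
    linarith
  have u2 : ‖z + 1‖ ≤ y + 1 := by
    refine (Complex.norm_le_abs_re_add_abs_im _).trans ?_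
    simp only [Complex.add_re, Complex.one_re, Complex.add_im, Complex.one_im, add_zero]
    rw [hzim, hzre, abs_of_pos (by linarith : 0 < y)]
    have : |(-3/4 + d/2 + 1 : ℝ)| ≤ 1 := by rw [abs_le]; constructor <;> linarith
    linarith
  have q : ‖Complex.Gamma z‖ / (‖z + 1‖ * (‖z‖ * ‖Complex.Gamma z‖)) = 1 / (‖z+1‖ * ‖z‖) := by
    have : 0 < ‖z‖ := by linarith
    have : 0 < ‖z+1‖ := by linarith
    field_simp
  rw [q]
  have hzz : 0 < ‖z+1‖ * ‖z‖ := mul_pos (by linarith) (by linarith)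
  have hpi : 0 < Real.pi ^ 2 := by positivity
  constructor
  · rw [← mul_assoc, mul_one_div, div_le_iff₀ hzz]
    nlinarith [mul_le_mul l2 l1 (by linarith) (by linarith)]
  · rw [← mul_assoc, mul_one_div, le_div_iff₀ hzz]
    nlinarith [mul_le_mul u2 u1 (norm_nonneg _) (by linarith)]


/-- partial sums of a character. -/
def zzS {k : ℕ} (θ : DirichletCharacter ℂ k) (n : ℕ) : ℂ := ∑ i ∈ Finset.range n, θ ((i + 1 : ℕ) : ZMod k)

theorem zz_period {k : ℕ} [NeZero k] {θ : DirichletCharacter ℂ k} (hθ : θ ≠ 1) (n : ℕ) :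
    ∑ i ∈ Finset.range k, θ ((n + i + 1 : ℕ) : ZMod k) = 0 := by
  have h := MulChar.sum_eq_zero_of_ne_one hθ
  rw [← h]
  have h2 : ∑ a : ZMod k, θ a = ∑ a : ZMod k, θ (a + (n + 1 : ℕ)) :=
    (Equiv.sum_comp (Equiv.addRight ((n + 1 : ℕ) : ZMod k)) (fun a => θ a)).symm
  rw [h2]
  refine Finset.sum_bij' (fun i _ => (i : ZMod k)) (fun a _ => a.val) ?_ ?_ ?_ ?_ ?_
  · intros; exact Finset.mem_univ _
  · intro a _; exact Finset.mem_range.2 (ZMod.val_lt a)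
  · intro i hi; exact ZMod.val_cast_of_lt (Finset.mem_range.1 hi)
  · intro a _; exact ZMod.natCast_zmod_val a
  · intro i _
    congr 1
    push_cast
    ring

theorem zzS_norm {k : ℕ} [NeZero k] {θ : DirichletCharacter ℂ k} (hθ : θ ≠ 1) (n : ℕ) :
    ‖zzS θ n‖ ≤ k := by
  induction n using Nat.strong_induction_on with
  | _ n ih =>
    by_cases h : n < k
    · refine (norm_sum_le _ _).trans ?_
      refine (Finset.sum_le_card_nsmul _ _ 1 (fun i _ => θ.norm_le_one _)).trans ?_
      simp
      exact_mod_cast h.le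
    · obtain ⟨m, rfl⟩ := Nat.exists_eq_add_of_le (not_lt.1 h)
      have hk : 0 < k := Nat.pos_of_ne_zero (NeZero.ne k)
      have : zzS θ (k + m) = zzS θ m := by
        rw [zzS, add_comm k m, Finset.sum_range_add, zz_period hθ m, add_zero, zzS]
      rw [this]
      exact ih m (by omega)

theorem zz_dterm {s : ℂ} {σ : ℝ} (hσ : 0 < σ) (hs : σ ≤ s.re) (n : ℕ) :
    ‖((n + 1 : ℕ) : ℂ) ^ (-s) - ((n + 2 : ℕ) : ℂ) ^ (-s)‖ ≤ ‖s‖ * ((n + 1 : ℕ) : ℝ) ^ (-(1 + σ)) := by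
  have hn : (1:ℝ) ≤ ((n + 1 : ℕ) : ℝ) := by push_cast; linarith [(Nat.cast_nonneg n : (0:ℝ) ≤ n)]
  have key := Convex.norm_image_sub_le_of_norm_hasDerivWithin_le
    (f := fun x : ℝ => (x : ℂ) ^ (-s)) (f' := fun x : ℝ => (-s) * (x : ℂ) ^ (-s - 1))
    (s := Set.Ici ((n + 1 : ℕ) : ℝ)) (C := ‖s‖ * ((n + 1 : ℕ) : ℝ) ^ (-(1 + σ)))
    (x := ((n + 2 : ℕ) : ℝ)) (y := ((n + 1 : ℕ) : ℝ)) ?_ ?_ (convex_Ici _) ?_ ?_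
  · have e : ‖((n + 1 : ℕ) : ℝ) - ((n + 2 : ℕ) : ℝ)‖ = 1 := by push_cast; ring_nf; norm_num
    rw [e, mul_one] at key
    exact_mod_cast key
  · intro x hx
    have hx0 : 0 < x := by have := Set.mem_Ici.1 hx; linarith
    by_cases hs0 : s = 0
    · simp [hs0]
      exact (hasDerivAt_const x (1:ℂ)).hasDerivWithinAt
    · have := hasDerivAt_ofReal_cpow_const' hx0.ne' (r := -s - 1) (by
        intro h; apply hs0; linear_combination -h)
      have h2 := (this.const_mul (-s)).hasDerivWithinAt (s := Set.Ici ((n + 1 : ℕ) : ℝ))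
      refine h2.congr_of_eventuallyEq ?_ ?_
      · refine Filter.Eventually.of_forall (fun y => ?_)
        simp only [sub_add_cancel]
        field_simp
      · simp only [sub_add_cancel]
        field_simp
  · intro x hx
    have hx1 := Set.mem_Ici.1 hx
    have hx0 : 0 < x := by linarith
    rw [norm_mul, norm_neg, Complex.norm_cpow_eq_rpow_re_of_pos hx0]
    refine mul_le_mul_of_nonneg_left ?_ (norm_nonneg _)
    simp only [Complex.sub_re, Complex.neg_re, Complex.one_re]
    calc x ^ (-s.re - 1) ≤ x ^ (-(1 + σ)) :=
          Real.rpow_le_rpow_of_exponent_le (by linarith) (by linarith)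
      _ ≤ _ := Real.rpow_le_rpow_of_nonpos (by linarith) hx1 (by linarith)
  · simp
  · simp

/-- summation by parts terms. -/
def zzT {k : ℕ} (θ : DirichletCharacter ℂ k) (s : ℂ) (n : ℕ) : ℂ :=
  zzS θ (n + 1) * (((n + 1 : ℕ) : ℂ) ^ (-s) - ((n + 2 : ℕ) : ℂ) ^ (-s))

theorem zz_parts {k : ℕ} (θ : DirichletCharacter ℂ k) (s : ℂ) (N : ℕ) :
    ∑ n ∈ Finset.range N, θ ((n + 1 : ℕ) : ZMod k) * ((n + 1 : ℕ) : ℂ) ^ (-s) =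
      ∑ n ∈ Finset.range N, zzT θ s n + zzS θ N * ((N + 1 : ℕ) : ℂ) ^ (-s) := by
  induction N with
  | zero => simp [zzS]
  | succ N ih =>
    rw [Finset.sum_range_succ, ih, Finset.sum_range_succ, zzT]
    have : zzS θ (N + 1) = zzS θ N + θ ((N + 1 : ℕ) : ZMod k) := by
      rw [zzS, Finset.sum_range_succ]; rfl
    rw [this]
    ring

theorem zzT_norm {k : ℕ} [NeZero k] {θ : DirichletCharacter ℂ k} (hθ : θ ≠ 1)
    {s : ℂ} {σ : ℝ} (hσ : 0 < σ) (hs : σ ≤ s.re) (n : ℕ) :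
    ‖zzT θ s n‖ ≤ k * (‖s‖ * ((n + 1 : ℕ) : ℝ) ^ (-(1 + σ))) := by
  rw [zzT, norm_mul]
  exact mul_le_mul (zzS_norm hθ _) (zz_dterm hσ hs n) (norm_nonneg _) (Nat.cast_nonneg _)

theorem zz_summ {σ : ℝ} (hσ : 0 < σ) : Summable (fun n : ℕ => ((n + 1 : ℕ) : ℝ) ^ (-(1 + σ))) :=
  (summable_nat_add_iff (f := fun n : ℕ => (n : ℝ) ^ (-(1 + σ))) 1).2
    (Real.summable_nat_rpow.2 (by linarith))

theorem zz_L_eq_gt {k : ℕ} [NeZero k] {θ : DirichletCharacter ℂ k} (hθ : θ ≠ 1)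
    {s : ℂ} (hs : 1 < s.re) : DirichletCharacter.LFunction θ s = ∑' n, zzT θ s n := by
  have h1 : HasSum (fun n : ℕ => θ ((n + 1 : ℕ) : ZMod k) * ((n + 1 : ℕ) : ℂ) ^ (-s))
      (DirichletCharacter.LFunction θ s) := by
    rw [DirichletCharacter.LFunction_eq_LSeries θ hs]
    have := (DirichletCharacter.LSeriesSummable_of_one_lt_re θ hs).LSeriesHasSum
    rw [LSeriesHasSum, ← hasSum_nat_add_iff' 1] at this
    simp only [Finset.sum_range_one, LSeries.term_zero, sub_zero] at this
    have e : (fun n : ℕ => θ ((n + 1 : ℕ) : ZMod k) * ((n + 1 : ℕ) : ℂ) ^ (-s)) =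
        fun n => LSeries.term (fun n => θ n) s (n + 1) := by
      funext n
      rw [LSeries.term_of_ne_zero (by omega), Complex.cpow_neg, div_eq_mul_inv]
    rw [e]; exact this
  have h2 : Summable (fun n => zzT θ s n) := by
    refine Summable.of_norm_bounded (g := fun n : ℕ => (k:ℝ) * (‖s‖ * ((n + 1 : ℕ) : ℝ) ^ (-(1 + (1:ℝ)))))
      (((zz_summ one_pos).mul_left _).mul_left _) (fun n => zzT_norm hθ one_pos hs.le n)
  refine tendsto_nhds_unique h1.tendsto_sum_nat ?_
  have h3 : Filter.Tendsto (fun N : ℕ => zzS θ N * ((N + 1 : ℕ) : ℂ) ^ (-s)) Filter.atTop (nhds 0) := by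
    refine squeeze_zero_norm (a := fun N : ℕ => (k:ℝ) * ((N + 1 : ℕ) : ℝ) ^ (-(1:ℝ))) (fun N => ?_) ?_
    · rw [norm_mul]
      refine mul_le_mul (zzS_norm hθ _) ?_ (norm_nonneg _) (Nat.cast_nonneg _)
      rw [Complex.norm_natCast_cpow_of_pos (Nat.succ_pos N)]
      refine Real.rpow_le_rpow_of_exponent_le ?_ ?_
      · push_cast; linarith [(Nat.cast_nonneg N : (0:ℝ) ≤ N)]
      · simp; linarith
    · have := (tendsto_rpow_neg_atTop one_pos).comp
        ((tendsto_natCast_atTop_atTop (R := ℝ)).comp (Filter.tendsto_add_atTop_nat 1))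
      simpa using this.const_mul (k:ℝ)
  have h4 := h2.hasSum.tendsto_sum_nat.add h3
  rw [add_zero] at h4
  refine h4.congr (fun N => (zz_parts θ s N).symm)

theorem zz_T_diffOn {k : ℕ} [NeZero k] {θ : DirichletCharacter ℂ k} (hθ : θ ≠ 1) :
    DifferentiableOn ℂ (fun s => ∑' n, zzT θ s n) {s : ℂ | 0 < s.re} := by
  intro s hs
  have hs' : 0 < s.re := hs
  have hopen : IsOpen ({z : ℂ | s.re / 2 < z.re} ∩ Metric.ball 0 (‖s‖ + 1)) :=
    (isOpen_lt continuous_const Complex.continuous_re).inter Metric.isOpen_ball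
  have hσ : 0 < s.re / 2 := by linarith
  have := Complex.differentiableOn_tsum_of_summable_norm (F := fun n s => zzT θ s n)
    (u := fun n : ℕ => (k:ℝ) * ((‖s‖ + 1) * ((n + 1 : ℕ) : ℝ) ^ (-(1 + s.re/2))))
    (((zz_summ hσ).mul_left _).mul_left _) (U := {z : ℂ | s.re / 2 < z.re} ∩ Metric.ball 0 (‖s‖ + 1))
    (fun n => by
      apply Differentiable.differentiableOn
      unfold zzT
      refine (Differentiable.sub ?_ ?_).const_mul _
      · exact differentiable_neg.const_cpow (Or.inl (by exact_mod_cast Nat.succ_ne_zero n))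
      · exact differentiable_neg.const_cpow (Or.inl (by exact_mod_cast Nat.succ_ne_zero (n+1)))) hopen
    (fun n z hz => by
      refine (zzT_norm hθ hσ (le_of_lt hz.1) n).trans ?_
      have : ‖z‖ ≤ ‖s‖ + 1 := by simpa using (le_of_lt (Metric.mem_ball.1 hz.2))
      gcongr)
  refine ((this s ⟨?_, ?_⟩).differentiableAt (hopen.mem_nhds ⟨?_, ?_⟩)).differentiableWithinAt <;>
    simp <;> linarith

theorem zz_L_eq {k : ℕ} [NeZero k] {θ : DirichletCharacter ℂ k} (hθ : θ ≠ 1)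
    {s : ℂ} (hs : 0 < s.re) : DirichletCharacter.LFunction θ s = ∑' n, zzT θ s n := by
  have hop : IsOpen {s : ℂ | 0 < s.re} := isOpen_lt continuous_const Complex.continuous_re
  have a1 : AnalyticOnNhd ℂ (DirichletCharacter.LFunction θ) {s : ℂ | 0 < s.re} :=
    (DirichletCharacter.differentiable_LFunction hθ).differentiableOn.analyticOnNhd hop
  have a2 := (zz_T_diffOn hθ).analyticOnNhd hop
  have hpre : IsPreconnected {s : ℂ | 0 < s.re} := (convex_halfSpace_re_gt 0).isPreconnected
  refine a1.eqOn_of_preconnected_of_eventuallyEq a2 hpre (z₀ := 2) (by simp) ?_ hs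
  have : {s : ℂ | 1 < s.re} ∈ nhds (2:ℂ) :=
    (isOpen_lt continuous_const Complex.continuous_re).mem_nhds (by simp)
  filter_upwards [this] with z hz
  exact zz_L_eq_gt hθ hz

theorem zz_sum32 (N : ℕ) : ∑ n ∈ Finset.range N, ((n + 1 : ℕ) : ℝ) ^ (-(1 + (1/2 : ℝ))) ≤
    4 - 4 / Real.sqrt (N + 1) := by
  induction N with
  | zero => simp
  | succ N ih =>
    rw [Finset.sum_range_succ]
    have hN : (0:ℝ) ≤ N := Nat.cast_nonneg N
    have e : ((N + 1 : ℕ) : ℝ) ^ (-(1 + (1/2 : ℝ))) = 1 / ((N + 1) * Real.sqrt (N + 1)) := by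
      rw [Real.rpow_neg (by positivity), Real.rpow_add (by positivity), Real.rpow_one,
        ← Real.sqrt_eq_rpow]
      push_cast
      rw [one_div]
    rw [e]
    push_cast
    have ha : 0 < Real.sqrt ((N:ℝ) + 1) := Real.sqrt_pos.2 (by linarith)
    have hb : 0 < Real.sqrt ((N:ℝ) + 1 + 1) := Real.sqrt_pos.2 (by linarith)
    have ha2 : Real.sqrt ((N:ℝ) + 1) ^ 2 = N + 1 := Real.sq_sqrt (by linarith)
    have hb2 : Real.sqrt ((N:ℝ) + 1 + 1) ^ 2 = N + 1 + 1 := Real.sq_sqrt (by linarith)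
    have hab : Real.sqrt ((N:ℝ) + 1) ≤ Real.sqrt ((N:ℝ) + 1 + 1) := Real.sqrt_le_sqrt (by linarith)
    set a := Real.sqrt ((N:ℝ) + 1)
    set b := Real.sqrt ((N:ℝ) + 1 + 1)
    have hb2a : b ≤ 3/2 * a := by
      apply abs_le_of_sq_le_sq' _ (by positivity) |>.2
      nlinarith
    have h1 : 1 / (((N:ℝ) + 1) * a) ≤ 4 / a - 4 / b := by
      rw [← ha2, div_sub_div _ _ ha.ne' hb.ne', div_le_div_iff₀ (by positivity) (by positivity)]
      have h5 : (b - a) * (b + a) = 1 := by nlinarith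
      have h6 : b - a ≥ 1 / (5/2 * a) := by
        rw [ge_iff_le, div_le_iff₀ (by positivity)]
        nlinarith
      have h7 : 4 * b - a * 4 ≥ 4 * (1 / (5/2 * a)) := by linarith
      calc 1 * (a * b) ≤ a * (3/2 * a) := by rw [one_mul]; gcongr
        _ ≤ 4 * (1 / (5/2 * a)) * (a ^ 2 * a) := by
          field_simp; nlinarith
        _ ≤ _ := by
          have e9 : 4 * b - a * 4 = (4 * b - a * 4) := rfl
          gcongr
    push_cast at ih
    linarith

theorem zz_L_crude {k : ℕ} [NeZero k] {θ : DirichletCharacter ℂ k} (hθ : θ ≠ 1)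
    {s : ℂ} (hs : 1/2 ≤ s.re) : ‖DirichletCharacter.LFunction θ s‖ ≤ 4 * k * ‖s‖ := by
  rw [zz_L_eq hθ (by linarith)]
  have h2 : Summable (fun n => zzT θ s n) := by
    refine Summable.of_norm_bounded (g := fun n : ℕ => (k:ℝ) * (‖s‖ * ((n + 1 : ℕ) : ℝ) ^ (-(1 + (1/2:ℝ)))))
      (((zz_summ (by norm_num)).mul_left _).mul_left _) (fun n => zzT_norm hθ (by norm_num) hs n)
  refine le_of_tendsto' h2.hasSum.tendsto_sum_nat.norm (fun N => ?_)
  refine (norm_sum_le_of_le _ (fun n _ => zzT_norm hθ (by norm_num : (0:ℝ) < 1/2) hs n)).trans ?_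
  rw [← Finset.mul_sum, ← Finset.mul_sum]
  have := zz_sum32 N
  have h3 : 0 ≤ 4 / Real.sqrt ((N:ℝ) + 1) := by positivity
  have : ∑ n ∈ Finset.range N, ((n + 1 : ℕ) : ℝ) ^ (-(1 + (1/2 : ℝ))) ≤ 4 := by linarith
  calc _ ≤ (k:ℝ) * (‖s‖ * 4) := by gcongr
    _ = _ := by ring


/-- wide height window -/
def zzW (D : ℕ) (s : ℂ) : Prop := |s.im - 2 * Real.pi * t0 D| ≤ bigL D ^ 406

theorem zz_pow_mul_le {L : ℝ} (hL : (10:ℝ)^100 ≤ L) {a b : ℕ} (hab : a < b) :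
    (10:ℝ)^100 * L ^ a ≤ L ^ b := by
  have h1 : 1 ≤ L := le_trans (by norm_num) hL
  calc (10:ℝ)^100 * L ^ a ≤ L * L ^ a := by gcongr
    _ = L ^ (a+1) := by ring
    _ ≤ L ^ b := pow_le_pow_right₀ h1 hab

theorem zzW_im {D : ℕ} (hD : zzBig D) {s : ℂ} (hs : zzW D s) :
    bigL D ^ 519 ≤ s.im ∧ s.im ≤ 7 * bigL D ^ 519 ∧ 2 ≤ s.im ∧ s.im ≠ 0 := by
  have h1 := abs_le.1 hs
  rw [t0] at h1
  have h2 := zz_pow_mul_le hD.1 (show 406 < 519 by norm_num)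
  have h3 := zz_pow_ge hD (show 1 ≤ 406 by norm_num)
  have h4 : bigL D ^ 406 ≤ bigL D ^ 519 / 10 := by nlinarith
  have hp := Real.pi_gt_three
  have hp2 := Real.pi_lt_d2
  have h5 : 0 < bigL D ^ 519 := by have := hD.pos; positivity
  have h6 : 6 * bigL D ^ 519 ≤ 2 * Real.pi * bigL D ^ 519  := mul_le_mul_of_nonneg_right (by linarith) h5.le
  have h7 : 2 * Real.pi * bigL D ^ 519 ≤ 6.3 * bigL D ^ 519 := mul_le_mul_of_nonneg_right (by norm_num at *; linarith) h5.le
  have h8 : 10 ≤ bigL D ^ 519 := by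
    have := zz_pow_ge hD (show 1 ≤ 519 by norm_num)
    exact le_trans (by norm_num) this
  refine ⟨by linarith, by linarith, by linarith, by intro h; rw [h] at h1; linarith⟩

theorem zz_half {D : ℕ} (hD : zzBig D) : bigL D ^ 10000 ≤ Real.exp (bigL D / 2) := by
  have h : (bigL D ^ 10000) ^ 2 ≤ Real.exp (bigL D / 2) ^ 2 := by
    rw [← pow_mul, ← Real.exp_nat_mul]
    convert hD.2 using 2
    push_cast; ring
  exact (abs_le_of_sq_le_sq' h (Real.exp_pos _).le).2

theorem zzg_L {D : ℕ} (hD : zzBig D) {δ : ℂ} (hδ : δ = 0 ∨ δ = 1) {s : ℂ} (h1 : -2 ≤ s.re) (h2 : s.re ≤ 3)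
    (hs : zzW D s) : ‖zzg δ s‖ ≤ Real.exp (bigL D / 2) := by
  obtain ⟨a1, a2, a3, -⟩ := zzW_im hD hs
  refine (zzg_upper hδ h1 h2 a3).trans (le_trans ?_ (zz_half hD))
  have h8 : 22 ≤ bigL D ^ 519 := le_trans (by norm_num) (zz_pow_ge hD (show 1 ≤ 519 by norm_num))
  have hL := hD.one
  calc 32 * (s.im / 2 + 11) ^ 8 ≤ 32 * (4 * bigL D ^ 519) ^ 8 := by gcongr; linarith
    _ = 2097152 * bigL D ^ 4152 := by ring
    _ ≤ (10:ℝ)^100 * bigL D ^ 4152 := by gcongr; norm_num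
    _ ≤ _ := zz_pow_mul_le hD.1 (by norm_num)

theorem zz_del_im {δ : ℂ} (hδ : δ = 0 ∨ δ = 1) : δ.im = 0 := by rcases hδ with h | h <;> simp [h]

theorem zzW_refl {D : ℕ} {s : ℂ} (hs : zzW D s) : zzW D (1 - conj s) := by
  unfold zzW at *; simpa using hs

theorem zzg_refl_norm {δ s : ℂ} (hδ : δ = 0 ∨ δ = 1) (hs : s.im ≠ 0) :
    ‖zzg δ s‖ * ‖zzg δ (1 - conj s)‖ = 1 := by
  have := congrArg norm (zzg_refl (zz_del_im hδ) hs)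
  simpa using this

theorem zzg_L_lower {D : ℕ} (hD : zzBig D) {δ : ℂ} (hδ : δ = 0 ∨ δ = 1) {s : ℂ} (h1 : -2 ≤ s.re) (h2 : s.re ≤ 3)
    (hs : zzW D s) : 1 ≤ Real.exp (bigL D / 2) * ‖zzg δ s‖ := by
  rw [← zzg_refl_norm hδ (zzW_im hD hs).2.2.2, mul_comm]
  gcongr
  exact zzg_L hD hδ (by simp; linarith) (by simp; linarith) (zzW_refl hs)

theorem zzg_line {δ s : ℂ} (hδ : δ = 0 ∨ δ = 1) (hs : s.im ≠ 0) (hr : s.re = 1/2) : ‖zzg δ s‖ = 1 := by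
  have h := zzg_refl_norm hδ hs
  have e : 1 - conj s = s := by
    apply Complex.ext
    · simp [hr]; norm_num
    · simp
  rw [e] at h
  nlinarith [norm_nonneg (zzg δ s)]

/-- narrower window -/
def zzN (D : ℕ) (s : ℂ) : Prop := |s.im - 2 * Real.pi * t0 D| ≤ bigL D ^ 405 + 2 * bigL D ^ 5

theorem zzN_W {D : ℕ} (hD : zzBig D) {s z : ℂ} (hs : zzN D s) (hz : |z.im - s.im| ≤ 1) : zzW D z := by
  unfold zzN zzW at *
  have h1 := abs_le.1 hs
  have h2 := abs_le.1 hz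
  have h3 := zz_pow_mul_le hD.1 (show 405 < 406 by norm_num)
  have h4 := zz_pow_mul_le hD.1 (show 5 < 405 by norm_num)
  have h5 := zz_pow_ge hD (show 1 ≤ 5 by norm_num)
  have h6 : (10:ℝ) ≤ bigL D ^ 5 := le_trans (by norm_num) h5
  have h7 : 10 * bigL D ^ 5 ≤ bigL D ^ 405 := le_trans (by gcongr; norm_num) h4
  have h8 : 10 * bigL D ^ 405 ≤ bigL D ^ 406 := le_trans (by have := hD.pos; gcongr; norm_num) h3
  rw [abs_le]; constructor <;> linarith

theorem zzg_logderiv {D : ℕ} (hD : zzBig D) {δ : ℂ} (hδ : δ = 0 ∨ δ = 1) {s : ℂ} (h1 : -1 ≤ s.re)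
    (h2 : s.re ≤ 2) (hs : zzN D s) : ‖deriv (zzg δ) s / zzg δ s‖ ≤ 8 * bigL D := by
  have key : ∀ z ∈ Metric.ball s (1/2), zzW D z ∧ -2 ≤ z.re ∧ z.re ≤ 3 := by
    intro z hz
    rw [Metric.mem_ball, dist_eq_norm] at hz
    have a1 := (Complex.abs_re_le_norm (z - s)).trans hz.le
    have a2 := (Complex.abs_im_le_norm (z - s)).trans hz.le
    simp only [Complex.sub_re, Complex.sub_im] at a1 a2
    have a3 := abs_le.1 a1
    exact ⟨zzN_W hD hs (by linarith), by linarith, by linarith⟩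
  have := zz_logderiv_bound (f := zzg δ) (a := s) (R := 1/2) (M := bigL D) (by norm_num) hD.pos
    (fun z hz => (zzg_diff (zz_del_im hδ) (zzW_im hD (key z hz).1).2.2.2).differentiableWithinAt)
    (fun z hz => zzg_ne (zz_del_im hδ) (zzW_im hD (key z hz).1).2.2.2)
    (fun z hz => by
      have b1 := zzg_L hD hδ (key z hz).2.1 (key z hz).2.2 (key z hz).1
      have hss := key s (Metric.mem_ball_self (by norm_num))
      have b2 := zzg_L_lower hD hδ hss.2.1 hss.2.2 hss.1
      calc ‖zzg δ z‖ ≤ Real.exp (bigL D / 2) * 1 := by rw [mul_one]; exact b1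
        _ ≤ Real.exp (bigL D / 2) * (Real.exp (bigL D / 2) * ‖zzg δ s‖) := by gcongr
        _ = _ := by rw [← mul_assoc, ← Real.exp_add, add_halves])
  calc _ ≤ _ := this
    _ = _ := by ring

theorem zz_growth' {f : ℂ → ℂ} {a b : ℂ} {M : ℝ} (hM : 0 ≤ M) (hfa : f a ≠ 0)
    (hf : ∀ z ∈ segment ℝ a b, DifferentiableAt ℂ f z)
    (hne : ∀ z ∈ segment ℝ a b, f z ≠ 0)
    (hb : ∀ z ∈ segment ℝ a b, ‖deriv f z / f z‖ ≤ M) :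
    ‖f b - f a‖ ≤ ‖f a‖ * (Real.exp (M * ‖b - a‖) - 1) ∧ ‖f b‖ ≤ ‖f a‖ * Real.exp (M * ‖b - a‖) := by
  have h := zz_growth hM hfa hf (fun z hz => by
    have := hb z hz
    rwa [norm_div, div_le_iff₀ (norm_pos_iff.2 (hne z hz))] at this)
  refine ⟨h, ?_⟩
  have := norm_le_norm_add_norm_sub' (f b) (f a)
  linarith

/-- horizontal segment -/
theorem zz_seg {s z : ℂ} (hz : z ∈ segment ℝ (⟨1/2, s.im⟩ : ℂ) s) :
    z.im = s.im ∧ ((1/2 ≤ z.re ∧ z.re ≤ s.re) ∨ (s.re ≤ z.re ∧ z.re ≤ 1/2)) := by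
  obtain ⟨a, b, ha, hb, hab, rfl⟩ := hz
  have hb' : b = 1 - a := by linarith
  subst hb'
  constructor
  · simp; ring
  · simp
    rcases le_total (1/2) s.re with h | h
    · left; constructor <;> nlinarith
    · right; constructor <;> nlinarith

theorem zz_seg_norm (s : ℂ) : ‖s - (⟨1/2, s.im⟩ : ℂ)‖ = |s.re - 1/2| := by
  have : s - (⟨1/2, s.im⟩ : ℂ) = ((s.re - 1/2 : ℝ) : ℂ) := by
    apply Complex.ext <;> simp
  rw [this, Complex.norm_real, Real.norm_eq_abs]

theorem zzg_growth {D : ℕ} (hD : zzBig D) {δ : ℂ} (hδ : δ = 0 ∨ δ = 1) {s : ℂ} (h1 : -1 ≤ s.re)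
    (h2 : s.re ≤ 2) (hs : zzN D s) : ‖zzg δ s‖ ≤ Real.exp (8 * bigL D * |s.re - 1/2|) := by
  have hW : zzW D s := zzN_W hD hs (by simp)
  have him := (zzW_im hD hW).2.2.2
  have key : ∀ z ∈ segment ℝ (⟨1/2, s.im⟩ : ℂ) s, zzN D z ∧ z.im ≠ 0 ∧ -1 ≤ z.re ∧ z.re ≤ 2 := by
    intro z hz
    obtain ⟨e, h⟩ := zz_seg hz
    refine ⟨by unfold zzN at *; rwa [e], by rwa [e], ?_, ?_⟩ <;> rcases h with h | h <;> linarith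
  have := (zz_growth' (f := zzg δ) (a := ⟨1/2, s.im⟩) (b := s) (M := 8 * bigL D)
    (by have := hD.pos; positivity)
    (zzg_ne (zz_del_im hδ) him) (fun z hz => zzg_diff (zz_del_im hδ) (key z hz).2.1)
    (fun z hz => zzg_ne (zz_del_im hδ) (key z hz).2.1)
    (fun z hz => zzg_logderiv hD hδ (key z hz).2.2.1 (key z hz).2.2.2 (key z hz).1)).2
  rwa [zzg_line (s := ⟨1/2, s.im⟩) hδ him rfl, one_mul, zz_seg_norm] at this

/-- f^♯ -/
def zzSh (f : ℂ → ℂ) (s : ℂ) : ℂ := conj (f (1 - conj s))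

theorem zz_refl_refl (s : ℂ) : 1 - conj (1 - conj s) = s := by simp

theorem zzSh_hasDeriv {f : ℂ → ℂ} {s : ℂ} (hf : DifferentiableAt ℂ f (1 - conj s)) :
    HasDerivAt (zzSh f) (-conj (deriv f (1 - conj s))) s := by
  have e : 1 - conj s = conj (1 - s) := by simp
  rw [e] at hf ⊢
  have h2 := hf.hasDerivAt.conj_conj
  rw [Complex.conj_conj] at h2
  have h3 := h2.comp_const_sub 1 s
  refine h3.congr_of_eventuallyEq (Filter.Eventually.of_forall (fun z => ?_))
  simp [zzSh]



/-- The size of `p`. -/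
structure zzP (D p : ℕ) : Prop where
  pos : 0 < p
  lo : bigL D ^ 9 ≤ Real.log p
  hi : Real.log p ≤ bigL D ^ 9 + 1

theorem zzP_of {D p : ℕ} (hD : zzBig D) (h : SimP D p) : zzP D p := by
  obtain ⟨h1, h2, h3⟩ := h
  have hp : (0:ℝ) < p := by exact_mod_cast h1.pos
  have hL := hD.pos
  refine ⟨h1.pos, ?_, ?_⟩
  · rw [Real.le_log_iff_exp_le hp]; exact h2.le
  · rw [Real.log_le_iff_le_exp hp, Real.exp_add]
    refine h3.le.trans ?_
    rw [bigP]
    gcongr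
    have : bigL D ^ (-68 : ℤ) ≤ 1 := by
      rw [zpow_neg]
      apply inv_le_one_of_one_le₀
      exact one_le_pow₀ hD.one
    have h4 := Real.add_one_le_exp (1:ℝ)
    linarith

/-- product modulus -/
def zzk (D p : ℕ) : ℕ := p * (D * p)
/-- length -/
def zzLen (D p : ℕ) : ℝ := Real.sqrt D * p * t0 D
/-- log of modulus -/
def zzLam (D p : ℕ) : ℝ := Real.log (zzk D p)

theorem zzLam_eq {D p : ℕ} (hD : zzBig D) (hp : zzP D p) :
    zzLam D p = bigL D + 2 * Real.log p := by
  have h1 : (p:ℝ) ≠ 0 := by exact_mod_cast hp.pos.ne'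
  have h2 : (D:ℝ) ≠ 0 := by exact_mod_cast hD.D_pos.ne'
  rw [zzLam, zzk]; push_cast
  rw [Real.log_mul h1 (mul_ne_zero h2 h1), Real.log_mul h2 h1, bigL]; ring

theorem zzk_pos {D p : ℕ} (hD : zzBig D) (hp : zzP D p) : 0 < zzk D p :=
  Nat.mul_pos hp.pos (Nat.mul_pos hD.D_pos hp.pos)

theorem zzLen_pos {D p : ℕ} (hD : zzBig D) (hp : zzP D p) : 0 < zzLen D p := by
  have h1 : (0:ℝ) < p := by exact_mod_cast hp.pos
  have h2 : (0:ℝ) < D := by exact_mod_cast hD.D_pos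
  have := hD.pos
  unfold zzLen t0; positivity

theorem zzLen_log {D p : ℕ} (hD : zzBig D) (hp : zzP D p) :
    bigL D ^ 9 ≤ Real.log (zzLen D p) ∧ Real.log (zzLen D p) ≤ bigL D ^ 9 + bigL D := by
  have h1 : (0:ℝ) < p := by exact_mod_cast hp.pos
  have h2 : (0:ℝ) < D := by exact_mod_cast hD.D_pos
  have hL := hD.pos
  have hs : 0 < Real.sqrt D := Real.sqrt_pos.2 h2
  have ht : 0 < t0 D := by unfold t0; positivity
  have e : Real.log (zzLen D p) = bigL D / 2 + Real.log p + 519 * Real.log (bigL D) := by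
    rw [zzLen, Real.log_mul (by positivity) ht.ne', Real.log_mul hs.ne' h1.ne', Real.log_sqrt h2.le, t0,
      Real.log_pow, bigL]; push_cast; ring
  have h3 := zz_log_le hD
  have h4 : 0 ≤ Real.log (bigL D) := Real.log_nonneg hD.one
  have h5 : (100:ℝ) ≤ bigL D := le_trans (by norm_num) hD.1
  have := hp.lo; have := hp.hi
  rw [e]; constructor <;> linarith

/-- Properties of the factor in the functional equation. -/
structure zzZP (D p : ℕ) (Z : ℂ → ℂ) : Prop where
  diff : ∀ s, zzW D s → DifferentiableAt ℂ Z s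
  ne : ∀ s, zzW D s → Z s ≠ 0
  refl : ∀ s, zzW D s → Z s * conj (Z (1 - conj s)) = 1
  crude : ∀ s : ℂ, zzW D s → -2 ≤ s.re → s.re ≤ 3 → ‖Z s‖ ≤ Real.exp (6 * bigL D ^ 9)
  ld : ∀ s : ℂ, zzN D s → -1 ≤ s.re → s.re ≤ 2 → ‖deriv Z s / Z s + zzLam D p‖ ≤ 16 * bigL D
  growth : ∀ s : ℂ, zzN D s → -1 ≤ s.re → s.re ≤ 2 →
    ‖Z s‖ ≤ Real.exp (-zzLam D p * (s.re - 1/2) + 16 * bigL D * |s.re - 1/2|)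
  right : ∀ s : ℂ, zzW D s → s.re = 5/2 → ‖Z s‖ * zzLen D p ^ 4 ≤ 4 ∧ 1 ≤ 4 * (‖Z s‖ * zzLen D p ^ 4)

theorem zzg_right_t0 {D : ℕ} (hD : zzBig D) {δ : ℂ} (hδ : δ = 0 ∨ δ = 1) {s : ℂ} (h1 : s.re = 5/2)
    (hs : zzW D s) : t0 D ^ 2 * ‖zzg δ s‖ ≤ 2 ∧ 1 ≤ 2 * (t0 D ^ 2 * ‖zzg δ s‖) := by
  obtain ⟨a1, a2⟩ := zzg_right hδ h1 (zzW_im hD hs).2.2.1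
  have b := abs_le.1 hs
  have hp := Real.pi_gt_three
  have hp2 := Real.pi_lt_four
  have h2 := zz_pow_mul_le hD.1 (show 406 < 519 by norm_num)
  have h3 := zz_pow_ge hD (show 1 ≤ 406 by norm_num)
  have ht : t0 D = bigL D ^ 519 := rfl
  rw [← ht] at h2
  clear ht
  generalize t0 D = T at *
  generalize bigL D ^ 406 = q at *
  have hq : 100 ≤ q := le_trans (by norm_num) h3
  have hq2 : 100 * q ≤ T := le_trans (by gcongr; norm_num) h2
  have hg := norm_nonneg (zzg δ s)
  set g := ‖zzg δ s‖
  have hpi := Real.pi_pos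
  have c1 : (9/10) * (Real.pi * T) ≤ s.im / 2 := by nlinarith
  have c2 : s.im / 2 + 1 ≤ (11/10) * (Real.pi * T) := by nlinarith
  have htp : 0 ≤ Real.pi * T := by nlinarith
  have d1 : ((9/10) * (Real.pi * T)) ^ 2 * g ≤ Real.pi ^ 2 := le_trans (by gcongr) a1
  have d2 : Real.pi ^ 2 ≤ ((11/10) * (Real.pi * T)) ^ 2 * g := a2.trans (by
    have : 0 ≤ s.im/2 + 1 := by linarith
    gcongr)
  have hpp : 0 < Real.pi ^ 2 := by positivity
  have e1 : Real.pi ^ 2 * ((81/100) * (T ^ 2 * g)) ≤ Real.pi ^ 2 * 1 := by linarith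
  have e2 : Real.pi ^ 2 * 1 ≤ Real.pi ^ 2 * ((121/100) * (T ^ 2 * g)) := by linarith
  have f1 := le_of_mul_le_mul_left e1 hpp
  have f2 := le_of_mul_le_mul_left e2 hpp
  constructor <;> linarith

/-- The factor. -/
def zzZ (ε δ₁ δ₂ : ℂ) (k : ℕ) (s : ℂ) : ℂ := ε * (k:ℂ) ^ (1/2 - s) * (zzg δ₁ s * zzg δ₂ s)

theorem zzZ_P {D p : ℕ} (hD : zzBig D) (hp : zzP D p) {ε δ₁ δ₂ : ℂ} (hε : ‖ε‖ = 1)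
    (h₁ : δ₁ = 0 ∨ δ₁ = 1) (h₂ : δ₂ = 0 ∨ δ₂ = 1) : zzZP D p (zzZ ε δ₁ δ₂ (zzk D p)) := by
  have hk := zzk_pos hD hp
  have hkc : ((zzk D p : ℕ) : ℂ) ≠ 0 := by exact_mod_cast hk.ne'
  have hkr : (0:ℝ) < zzk D p := by exact_mod_cast hk
  have hε0 : ε ≠ 0 := by intro h; simp [h] at hε
  have hL := hD.pos
  have i1 := zz_del_im h₁
  have i2 := zz_del_im h₂
  have hnorm : ∀ s, ‖zzZ ε δ₁ δ₂ (zzk D p) s‖ = Real.exp (-zzLam D p * (s.re - 1/2)) * (‖zzg δ₁ s‖ * ‖zzg δ₂ s‖) := by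
    intro s
    rw [zzZ, norm_mul, norm_mul, norm_mul, hε, one_mul, Complex.norm_natCast_cpow_of_pos hk,
      Real.rpow_def_of_pos hkr, zzLam]
    congr 2
    simp
    ring
  have hder : ∀ s, zzW D s → HasDerivAt (zzZ ε δ₁ δ₂ (zzk D p))
      (ε * ((zzk D p : ℕ) : ℂ) ^ (1/2 - s) * (-Complex.log (zzk D p)) * (zzg δ₁ s * zzg δ₂ s) +
        ε * ((zzk D p : ℕ) : ℂ) ^ (1/2 - s) * (deriv (zzg δ₁) s * zzg δ₂ s + zzg δ₁ s * deriv (zzg δ₂) s)) s := by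
    intro s hs
    have him := (zzW_im hD hs).2.2.2
    have d1 : HasDerivAt (fun s => ((zzk D p : ℕ) : ℂ) ^ (1/2 - s)) _ s :=
      ((hasDerivAt_id s).const_sub (1/2)).const_cpow (Or.inl hkc)
    have d2 := (d1.const_mul ε).mul ((zzg_diff i1 him).hasDerivAt.mul (zzg_diff i2 him).hasDerivAt)
    have e : ∀ x y : ℂ, x = y → HasDerivAt (zzZ ε δ₁ δ₂ (zzk D p)) x s → HasDerivAt (zzZ ε δ₁ δ₂ (zzk D p)) y s :=
      fun x y h h' => h ▸ h'
    refine e _ _ ?_ d2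
    simp only [id, Pi.mul_apply]
    ring
  have hne : ∀ s, zzW D s → zzZ ε δ₁ δ₂ (zzk D p) s ≠ 0 := by
    intro s hs
    have him := (zzW_im hD hs).2.2.2
    exact mul_ne_zero (mul_ne_zero hε0 (by rw [Complex.cpow_ne_zero_iff]; exact Or.inl hkc))
      (mul_ne_zero (zzg_ne i1 him) (zzg_ne i2 him))
  have hLam := zzLam_eq hD hp
  refine ⟨fun s hs => (hder s hs).differentiableAt, hne, ?_, ?_, ?_, ?_, ?_⟩
  · intro s hs
    have him := (zzW_im hD hs).2.2.2
    have r1 := zzg_refl i1 him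
    have r2 := zzg_refl i2 him
    have r3 : ε * conj ε = 1 := by rw [Complex.mul_conj, Complex.normSq_eq_norm_sq, hε]; simp
    have r4 : ((zzk D p : ℕ) : ℂ) ^ (1/2 - s) * conj (((zzk D p : ℕ) : ℂ) ^ (1/2 - (1 - conj s))) = 1 := by
      rw [← zz_ncpow_conj, ← Complex.cpow_add _ _ hkc]
      have : (1/2 - s) + conj (1/2 - (1 - conj s)) = 0 := by
        simp only [map_sub, map_div₀, map_one, Complex.conj_conj, Complex.conj_ofNat]; ring
      rw [this, Complex.cpow_zero]
    simp only [zzZ, map_mul]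
    calc _ = (ε * conj ε) * (((zzk D p : ℕ) : ℂ) ^ (1/2 - s) * conj (((zzk D p : ℕ) : ℂ) ^ (1/2 - (1 - conj s)))) *
          (zzg δ₁ s * conj (zzg δ₁ (1 - conj s))) * (zzg δ₂ s * conj (zzg δ₂ (1 - conj s))) := by ring
      _ = 1 := by rw [r1, r2, r3, r4]; ring
  · intro s hs h1 h2
    rw [hnorm]
    have g1 := zzg_L hD h₁ h1 h2 hs
    have g2 := zzg_L hD h₂ h1 h2 hs
    have hl : 0 ≤ zzLam D p := by rw [hLam]; have := hp.lo; have : 0 ≤ bigL D ^ 9 := by positivity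
                                  linarith
    calc Real.exp (-zzLam D p * (s.re - 1/2)) * (‖zzg δ₁ s‖ * ‖zzg δ₂ s‖)
        ≤ Real.exp (zzLam D p * (5/2)) * (Real.exp (bigL D / 2) * Real.exp (bigL D / 2)) := by
          refine mul_le_mul (Real.exp_le_exp.2 (by nlinarith)) (mul_le_mul g1 g2 (norm_nonneg _) (Real.exp_pos _).le)
            (by positivity) (Real.exp_pos _).le
      _ = Real.exp (zzLam D p * (5/2) + bigL D) := by rw [← Real.exp_add, ← Real.exp_add, add_halves]
      _ ≤ _ := by
        apply Real.exp_le_exp.2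
        rw [hLam]
        have h9 := zz_pow_mul_le hD.1 (show 1 < 9 by norm_num)
        have h10 : 100 * bigL D ≤ bigL D ^ 9 := le_trans (by rw [pow_one]; gcongr; norm_num) h9
        have := hp.hi
        have := hD.one
        linarith
  · intro s hN h1 h2
    have hs : zzW D s := zzN_W hD hN (by simp)
    have him := (zzW_im hD hs).2.2.2
    have g1 := zzg_logderiv hD h₁ h1 h2 hN
    have g2 := zzg_logderiv hD h₂ h1 h2 hN
    have e : deriv (zzZ ε δ₁ δ₂ (zzk D p)) s / zzZ ε δ₁ δ₂ (zzk D p) s + zzLam D p =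
        deriv (zzg δ₁) s / zzg δ₁ s + deriv (zzg δ₂) s / zzg δ₂ s := by
      rw [(hder s hs).deriv, zzLam, Complex.ofReal_log hkr.le, Complex.ofReal_natCast, zzZ]
      have n1 := zzg_ne i1 him
      have n2 := zzg_ne i2 him
      have n3 : ((zzk D p : ℕ) : ℂ) ^ (1/2 - s) ≠ 0 := by rw [Complex.cpow_ne_zero_iff]; exact Or.inl hkc
      generalize ((zzk D p : ℕ) : ℂ) ^ (1/2 - s) = w at *
      field_simp
      ring
    rw [e]
    refine (norm_add_le _ _).trans ?_
    linarith
  · intro s hN h1 h2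
    rw [hnorm, Real.exp_add]
    have g1 := zzg_growth hD h₁ h1 h2 hN
    have g2 := zzg_growth hD h₂ h1 h2 hN
    gcongr
    calc ‖zzg δ₁ s‖ * ‖zzg δ₂ s‖ ≤ _ := mul_le_mul g1 g2 (norm_nonneg _) (Real.exp_pos _).le
      _ = _ := by rw [← Real.exp_add]; ring_nf
  · intro s hs h1
    obtain ⟨a1, a2⟩ := zzg_right_t0 hD h₁ h1 hs
    obtain ⟨b1, b2⟩ := zzg_right_t0 hD h₂ h1 hs
    have e1 : zzLen D p ^ 4 = (zzk D p : ℝ) ^ 2 * (t0 D ^ 2 * t0 D ^ 2) := by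
      have h2 : (0:ℝ) ≤ D := Nat.cast_nonneg D
      have : Real.sqrt D ^ 4 = (D:ℝ) ^ 2 := by
        rw [show (4:ℕ) = 2 * 2 by norm_num, pow_mul, Real.sq_sqrt h2]
      rw [zzLen, mul_pow, mul_pow, this, zzk]; push_cast; ring
    have e2 : Real.exp (-zzLam D p * (s.re - 1/2)) = ((zzk D p : ℝ) ^ 2)⁻¹ := by
      rw [h1, zzLam, show -Real.log (zzk D p : ℝ) * (5/2 - 1/2) = -(((2:ℕ):ℝ) * Real.log (zzk D p : ℝ)) by push_cast; ring, Real.exp_neg, Real.exp_nat_mul, Real.exp_log hkr]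
    have e3 : ‖zzZ ε δ₁ δ₂ (zzk D p) s‖ * zzLen D p ^ 4 = (t0 D ^ 2 * ‖zzg δ₁ s‖) * (t0 D ^ 2 * ‖zzg δ₂ s‖) := by
      rw [hnorm, e1, e2]
      field_simp
    rw [e3]
    have p1 : 0 ≤ t0 D ^ 2 * ‖zzg δ₁ s‖ := by positivity
    have p2 : 0 ≤ t0 D ^ 2 * ‖zzg δ₂ s‖ := by positivity
    constructor <;> nlinarith


theorem zz_chiPsi_apply (D : ℕ) (χ : DirichletCharacter ℂ D) {p : ℕ} (ψ : DirichletCharacter ℂ p) (n : ℕ) :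
    chiPsi D χ ψ (n : ZMod (D * p)) = χ (n : ZMod D) * ψ (n : ZMod p) := by
  rw [chiPsi, MulChar.mul_apply]
  by_cases h : n.Coprime (D * p)
  · have hc : IsCoprime (n : ℤ) ((D * p : ℕ) : ℤ) := Nat.isCoprime_iff_coprime.2 h
    have h1 := DirichletCharacter.changeLevel_eq_cast_of_dvd' χ (dvd_mul_right D p) hc
    have h2 := DirichletCharacter.changeLevel_eq_cast_of_dvd' ψ (dvd_mul_left p D) hc
    simp only [Int.cast_natCast] at h1 h2
    rw [h1, h2]
  · have hu : ¬ IsUnit ((n : ℕ) : ZMod (D * p)) := fun hu => h ((ZMod.isUnit_iff_coprime _ _).1 hu)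
    rw [MulChar.map_nonunit _ hu, zero_mul]
    rw [Nat.coprime_mul_iff_right, not_and_or] at h
    rcases h with h | h
    · rw [MulChar.map_nonunit χ (fun hu => h ((ZMod.isUnit_iff_coprime _ _).1 hu)), zero_mul]
    · rw [MulChar.map_nonunit ψ (fun hu => h ((ZMod.isUnit_iff_coprime _ _).1 hu)), mul_zero]

theorem zz_chiPsi_prim {D : ℕ} {χ : DirichletCharacter ℂ D} {p : ℕ} {ψ : DirichletCharacter ℂ p}
    [NeZero (D * p)] (hc : Nat.Coprime D p)
    (h1 : χ.IsPrimitive) (h2 : ψ.IsPrimitive) : (chiPsi D χ ψ).IsPrimitive := by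
  rw [DirichletCharacter.isPrimitive_def] at *
  set a := DirichletCharacter.changeLevel (dvd_mul_right D p) χ with ha
  set b := DirichletCharacter.changeLevel (dvd_mul_left p D) ψ with hb
  have ca : a.conductor = D := by rw [ha, DirichletCharacter.conductor_changeLevel, h1]
  have cb : b.conductor = p := by rw [hb, DirichletCharacter.conductor_changeLevel, h2]
  have e1 : chiPsi D χ ψ * b⁻¹ = a := by rw [chiPsi, ← ha, ← hb]; simp
  have e2 : chiPsi D χ ψ * a⁻¹ = b := by
    rw [chiPsi, ← ha, ← hb]; exact mul_inv_cancel_comm a b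
  have d1 := DirichletCharacter.conductor_mul_dvd_lcm_conductor (chiPsi D χ ψ) b⁻¹
  have d2 := DirichletCharacter.conductor_mul_dvd_lcm_conductor (chiPsi D χ ψ) a⁻¹
  rw [e1, DirichletCharacter.conductor_inv, ca, cb] at d1
  rw [e2, DirichletCharacter.conductor_inv, ca, cb] at d2
  have f1 : D ∣ (chiPsi D χ ψ).conductor :=
    hc.dvd_of_dvd_mul_right (d1.trans (Nat.lcm_dvd_mul _ _))
  have f2 : p ∣ (chiPsi D χ ψ).conductor :=
    hc.symm.dvd_of_dvd_mul_right (d2.trans (Nat.lcm_dvd_mul _ _))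
  exact Nat.dvd_antisymm (DirichletCharacter.conductor_dvd_level _) (hc.mul_dvd_of_dvd_of_dvd f1 f2)

/-- the product of the two L-functions -/
def zzA (D : ℕ) (χ : DirichletCharacter ℂ D) {p : ℕ} (ψ : DirichletCharacter ℂ p) (s : ℂ) : ℂ :=
  Lfun ψ s * Lfun (chiPsi D χ ψ) s

theorem Lfun_eq {N : ℕ} [h : NeZero N] (χ : DirichletCharacter ℂ N) (s : ℂ) :
    Lfun χ s = DirichletCharacter.LFunction χ s := by
  rw [Lfun, dif_neg h.ne]

theorem zz_conv (D : ℕ) (χ : DirichletCharacter ℂ D) {p : ℕ} (ψ : DirichletCharacter ℂ p) (n : ℕ) :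
    LSeries.convolution (fun n => ψ n) (fun n => chiPsi D χ ψ n) n = nuF D χ n * ψ n := by
  rw [LSeries.convolution_def]
  simp only [zz_chiPsi_apply]
  rw [nuF, Finset.sum_mul, Nat.sum_divisorsAntidiagonal' (f := fun a b => ψ (a : ZMod p) * (χ (b : ZMod D) * ψ (b : ZMod p)))]
  refine Finset.sum_congr rfl (fun d hd => ?_)
  have : ((n / d : ℕ) : ZMod p) * ((d : ℕ) : ZMod p) = (n : ZMod p) := by
    rw [← Nat.cast_mul, Nat.div_mul_cancel (Nat.dvd_of_mem_divisors hd)]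
  rw [← this, map_mul]
  ring

theorem zz_sum54 (N : ℕ) : ∑ n ∈ Finset.range N, ((n + 1 : ℕ) : ℝ) ^ (-(5/4 : ℝ)) ≤
    8 - 8 * ((N + 1 : ℕ) : ℝ) ^ (-(1/4 : ℝ)) := by
  induction N with
  | zero => simp
  | succ N ih =>
    rw [Finset.sum_range_succ]
    suffices h : ((N + 1 : ℕ) : ℝ) ^ (-(5/4 : ℝ)) ≤
        8 * ((N + 1 : ℕ) : ℝ) ^ (-(1/4 : ℝ)) - 8 * ((N + 1 + 1 : ℕ) : ℝ) ^ (-(1/4 : ℝ)) by linarith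
    have hm : (1:ℝ) ≤ ((N + 1 : ℕ) : ℝ) := by push_cast; linarith [(Nat.cast_nonneg N : (0:ℝ) ≤ N)]
    have e : ((N + 1 + 1 : ℕ) : ℝ) = ((N + 1 : ℕ) : ℝ) + 1 := by push_cast; ring
    rw [e]
    generalize ((N + 1 : ℕ) : ℝ) = m at *
    have hm0 : 0 < m := by linarith
    have hb := rpow_one_add_le_one_add_mul_self (s := -(1/(m+1))) (p := 1/4) (by
      rw [neg_le_neg_iff, div_le_one (by linarith)]; linarith) (by norm_num) (by norm_num)
    have e1 : 1 + -(1/(m+1)) = m * (m+1)⁻¹ := by field_simp; ring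
    rw [e1, Real.mul_rpow hm0.le (by positivity), Real.inv_rpow (by linarith), ← Real.rpow_neg (by linarith)] at hb
    have e2 : m ^ (-(5/4:ℝ)) = m ^ (-(1/4:ℝ)) * m⁻¹ := by
      rw [← Real.rpow_neg_one m, ← Real.rpow_add hm0]; norm_num
    have e3 : m ^ (-(1/4:ℝ)) * m ^ (1/4:ℝ) = 1 := by rw [← Real.rpow_add hm0]; norm_num
    rw [e2]
    have h0 : 0 < m ^ (-(1/4:ℝ)) := Real.rpow_pos_of_pos hm0 _
    have h1 : (m+1) ^ (-(1/4:ℝ)) ≤ m ^ (-(1/4:ℝ)) * (1 + 1/4 * -(1/(m+1))) := by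
      calc (m+1) ^ (-(1/4:ℝ)) = m ^ (-(1/4:ℝ)) * (m ^ (1/4:ℝ) * (m+1) ^ (-(1/4:ℝ))) := by
            rw [← mul_assoc, e3, one_mul]
        _ ≤ _ := by gcongr
    have h2 : m⁻¹ ≤ 2 * (1/(m+1)) := by
      rw [← one_div, ← mul_div_assoc, div_le_div_iff₀ hm0 (by linarith)]; linarith
    nlinarith

theorem zz_zeta54 : ‖riemannZeta ((5/4 : ℝ) : ℂ)‖ ≤ 8 := by
  have hre : 1 < (((5/4 : ℝ) : ℂ)).re := by rw [Complex.ofReal_re]; norm_num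
  have h := LSeriesHasSum_one hre
  rw [LSeriesHasSum, ← hasSum_nat_add_iff' 1] at h
  simp only [Finset.sum_range_one, LSeries.term_zero, sub_zero] at h
  refine le_of_tendsto' h.tendsto_sum_nat.norm (fun N => ?_)
  refine (norm_sum_le_of_le _ (fun n _ => ?_) : _ ≤ ∑ n ∈ Finset.range N, ((n + 1 : ℕ) : ℝ) ^ (-(5/4 : ℝ))).trans ?_
  · rw [LSeries.term_of_ne_zero (by omega), norm_div, Complex.norm_natCast_cpow_of_pos (by omega), Complex.ofReal_re,
      Real.rpow_neg (by positivity)]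
    simp
  · have := zz_sum54 N
    have h2 : (0:ℝ) ≤ ((N + 1 : ℕ) : ℝ) ^ (-(1/4 : ℝ)) := by positivity
    linarith

theorem zz_dsum : Summable (fun n : ℕ => (n.divisors.card : ℝ) * (n:ℝ) ^ (-(5/4:ℝ))) ∧
    ∑' n : ℕ, (n.divisors.card : ℝ) * (n:ℝ) ^ (-(5/4:ℝ)) ≤ 64 := by
  have hre : 1 < (((5/4 : ℝ) : ℂ)).re := by rw [Complex.ofReal_re]; norm_num
  have h := (LSeriesHasSum_one hre).convolution (LSeriesHasSum_one hre)
  rw [LSeriesHasSum] at h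
  have h2 := Complex.reCLM.hasSum h
  have e : (fun b => Complex.reCLM (LSeries.term (LSeries.convolution 1 1) ((5/4 : ℝ) : ℂ) b)) =
      (fun n : ℕ => (n.divisors.card : ℝ) * (n:ℝ) ^ (-(5/4:ℝ))) := by
    funext n
    rcases Nat.eq_zero_or_pos n with h0 | h0
    · simp [h0]
    · rw [LSeries.term_of_ne_zero h0.ne', LSeries.convolution_def]
      have e1 : ((n:ℂ)) ^ ((5/4 : ℝ) : ℂ) = (((n:ℝ) ^ (5/4:ℝ) : ℝ) : ℂ) := by
        rw [Complex.ofReal_cpow (Nat.cast_nonneg n), Complex.ofReal_natCast]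
      rw [e1, Real.rpow_neg (Nat.cast_nonneg n)]
      simp only [Pi.one_apply, mul_one, Finset.sum_const, nsmul_eq_mul]
      rw [div_eq_mul_inv, ← Complex.ofReal_inv]
      have e2 : (((n.divisorsAntidiagonal.card : ℕ)) : ℂ) = ((n.divisors.card : ℝ) : ℂ) := by
        rw [← Nat.map_div_right_divisors]; simp
      rw [e2, ← Complex.ofReal_mul]; rfl
  rw [e] at h2
  refine ⟨h2.summable, ?_⟩
  rw [h2.tsum_eq]
  refine (Complex.re_le_norm _).trans ?_
  rw [norm_mul]
  have := zz_zeta54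
  nlinarith [norm_nonneg (riemannZeta ((5/4 : ℝ) : ℂ))]


/-- properties of the product of L-functions -/
structure zzAP (D : ℕ) (χ : DirichletCharacter ℂ D) {p : ℕ} (ψ : DirichletCharacter ℂ p) (Z : ℂ → ℂ) : Prop where
  diff : Differentiable ℂ (zzA D χ ψ)
  fe : ∀ s, zzW D s → zzA D χ ψ s = Z s * zzSh (zzA D χ ψ) s
  crude : ∀ s : ℂ, zzW D s → -3/2 ≤ s.re → s.re ≤ 5/2 → ‖zzA D χ ψ s‖ ≤ Real.exp (9 * bigL D ^ 9)
  tail : ∀ s : ℂ, s.re = 5/2 → ∀ M : ℕ, ‖zzA D χ ψ s - ∑ n ∈ Finset.Icc 1 M, nuF D χ n * zzphi ψ s n‖ ≤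
    64 * ((M + 1 : ℕ) : ℝ) ^ (-(5/4 : ℝ))

theorem zz_nu_card (D : ℕ) (χ : DirichletCharacter ℂ D) (n : ℕ) : ‖nuF D χ n‖ ≤ n.divisors.card := by
  rw [nuF]
  refine (norm_sum_le_of_le _ (fun d _ => DirichletCharacter.norm_le_one χ _)).trans ?_
  simp

theorem zz_A_tail (D : ℕ) [NeZero D] (χ : DirichletCharacter ℂ D) {p : ℕ} [NeZero p] (ψ : DirichletCharacter ℂ p)
    {s : ℂ} (hs : s.re = 5/2) (M : ℕ) :
    ‖zzA D χ ψ s - ∑ n ∈ Finset.Icc 1 M, nuF D χ n * zzphi ψ s n‖ ≤ 64 * ((M + 1 : ℕ) : ℝ) ^ (-(5/4 : ℝ)) := by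
  have hre : 1 < s.re := by rw [hs]; norm_num
  have h1 : LSeriesHasSum (fun n => ψ n) s (Lfun ψ s) := by
    rw [Lfun_eq, DirichletCharacter.LFunction_eq_LSeries ψ hre]
    exact (DirichletCharacter.LSeriesSummable_of_one_lt_re ψ hre).LSeriesHasSum
  have h2 : LSeriesHasSum (fun n => chiPsi D χ ψ n) s (Lfun (chiPsi D χ ψ) s) := by
    rw [Lfun_eq, DirichletCharacter.LFunction_eq_LSeries _ hre]
    exact (DirichletCharacter.LSeriesSummable_of_one_lt_re _ hre).LSeriesHasSum
  have h3 := h1.convolution h2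
  rw [LSeriesHasSum, ← hasSum_nat_add_iff' (M + 1)] at h3
  have e1 : ∀ n : ℕ, n ≠ 0 → LSeries.term (LSeries.convolution (fun n => ψ n) (fun n => chiPsi D χ ψ n)) s n
      = nuF D χ n * zzphi ψ s n := by
    intro n hn
    rw [LSeries.term_of_ne_zero hn, zz_conv, zzphi, Complex.cpow_neg, div_eq_mul_inv, mul_assoc]
  have e2 : ∑ i ∈ Finset.range (M + 1), LSeries.term (LSeries.convolution (fun n => ψ n) (fun n => chiPsi D χ ψ n)) s i
      = ∑ n ∈ Finset.Icc 1 M, nuF D χ n * zzphi ψ s n := by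
    rw [Finset.sum_range_succ', LSeries.term_zero, add_zero]
    have hI : Finset.Icc 1 M = Finset.Ico 1 (M + 1) := by ext x; simp
    rw [hI, Finset.sum_Ico_eq_sum_range]
    refine Finset.sum_congr (by simp) (fun i _ => ?_)
    rw [e1 _ (by omega), add_comm 1 i]
  rw [e2] at h3
  have ds := zz_dsum
  have dsM := (summable_nat_add_iff (M+1)).2 ds.1
  set q := ((M + 1 : ℕ) : ℝ) ^ (-(5/4 : ℝ)) with hq
  have hq0 : 0 ≤ q := by positivity
  have hb : ∀ n : ℕ, ‖LSeries.term (LSeries.convolution (fun n => ψ n) (fun n => chiPsi D χ ψ n)) s (n + (M+1))‖ ≤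
      q * (((n + (M + 1)).divisors.card : ℝ) * ((n + (M+1) : ℕ) : ℝ) ^ (-(5/4 : ℝ))) := by
    intro n
    rw [e1 _ (by omega), norm_mul]
    have hn : (0:ℝ) < ((n + (M+1) : ℕ) : ℝ) := by exact_mod_cast (by omega)
    have f1 := zz_phi_norm ψ s (show n + (M+1) ≠ 0 by omega)
    have f2 : ((n + (M+1) : ℕ) : ℝ) ^ (-s.re) = ((n + (M+1) : ℕ) : ℝ) ^ (-(5/4 : ℝ)) * ((n + (M+1) : ℕ) : ℝ) ^ (-(5/4 : ℝ)) := by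
      rw [← Real.rpow_add hn, hs]; norm_num
    have f3 : ((n + (M+1) : ℕ) : ℝ) ^ (-(5/4 : ℝ)) ≤ q :=
      Real.rpow_le_rpow_of_nonpos (by positivity) (by exact_mod_cast (by omega)) (by norm_num)
    rw [f2] at f1
    calc _ ≤ ((n + (M + 1)).divisors.card : ℝ) * (((n + (M+1) : ℕ) : ℝ) ^ (-(5/4 : ℝ)) * ((n + (M+1) : ℕ) : ℝ) ^ (-(5/4 : ℝ))) :=
          mul_le_mul (zz_nu_card D χ _) f1 (norm_nonneg _) (by positivity)
      _ ≤ ((n + (M + 1)).divisors.card : ℝ) * (q * ((n + (M+1) : ℕ) : ℝ) ^ (-(5/4 : ℝ))) := by gcongr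
      _ = _ := by ring
  have hle : ‖∑' n : ℕ, LSeries.term (LSeries.convolution (fun n => ψ n) (fun n => chiPsi D χ ψ n)) s (n + (M+1))‖ ≤ _ :=
    tsum_of_norm_bounded (dsM.mul_left q).hasSum hb
  rw [h3.tsum_eq] at hle
  refine hle.trans ?_
  rw [tsum_mul_left, mul_comm]
  refine mul_le_mul_of_nonneg_right ?_ hq0
  have hsp := ds.1.sum_add_tsum_nat_add (M+1)
  have hpos : 0 ≤ ∑ i ∈ Finset.range (M + 1), (i.divisors.card : ℝ) * (i:ℝ) ^ (-(5/4:ℝ)) :=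
    Finset.sum_nonneg (fun i _ => by positivity)
  linarith [ds.2]

theorem zz_A_struct {D : ℕ} (hD : zzBig D) {χ : DirichletCharacter ℂ D} (hχp : χ.IsPrimitive) {p : ℕ}
    {ψ : DirichletCharacter ℂ p} (h : MemPsi1 D χ ψ) :
    ∃ Z, zzZP D p Z ∧ zzAP D χ ψ Z := by
  obtain ⟨hS, hψ, -⟩ := h
  have hp := zzP_of hD hS
  have hDpos := hD.D_pos
  have : NeZero p := ⟨hp.pos.ne'⟩
  have : NeZero D := ⟨hDpos.ne'⟩
  have hp1 : 1 < p := hS.1.one_lt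
  have hL1 := hD.one
  have hDp : D < p := by
    have h1 : (D:ℝ) = Real.exp (bigL D) := by
      rw [bigL, Real.exp_log (by exact_mod_cast hDpos)]
    have h2 := hS.2.1
    have h3 : (D:ℝ) < p := by
      rw [h1]
      refine lt_of_le_of_lt (Real.exp_le_exp.2 ?_) h2
      exact le_self_pow₀ hL1 (by norm_num)
    exact_mod_cast h3
  have hcop : Nat.Coprime D p := ((Nat.Prime.coprime_iff_not_dvd hS.1).2 (fun hd => by
    have := Nat.le_of_dvd hDpos hd; omega)).symm
  have hprim := zz_chiPsi_prim hcop hχp hψ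
  have hDp1 : 1 < D * p := lt_of_lt_of_le hp1 (Nat.le_mul_of_pos_left p hDpos)
  have hψ1 := zz_prim_ne_one hp1 hψ
  have hc1 := zz_prim_ne_one hDp1 hprim
  obtain ⟨ε₁, δ₁, a1, a2, a3⟩ := zz_FE hp1 hψ
  obtain ⟨ε₂, δ₂, b1, b2, b3⟩ := zz_FE hDp1 hprim
  have hZ := zzZ_P hD hp (ε := ε₁ * ε₂) (by rw [norm_mul, a1, b1, one_mul]) a2 b2
  refine ⟨zzZ (ε₁ * ε₂) δ₁ δ₂ (zzk D p), hZ, ?_⟩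
  have hA : zzA D χ ψ = fun s => DirichletCharacter.LFunction ψ s * DirichletCharacter.LFunction (chiPsi D χ ψ) s := by
    funext s; rw [zzA, Lfun_eq, Lfun_eq]
  have hfe : ∀ s, zzW D s → zzA D χ ψ s = zzZ (ε₁ * ε₂) δ₁ δ₂ (zzk D p) s * zzSh (zzA D χ ψ) s := by
    intro s hs
    have him := (zzW_im hD hs).2.2.2
    rw [zzSh, hA]
    simp only
    rw [a3 s him, b3 s him, map_mul, zzZ]
    have : ((zzk D p : ℕ) : ℂ) ^ (1/2 - s) = (p:ℂ) ^ (1/2 - s) * ((D * p : ℕ) : ℂ) ^ (1/2 - s) := by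
      rw [zzk, ← Complex.natCast_mul_natCast_cpow, ← Nat.cast_mul]
    rw [this]; ring
  have hR : ∀ s : ℂ, zzW D s → 1/2 ≤ s.re → s.re ≤ 5/2 → ‖zzA D χ ψ s‖ ≤ Real.exp (3 * bigL D ^ 9) := by
    intro s hs h1 h2
    rw [hA]; simp only
    rw [norm_mul]
    have c1 := zz_L_crude hψ1 h1
    have c2 := zz_L_crude hc1 h1
    have hn : ‖s‖ ≤ 10 * bigL D ^ 519 := by
      refine (Complex.norm_le_abs_re_add_abs_im s).trans ?_
      rw [abs_of_nonneg (by linarith), abs_of_nonneg (by linarith [(zzW_im hD hs).2.2.1])]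
      have := (zzW_im hD hs).2.1
      have := one_le_pow₀ hL1 (n := 519)
      linarith
    have hk : ((zzk D p : ℕ) : ℝ) = Real.exp (zzLam D p) := by
      rw [zzLam, Real.exp_log (by exact_mod_cast zzk_pos hD hp)]
    have hk2 : (p:ℝ) * ((D * p : ℕ):ℝ) = ((zzk D p : ℕ) : ℝ) := by rw [zzk]; push_cast; ring
    have hlam : zzLam D p ≤ 2 * bigL D ^ 9 + 2 + bigL D := by rw [zzLam_eq hD hp]; linarith [hp.hi]
    have hL9 := zz_pow_mul_le hD.1 (show 1 < 9 by norm_num)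
    rw [pow_one] at hL9
    calc _ ≤ (4 * p * ‖s‖) * (4 * (D * p : ℕ) * ‖s‖) := mul_le_mul c1 c2 (norm_nonneg _) (by positivity)
      _ = 16 * ((p:ℝ) * ((D * p : ℕ):ℝ)) * ‖s‖ ^ 2 := by ring
      _ = 16 * Real.exp (zzLam D p) * ‖s‖ ^ 2 := by rw [hk2, hk]
      _ ≤ 16 * Real.exp (zzLam D p) * (10 * bigL D ^ 519) ^ 2 :=
          mul_le_mul_of_nonneg_left (pow_le_pow_left₀ (norm_nonneg _) hn 2) (by positivity)
      _ = Real.exp (zzLam D p) * (1600 * bigL D ^ 1038) := by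
          have : (bigL D ^ 519) ^ 2 = bigL D ^ 1038 := by rw [← pow_mul]
          rw [mul_pow, this]; ring
      _ ≤ Real.exp (zzLam D p) * Real.exp (bigL D / 2) := by
          refine mul_le_mul_of_nonneg_left (le_trans ?_ (zz_half hD)) (Real.exp_nonneg _)
          have := zz_pow_mul_le hD.1 (show 1038 < 10000 by norm_num)
          refine le_trans (mul_le_mul_of_nonneg_right ?_ (by have := hD.pos; positivity)) this
          norm_num
      _ ≤ _ := by
          rw [← Real.exp_add]
          refine Real.exp_le_exp.2 ?_
          have : (10:ℝ) * bigL D ≤ 10 ^100 * bigL D := mul_le_mul_of_nonneg_right (by norm_num) hD.pos.le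
          linarith
  refine ⟨?_, hfe, ?_, ?_⟩
  · rw [hA]
    exact (DirichletCharacter.differentiable_LFunction hψ1).mul (DirichletCharacter.differentiable_LFunction hc1)
  · intro s hs h1 h2
    by_cases h3 : 1/2 ≤ s.re
    · refine (hR s hs h3 h2).trans (Real.exp_le_exp.2 ?_)
      have := hD.pos
      have : 0 ≤ bigL D ^ 9 := by positivity
      linarith
    · rw [hfe s hs, norm_mul, zzSh, Complex.norm_conj]
      have := hR (1 - conj s) (zzW_refl hs) (by simp; linarith) (by simp; linarith)
      have hz := hZ.crude s hs (by linarith) (by linarith)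
      calc _ ≤ Real.exp (6 * bigL D ^ 9) * Real.exp (3 * bigL D ^ 9) :=
            mul_le_mul hz this (norm_nonneg _) (Real.exp_nonneg _)
        _ = _ := by rw [← Real.exp_add]; ring_nf
  · intro s hs M
    exact zz_A_tail D χ ψ hs M


/-- a segment of the Dirichlet series -/
def zzQ (D : ℕ) (χ : DirichletCharacter ℂ D) {p : ℕ} (ψ : DirichletCharacter ℂ p) (N M : ℕ) (s : ℂ) : ℂ :=
  ∑ n ∈ Finset.Ioc N M, nuF D χ n * zzphi ψ s n

/-- coefficients at `s0` -/
def zzc (D : ℕ) (χ : DirichletCharacter ℂ D) {p : ℕ} (ψ : DirichletCharacter ℂ p) (n : ℕ) : ℂ :=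
  nuF D χ n * ψ (n : ZMod p) * (n : ℂ) ^ (-s0 D)

theorem zzQ_eq (D : ℕ) (χ : DirichletCharacter ℂ D) {p : ℕ} (ψ : DirichletCharacter ℂ p) (N M : ℕ) (s : ℂ) :
    zzQ D χ ψ N M s = ∑ n ∈ Finset.Ioc N M, zzc D χ ψ n * (n:ℂ) ^ (-(s - s0 D)) := by
  refine Finset.sum_congr rfl (fun n hn => ?_)
  rw [Finset.mem_Ioc] at hn
  rw [zz_phi_split ψ s (s0 D) (by omega), zzc]

theorem zz_w_norm' {D : ℕ} (hD : zzBig D) {s : ℂ} (hs : zzN D s) (h1 : -3/2 ≤ s.re) (h2 : s.re ≤ 5/2) :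
    1 + ‖s - s0 D‖ ≤ 3 * bigL D ^ 405 := by
  have h3 := Complex.norm_le_abs_re_add_abs_im (s - s0 D)
  rw [Complex.sub_re, Complex.sub_im, s0_re, s0_im] at h3
  have h4 : |s.re - 1/2| ≤ 2 := by rw [abs_le]; constructor <;> linarith
  have h5 := zz_pow_mul_le hD.1 (show 5 < 405 by norm_num)
  have h6 := zz_pow_ge hD (show 1 ≤ 5 by norm_num)
  have hs' : |s.im - 2 * Real.pi * t0 D| ≤ bigL D ^ 405 + 2 * bigL D ^ 5 := hs
  generalize bigL D ^ 405 = q at *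
  generalize bigL D ^ 5 = r at *
  norm_num at h5 h6
  linarith

theorem zz_S_exists {D : ℕ} (hD : zzBig D) {χ : DirichletCharacter ℂ D} {p : ℕ}
    {ψ : DirichletCharacter ℂ p} (hp : zzP D p) (h : Ineq2 D χ ψ) :
    ∃ x₁ : ℝ, zzLen D p ≤ x₁ ∧ x₁ ≤ 2 * zzLen D p ∧ (D:ℝ)^4 ≤ x₁ ∧ x₁ ≤ bigP D ^ 2 ∧
      (∀ s : ℂ, zzN D s → -3/2 ≤ s.re → s.re ≤ 5/2 → ∀ K : ℝ,
        (∀ x, (D:ℝ)^4 ≤ x → x ≤ x₁ → x ^ (1/2 - s.re) ≤ K) →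
        ‖zzQ D χ ψ (D^4) ⌊x₁⌋₊ s‖ * bigL D ^ 180 ≤ 9 * K) ∧
      (∀ s : ℂ, zzN D s → s.re = 5/2 →
        ‖zzQ D χ ψ ⌊x₁⌋₊ ⌊bigP D ^ 2⌋₊ s‖ * bigL D ^ 180 * zzLen D p ^ 2 ≤ 8) := by
  have hL := hD.pos
  have hL1 := hD.one
  have hX := zzLen_pos hD hp
  have hlog := zzLen_log hD hp
  have hDe := hD.exp
  have hL9 := zz_pow_mul_le hD.1 (show 1 < 9 by norm_num)
  rw [pow_one] at hL9
  have hL9' : 10 * bigL D ≤ bigL D ^ 9 := le_trans (mul_le_mul_of_nonneg_right (by norm_num) hL.le) hL9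
  have hXexp : zzLen D p = Real.exp (Real.log (zzLen D p)) := (Real.exp_log hX).symm
  have hDr : (0:ℝ) < D := by exact_mod_cast hD.D_pos
  have hD4 : (0:ℝ) < (D:ℝ)^4 := by positivity
  have ha : (D:ℝ)^4 ≤ zzLen D p := by
    have : (D:ℝ) = Real.exp (bigL D) := by rw [bigL, Real.exp_log hDr]
    rw [this, hXexp, ← Real.exp_nat_mul]
    refine Real.exp_le_exp.2 ?_
    push_cast; linarith
  have hb : 2 * zzLen D p ≤ bigP D ^ 2 := by
    have h2 : (2:ℝ) ≤ Real.exp 1 := by have := Real.add_one_le_exp (1:ℝ); linarith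
    rw [bigP, hXexp, ← Real.exp_nat_mul]
    calc _ ≤ Real.exp 1 * Real.exp (Real.log (zzLen D p)) := by gcongr
      _ ≤ _ := by
        rw [← Real.exp_add]
        refine Real.exp_le_exp.2 ?_
        push_cast; linarith
  have hX3 : ∀ x, X3 D χ ψ x = zzX (zzc D χ ψ) (D^4) x := fun x => rfl
  rw [Ineq2] at h
  simp only [hX3] at h
  set δ := bigL D ^ (-585 : ℤ) with hδ
  have hδ0 : 0 < δ := by positivity
  have hint0 : 0 ≤ ∫ x in ((D : ℝ) ^ 4)..(bigP D ^ 2), ‖zzX (zzc D χ ψ) (D^4) x‖ / x :=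
    intervalIntegral.integral_nonneg (by linarith) (fun u hu => div_nonneg (norm_nonneg _) (hD4.le.trans hu.1))
  have hi : (∫ x in ((D : ℝ) ^ 4)..(bigP D ^ 2), ‖zzX (zzc D χ ψ) (D^4) x‖ / x) < δ := by
    linarith [norm_nonneg (zzX (zzc D χ ψ) (D^4) (bigP D ^ 2))]
  have hP : ‖zzX (zzc D χ ψ) (D^4) (bigP D ^ 2)‖ < δ := by linarith
  obtain ⟨x₁, c1, c2, c3⟩ := zz_avg (zzc D χ ψ) (D^4) hD4 ha hb hi
  have hx0 : 0 < x₁ := by linarith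
  have i1 : (∫ x in ((D : ℝ) ^ 4)..x₁, ‖zzX (zzc D χ ψ) (D^4) x‖ / x) ≤ δ := by
    refine le_trans (intervalIntegral.integral_mono_interval le_rfl (by linarith) (by linarith) ?_
      (zzX_intble _ _ hD4 (by linarith))) hi.le
    rw [Filter.EventuallyLE, MeasureTheory.ae_restrict_iff' measurableSet_Ioc]
    exact Filter.Eventually.of_forall (fun x hx => div_nonneg (norm_nonneg _) (hD4.le.trans hx.1.le))
  have i2 : (∫ x in x₁..(bigP D ^ 2), ‖zzX (zzc D χ ψ) (D^4) x‖ / x) ≤ δ := by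
    refine le_trans (intervalIntegral.integral_mono_interval (by linarith) (by linarith) le_rfl ?_
      (zzX_intble _ _ hD4 (by linarith))) hi.le
    rw [Filter.EventuallyLE, MeasureTheory.ae_restrict_iff' measurableSet_Ioc]
    exact Filter.Eventually.of_forall (fun x hx => div_nonneg (norm_nonneg _) (hD4.le.trans hx.1.le))
  have hδ1 : bigL D ^ 405 * δ * bigL D ^ 180 = 1 := by
    rw [hδ, ← zpow_natCast, ← zpow_natCast, ← zpow_add₀ hL.ne', ← zpow_add₀ hL.ne']; norm_num
  have hδ2 : δ * bigL D ^ 180 ≤ 1 := by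
    rw [← hδ1]
    have : 1 ≤ bigL D ^ 405 := one_le_pow₀ hL1
    have h0 : 0 ≤ δ * bigL D ^ 180 := by positivity
    generalize bigL D ^ 405 = q at *
    generalize bigL D ^ 180 = r at *
    nlinarith
  have hq : 0 < bigL D ^ 180 := by positivity
  have hfl : ⌊(D:ℝ)^4⌋₊ = D^4 := by rw [← Nat.cast_pow, Nat.floor_natCast]
  refine ⟨x₁, c1, c2, by linarith, by linarith, ?_, ?_⟩
  · intro s hs h1 h2 K hK
    have hre : -(s - s0 D).re = 1/2 - s.re := by rw [Complex.sub_re, s0_re]; ring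
    have ab := zz_abel (zzc D χ ψ) (D^4) hD4 (by linarith : (D:ℝ)^4 ≤ x₁) hfl.ge (s - s0 D) K (by
      rw [hre]; exact hK)
    have hz : zzX (zzc D χ ψ) (D^4) ((D:ℝ)^4) = 0 := by rw [zzX, hfl, Finset.Ioc_self, Finset.sum_empty]
    rw [hz, zero_mul, add_zero, hfl, ← zzQ_eq] at ab
    have hK0 : 0 ≤ K := le_trans (by positivity) (hK x₁ (by linarith) le_rfl)
    have hw := zz_w_norm' hD hs h1 h2
    have t1 : ‖zzQ D χ ψ (D^4) ⌊x₁⌋₊ s‖ ≤ K * (3 * bigL D ^ 405) * (3 * δ) := by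
      refine ab.trans ?_
      refine mul_le_mul (mul_le_mul_of_nonneg_left hw hK0) (by linarith) ?_ (by positivity)
      refine add_nonneg (norm_nonneg _) (intervalIntegral.integral_nonneg (by linarith) (fun u hu => div_nonneg (norm_nonneg _) (hD4.le.trans hu.1)))
    refine (mul_le_mul_of_nonneg_right t1 hq.le).trans (le_of_eq ?_)
    calc _ = 9 * K * (bigL D ^ 405 * δ * bigL D ^ 180) := by ring
      _ = _ := by rw [hδ1]; ring
  · intro s hs h1
    have hre : -(s - s0 D).re = -2 := by rw [Complex.sub_re, s0_re, h1]; norm_num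
    have ab := zz_abel (zzc D χ ψ) (D^4) hx0 (by linarith : x₁ ≤ bigP D ^ 2) (by
      refine Nat.le_floor ?_
      push_cast; linarith) (s - s0 D) (x₁ ^ (-2:ℝ)) (by
      rw [hre]; intro x hx _; exact Real.rpow_le_rpow_of_nonpos hx0 hx (by norm_num))
    rw [← zzQ_eq] at ab
    have hw := zz_w_norm' hD hs (by linarith) (by linarith)
    have hxn : ‖(x₁:ℂ) ^ (-(s - s0 D))‖ = x₁ ^ (-2:ℝ) := by
      rw [Complex.norm_cpow_eq_rpow_re_of_pos hx0, Complex.neg_re, hre]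
    set k := x₁ ^ (-2:ℝ) with hk
    have hk0 : 0 < k := by positivity
    have t1 : ‖zzQ D χ ψ ⌊x₁⌋₊ ⌊bigP D ^ 2⌋₊ s‖ ≤ k * (3 * bigL D ^ 405) * (2 * δ) + 2 * δ * k := by
      have := norm_sub_le (zzQ D χ ψ ⌊x₁⌋₊ ⌊bigP D ^ 2⌋₊ s + zzX (zzc D χ ψ) (D^4) x₁ * (x₁:ℂ) ^ (-(s - s0 D)))
        (zzX (zzc D χ ψ) (D^4) x₁ * (x₁:ℂ) ^ (-(s - s0 D)))
      rw [add_sub_cancel_right] at this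
      refine this.trans (add_le_add (ab.trans ?_) ?_)
      · refine mul_le_mul (mul_le_mul_of_nonneg_left hw hk0.le) (by linarith) ?_ (by positivity)
        refine add_nonneg (norm_nonneg _) (intervalIntegral.integral_nonneg (by linarith) (fun u hu => div_nonneg (norm_nonneg _) (hx0.le.trans hu.1)))
      · rw [norm_mul, hxn]; gcongr
    have hkX : k * zzLen D p ^ 2 ≤ 1 := by
      have : k = (x₁^2)⁻¹ := by
        rw [hk, Real.rpow_neg hx0.le]; norm_num
      rw [this, inv_mul_le_iff₀ (by positivity), mul_one]
      gcongr
    have hXX : 0 ≤ zzLen D p ^ 2 := by positivity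
    calc _ ≤ (k * (3 * bigL D ^ 405) * (2 * δ) + 2 * δ * k) * bigL D ^ 180 * zzLen D p ^ 2 := by
          refine mul_le_mul_of_nonneg_right (mul_le_mul_of_nonneg_right t1 hq.le) hXX
      _ = (6 * (bigL D ^ 405 * δ * bigL D ^ 180) + 2 * (δ * bigL D ^ 180)) * (k * zzLen D p ^ 2) := by ring
      _ ≤ (6 * 1 + 2 * 1) * 1 := by rw [hδ1]; gcongr
      _ ≤ _ := by norm_num


/-- partial sum of the Dirichlet series up to `N` -/
def zzH (D : ℕ) (χ : DirichletCharacter ℂ D) {p : ℕ} (ψ : DirichletCharacter ℂ p) (N : ℕ) (s : ℂ) : ℂ :=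
  Ffun D χ ψ s + zzQ D χ ψ (D^4) N s

/-- error in the approximate functional equation -/
def zzE (D : ℕ) (χ : DirichletCharacter ℂ D) {p : ℕ} (ψ : DirichletCharacter ℂ p) (Z : ℂ → ℂ) (N : ℕ) (s : ℂ) : ℂ :=
  zzA D χ ψ s - zzH D χ ψ N s - Z s * zzSh (zzH D χ ψ N) s

theorem zzQ_diff {D : ℕ} {χ : DirichletCharacter ℂ D} {p : ℕ}
    {ψ : DirichletCharacter ℂ p} {N M : ℕ} : Differentiable ℂ (zzQ D χ ψ N M) := by
  intro s
  unfold zzQ zzphi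
  refine DifferentiableAt.fun_sum (fun n hn => ?_)
  rw [Finset.mem_Ioc] at hn
  refine DifferentiableAt.const_mul (DifferentiableAt.const_mul ?_ _) _
  exact DifferentiableAt.const_cpow (by fun_prop) (Or.inl (by norm_cast; omega))

theorem zzH_diff {D : ℕ} {χ : DirichletCharacter ℂ D} {p : ℕ}
    {ψ : DirichletCharacter ℂ p} {N : ℕ} : Differentiable ℂ (zzH D χ ψ N) :=
  zz_F_diff.add zzQ_diff

theorem zzH_eq {D : ℕ} {χ : DirichletCharacter ℂ D} {p : ℕ}
    {ψ : DirichletCharacter ℂ p} {N M : ℕ} (h1 : D ^ 4 ≤ N) (h2 : N ≤ M) (s : ℂ) :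
    ∑ n ∈ Finset.Icc 1 M, nuF D χ n * zzphi ψ s n = zzH D χ ψ N s + zzQ D χ ψ N M s := by
  have e : Ffun D χ ψ s = ∑ n ∈ Finset.Ioc 0 (D ^ 4), nuF D χ n * zzphi ψ s n := by
    unfold Ffun
    refine Finset.sum_congr (by ext; simp [Nat.succ_le_iff]) (fun n _ => ?_)
    rw [zzphi, mul_assoc]
  have e' : Finset.Icc 1 M = Finset.Ioc 0 M := by ext; simp [Nat.succ_le_iff]
  rw [zzH, e, zzQ, zzQ, e', Finset.sum_Ioc_consecutive _ (Nat.zero_le _) h1,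
    Finset.sum_Ioc_consecutive _ (Nat.zero_le _) h2]

theorem zzQ_crude {D : ℕ} {χ : DirichletCharacter ℂ D} {p : ℕ}
    {ψ : DirichletCharacter ℂ p} {N M : ℕ} {s : ℂ} (hs : -3/2 ≤ s.re) :
    ‖zzQ D χ ψ N M s‖ ≤ (M:ℝ) ^ 4 := by
  unfold zzQ
  have : ∀ n ∈ Finset.Ioc N M, ‖nuF D χ n * zzphi ψ s n‖ ≤ (M:ℝ)^3 := by
    intro n hn
    rw [Finset.mem_Ioc] at hn
    have hn1 : (1:ℝ) ≤ n := by exact_mod_cast (by omega : 1 ≤ n)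
    have hnM : (n:ℝ) ≤ M := by exact_mod_cast hn.2
    have f1 := zz_phi_norm ψ s (show n ≠ 0 by omega)
    have f2 : (n:ℝ) ^ (-s.re) ≤ (n:ℝ)^(2:ℝ) := Real.rpow_le_rpow_of_exponent_le hn1 (by linarith)
    rw [Real.rpow_two] at f2
    rw [norm_mul]
    calc _ ≤ (n:ℝ) * (n:ℝ)^2 := mul_le_mul (zz_nu_norm D χ n) (f1.trans f2) (norm_nonneg _) (by positivity)
      _ = (n:ℝ)^3 := by ring
      _ ≤ _ := by gcongr
  refine (norm_sum_le_of_le _ this).trans ?_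
  rw [Finset.sum_const, nsmul_eq_mul, Nat.card_Ioc]
  have : ((M - N : ℕ) : ℝ) ≤ M := by exact_mod_cast Nat.sub_le M N
  calc _ ≤ (M:ℝ) * (M:ℝ)^3 := by gcongr
    _ = _ := by ring

theorem zz_D_exp {D : ℕ} (hD : zzBig D) : (D:ℝ) = Real.exp (bigL D) := by
  rw [bigL, Real.exp_log (by exact_mod_cast hD.D_pos)]

theorem zzLen_exp {D p : ℕ} (hD : zzBig D) (hp : zzP D p) :
    Real.exp (bigL D ^ 9) ≤ zzLen D p ∧ zzLen D p ≤ Real.exp (bigL D ^ 9 + bigL D) := by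
  have hX := zzLen_pos hD hp
  have := zzLen_log hD hp
  exact ⟨(Real.le_log_iff_exp_le hX).1 this.1, (Real.log_le_iff_le_exp hX).1 this.2⟩

theorem zz_L9 {D : ℕ} (hD : zzBig D) : 10^99 * bigL D ≤ bigL D ^ 9 := by
  have := zz_pow_mul_le hD.1 (show 1 < 9 by norm_num)
  rw [pow_one] at this
  exact le_trans (mul_le_mul_of_nonneg_right (by norm_num) hD.pos.le) this

theorem zz_E_right {D : ℕ} (hD : zzBig D) {χ : DirichletCharacter ℂ D} {p : ℕ}
    {ψ : DirichletCharacter ℂ p} (hp : zzP D p) {Z : ℂ → ℂ} (hZ : zzZP D p Z) (hA : zzAP D χ ψ Z)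
    {x₁ : ℝ} (c2 : x₁ ≤ 2 * zzLen D p) (c3 : (D:ℝ)^4 ≤ x₁) (c4 : x₁ ≤ bigP D ^ 2)
    (S1 : ∀ s : ℂ, zzN D s → -3/2 ≤ s.re → s.re ≤ 5/2 → ∀ K : ℝ,
        (∀ x, (D:ℝ)^4 ≤ x → x ≤ x₁ → x ^ (1/2 - s.re) ≤ K) →
        ‖zzQ D χ ψ (D^4) ⌊x₁⌋₊ s‖ * bigL D ^ 180 ≤ 9 * K)
    (S2 : ∀ s : ℂ, zzN D s → s.re = 5/2 →
        ‖zzQ D χ ψ ⌊x₁⌋₊ ⌊bigP D ^ 2⌋₊ s‖ * bigL D ^ 180 * zzLen D p ^ 2 ≤ 8)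
    {s : ℂ} (hs : zzN D s) (hr : s.re = 5/2) :
    ‖zzE D χ ψ Z ⌊x₁⌋₊ s‖ * zzLen D p ^ 2 * bigL D ^ 179 ≤ 1 := by
  have hL := hD.pos
  have hL1 := hD.one
  have hbig : (1000:ℝ) ≤ bigL D := le_trans (by norm_num) hD.1
  have hX := zzLen_pos hD hp
  obtain ⟨X1, X2⟩ := zzLen_exp hD hp
  have hL9 := zz_L9 hD
  norm_num at hL9
  have hDr : (0:ℝ) < D := by exact_mod_cast hD.D_pos
  have hx0 : 0 < x₁ := lt_of_lt_of_le (by positivity) c3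
  have hq : bigL D ^ 180 ≤ Real.exp (bigL D) := (pow_le_pow_right₀ hL1 (by norm_num)).trans hD.2
  have hq0 : 0 < bigL D ^ 180 := by positivity
  have hN1 : D ^ 4 ≤ ⌊x₁⌋₊ := Nat.le_floor (by push_cast; exact c3)
  have hN2 : ⌊x₁⌋₊ ≤ ⌊bigP D ^ 2⌋₊ := Nat.floor_le_floor c4
  have hW : zzW D s := zzN_W hD hs (by simp)
  set N := ⌊x₁⌋₊
  set M := ⌊bigP D ^ 2⌋₊ with hM
  set q := bigL D ^ 180 with hqd
  set X := zzLen D p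
  -- the tail
  have t1 := hA.tail s hr M
  rw [zzH_eq hN1 hN2] at t1
  have hP : bigP D ^ 2 = Real.exp (2 * bigL D ^ 9) := by
    rw [bigP, ← Real.exp_nat_mul]; norm_num
  have t2 : ((M + 1 : ℕ) : ℝ) ^ (-(5/4 : ℝ)) ≤ Real.exp (-(5/2) * bigL D ^ 9) := by
    have : bigP D ^ 2 ≤ ((M + 1 : ℕ) : ℝ) := by push_cast; exact (Nat.lt_floor_add_one _).le
    refine (Real.rpow_le_rpow_of_nonpos (by rw [hP]; positivity) this (by norm_num)).trans (le_of_eq ?_)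
    rw [hP, ← Real.exp_mul]; ring_nf
  have t3 : 64 * ((M + 1 : ℕ) : ℝ) ^ (-(5/4 : ℝ)) * q * X ^ 2 ≤ 1 := by
    have h64 : (64:ℝ) ≤ Real.exp (bigL D) := by linarith [Real.add_one_le_exp (bigL D)]
    calc _ ≤ Real.exp (bigL D) * Real.exp (-(5/2) * bigL D ^ 9) * Real.exp (bigL D) * Real.exp (bigL D ^ 9 + bigL D) ^ 2 := by
          gcongr
      _ = Real.exp (bigL D + -(5/2) * bigL D ^ 9 + bigL D + 2 * (bigL D ^ 9 + bigL D)) := by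
          rw [← Real.exp_nat_mul, ← Real.exp_add, ← Real.exp_add, ← Real.exp_add]; norm_num
      _ ≤ Real.exp 0 := Real.exp_le_exp.2 (by linarith)
      _ = 1 := Real.exp_zero
  -- reflected part
  have hs' : zzN D (1 - conj s) := by unfold zzN at *; simpa using hs
  have hre' : (1 - conj s).re = -3/2 := by simp [hr]; norm_num
  have r1 := S1 (1 - conj s) hs' hre'.ge (by rw [hre']; norm_num) (x₁ ^ 2) (by
    intro x hx1 hx2
    have hx : 0 < x := lt_of_lt_of_le (by positivity) hx1
    rw [hre', show (1/2 - -3/2 : ℝ) = (2:ℝ) by norm_num, Real.rpow_two]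
    gcongr)
  have r2 : x₁ ^ 2 ≤ 4 * X ^ 2 := by
    calc x₁^2 ≤ (2 * X)^2 := by gcongr
      _ = _ := by ring
  have r3 := zz_F_crude hD (χ := χ) (ψ := ψ) (s := 1 - conj s) hre'.ge
  have r4 : (D:ℝ)^16 * q ≤ X ^ 2 := by
    calc (D:ℝ)^16 * q ≤ Real.exp (bigL D) ^ 16 * Real.exp (bigL D) := by rw [zz_D_exp hD]; gcongr
      _ = Real.exp (17 * bigL D) := by rw [← Real.exp_nat_mul, ← Real.exp_add]; push_cast; ring_nf
      _ ≤ Real.exp (2 * bigL D ^ 9) := Real.exp_le_exp.2 (by linarith)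
      _ = Real.exp (bigL D ^ 9) ^ 2 := by rw [← Real.exp_nat_mul]; norm_num
      _ ≤ _ := by gcongr
  have r5 : ‖zzH D χ ψ N (1 - conj s)‖ * q ≤ 37 * X ^ 2 := by
    have : ‖zzH D χ ψ N (1 - conj s)‖ ≤ _ := norm_add_le _ _
    nlinarith
  have r6 := (hZ.right s hW hr).1
  have r7 : ‖Z s * zzSh (zzH D χ ψ N) s‖ * q * X^2 ≤ 148 := by
    rw [norm_mul, zzSh, Complex.norm_conj]
    have hz : 0 ≤ ‖Z s‖ * X^2 := by positivity
    have := mul_le_mul_of_nonneg_left r5 hz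
    calc _ = ‖Z s‖ * X^2 * (‖zzH D χ ψ N (1 - conj s)‖ * q) := by ring
      _ ≤ ‖Z s‖ * X^2 * (37 * X^2) := this
      _ = 37 * (‖Z s‖ * X^4) := by ring
      _ ≤ _ := by linarith
  have hE : ‖zzE D χ ψ Z N s‖ ≤ 64 * ((M + 1 : ℕ) : ℝ) ^ (-(5/4 : ℝ)) + ‖zzQ D χ ψ N M s‖ + ‖Z s * zzSh (zzH D χ ψ N) s‖ := by
    have : zzE D χ ψ Z N s = (zzA D χ ψ s - (zzH D χ ψ N s + zzQ D χ ψ N M s)) + zzQ D χ ψ N M s - Z s * zzSh (zzH D χ ψ N) s := by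
      rw [zzE]; ring
    rw [this]
    refine (norm_sub_le _ _).trans (add_le_add_left ((norm_add_le _ _).trans (add_le_add_left t1 _)) _)
  have r8 := S2 s hs hr
  have hfin : ‖zzE D χ ψ Z N s‖ * q * X^2 ≤ 157 := by
    calc _ ≤ (64 * ((M + 1 : ℕ) : ℝ) ^ (-(5/4 : ℝ)) + ‖zzQ D χ ψ N M s‖ + ‖Z s * zzSh (zzH D χ ψ N) s‖) * q * X^2 := by gcongr
      _ = 64 * ((M + 1 : ℕ) : ℝ) ^ (-(5/4 : ℝ)) * q * X ^ 2 + ‖zzQ D χ ψ N M s‖ * q * X^2 + ‖Z s * zzSh (zzH D χ ψ N) s‖ * q * X^2 := by ring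
      _ ≤ _ := by linarith
  have hqq : q = bigL D ^ 179 * bigL D := by rw [hqd, ← pow_succ]
  rw [hqq] at hfin
  have hnn : 0 ≤ ‖zzE D χ ψ Z N s‖ * X^2 * bigL D ^ 179 := by positivity
  have : ‖zzE D χ ψ Z N s‖ * X^2 * bigL D ^ 179 * bigL D ≤ 157 := by
    refine le_trans (le_of_eq ?_) hfin; ring
  generalize ‖zzE D χ ψ Z N s‖ * X^2 * bigL D ^ 179 = y at *
  by_contra hcon
  push Not at hcon
  nlinarith

theorem zz_E_refl {D : ℕ} {χ : DirichletCharacter ℂ D} {p : ℕ}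
    {ψ : DirichletCharacter ℂ p} {Z : ℂ → ℂ} (hZ : zzZP D p Z) (hA : zzAP D χ ψ Z) {N : ℕ} {s : ℂ} (hW : zzW D s) :
    zzE D χ ψ Z N s = Z s * zzSh (zzE D χ ψ Z N) s := by
  have h1 := hA.fe s hW
  have h2 := hZ.refl s hW
  have h3 : zzSh (zzE D χ ψ Z N) s = zzSh (zzA D χ ψ) s - zzSh (zzH D χ ψ N) s - conj (Z (1 - conj s)) * zzH D χ ψ N s := by
    unfold zzSh zzE zzSh
    rw [map_sub, map_sub, map_mul, zz_refl_refl, Complex.conj_conj]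
  rw [h3, zzE, h1]
  linear_combination (zzH D χ ψ N s) * h2

theorem zz_E_bound {D : ℕ} (hD : zzBig D) {χ : DirichletCharacter ℂ D} {p : ℕ}
    {ψ : DirichletCharacter ℂ p} (hp : zzP D p) {Z : ℂ → ℂ} (hZ : zzZP D p Z) (hA : zzAP D χ ψ Z)
    {x₁ : ℝ} (c2 : x₁ ≤ 2 * zzLen D p) (c3 : (D:ℝ)^4 ≤ x₁) (c4 : x₁ ≤ bigP D ^ 2)
    (S1 : ∀ s : ℂ, zzN D s → -3/2 ≤ s.re → s.re ≤ 5/2 → ∀ K : ℝ,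
        (∀ x, (D:ℝ)^4 ≤ x → x ≤ x₁ → x ^ (1/2 - s.re) ≤ K) →
        ‖zzQ D χ ψ (D^4) ⌊x₁⌋₊ s‖ * bigL D ^ 180 ≤ 9 * K)
    (S2 : ∀ s : ℂ, zzN D s → s.re = 5/2 →
        ‖zzQ D χ ψ ⌊x₁⌋₊ ⌊bigP D ^ 2⌋₊ s‖ * bigL D ^ 180 * zzLen D p ^ 2 ≤ 8)
    {s : ℂ} (hs : |s.im - 2 * Real.pi * t0 D| ≤ bigL D ^ 405 + bigL D ^ 5) (h1 : -3/2 ≤ s.re) (h2 : s.re ≤ 5/2) :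
    ‖zzE D χ ψ Z ⌊x₁⌋₊ s‖ * bigL D ^ 178 ≤ zzLen D p ^ (1/2 - s.re) := by
  have hL := hD.pos
  have hL1 := hD.one
  have hX := zzLen_pos hD hp
  obtain ⟨X1, X2⟩ := zzLen_exp hD hp
  have hL9 := zz_L9 hD
  norm_num at hL9
  have hx0 : 0 < x₁ := lt_of_lt_of_le (by have : (0:ℝ) < D := by exact_mod_cast hD.D_pos
                                          positivity) c3
  have hX1 : 1 ≤ zzLen D p := by
    refine le_trans ?_ X1
    rw [← Real.exp_zero]; exact Real.exp_le_exp.2 (by positivity)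
  have hNz : ∀ z : ℂ, |z.im - s.im| ≤ bigL D ^ 5 → zzN D z := by
    intro z hz
    rw [zzN]
    have : z.im - 2 * Real.pi * t0 D = (z.im - s.im) + (s.im - 2 * Real.pi * t0 D) := by ring
    rw [this]
    refine (abs_add_le _ _).trans ?_
    linarith
  have hWz : ∀ z : ℂ, |z.im - s.im| ≤ bigL D ^ 5 → zzW D z := fun z hz => zzN_W hD (hNz z hz) (by simp)
  set N := ⌊x₁⌋₊ with hN
  set X := zzLen D p
  have hr : ∀ z : ℂ, z.re = 5/2 → zzN D z → ‖zzE D χ ψ Z N z‖ * X ^ 2 ≤ (bigL D ^ 179)⁻¹ := by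
    intro z hz hzN
    have := zz_E_right hD hp hZ hA c2 c3 c4 S1 S2 hzN hz
    rwa [← le_div_iff₀ (by positivity), one_div] at this
  set η := (bigL D ^ 179)⁻¹ with hη
  have hη0 : 0 < η := by positivity
  have hHc : ∀ z : ℂ, -3/2 ≤ z.re → ‖zzH D χ ψ N z‖ ≤ Real.exp (9 * bigL D ^ 9) := by
    intro z hz
    have a1 := zz_F_crude hD (χ := χ) (ψ := ψ) hz
    have a2 := zzQ_crude (χ := χ) (ψ := ψ) (N := D^4) (M := N) hz
    have a3 : (N:ℝ) ≤ Real.exp (2 * bigL D ^ 9) := by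
      refine (Nat.floor_le hx0.le).trans (c4.trans (le_of_eq ?_))
      rw [bigP, ← Real.exp_nat_mul]; norm_num
    have a4 : (N:ℝ)^4 ≤ Real.exp (8 * bigL D ^ 9) := by
      calc (N:ℝ)^4 ≤ Real.exp (2 * bigL D ^ 9) ^ 4 := by gcongr
        _ = _ := by rw [← Real.exp_nat_mul]; push_cast; ring_nf
    have a5 : (D:ℝ)^16 ≤ Real.exp (8 * bigL D ^ 9) := by
      rw [zz_D_exp hD, ← Real.exp_nat_mul]; exact Real.exp_le_exp.2 (by push_cast; linarith)
    have a6 : 2 ≤ Real.exp (bigL D ^ 9) := by linarith [Real.add_one_le_exp (bigL D ^ 9)]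
    have a7 : Real.exp (9 * bigL D ^ 9) = Real.exp (bigL D ^ 9) * Real.exp (8 * bigL D ^ 9) := by
      rw [← Real.exp_add]; ring_nf
    have a8 : ‖zzH D χ ψ N z‖ ≤ _ := norm_add_le _ _
    have a9 := Real.exp_pos (8 * bigL D ^ 9)
    rw [a7]; nlinarith
  have key := zz_gauss_max (E := zzE D χ ψ Z N) (s₁ := s) (x := X) (h := bigL D ^ 5) (A := 4 * η)
    (B := Real.exp (16 * bigL D ^ 9)) hX1 (one_le_pow₀ hL1) (by positivity) h1 h2 ?_ ?_ ?_ ?_ ?_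
  · have e16 : 4 * Real.exp 16 ≤ bigL D := by
      have := zz_exp80 hD
      have h64 : 2 ≤ Real.exp 64 := by linarith [Real.add_one_le_exp (64:ℝ)]
      have h80 : Real.exp 80 = Real.exp 64 * Real.exp 16 := by rw [← Real.exp_add]; norm_num
      nlinarith [Real.exp_pos 16]
    have hηL : η * bigL D * bigL D ^ 178 = 1 := by
      rw [mul_assoc, ← pow_succ', hη]; exact inv_mul_cancel₀ (by positivity)
    have hXr : 0 < X ^ (1/2 - s.re) := by positivity
    calc _ ≤ Real.exp 16 * (4 * η) * X ^ (1/2 - s.re) * bigL D ^ 178 := mul_le_mul_of_nonneg_right key (by positivity)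
      _ = 4 * Real.exp 16 * (η * X ^ (1/2 - s.re) * bigL D ^ 178) := by ring
      _ ≤ bigL D * (η * X ^ (1/2 - s.re) * bigL D ^ 178) := mul_le_mul_of_nonneg_right e16 (by positivity)
      _ = η * bigL D * bigL D ^ 178 * X ^ (1/2 - s.re) := by ring
      _ = _ := by rw [hηL, one_mul]
  · intro z _ _ hz
    have hd1 := (zzSh_hasDeriv (f := zzH D χ ψ N) (s := z) (zzH_diff _)).differentiableAt
    exact ((hA.diff z).sub (zzH_diff z)).sub ((hZ.diff z (hWz z hz)).mul hd1)
  · intro z hz1 hz2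
    have := hr z hz1 (hNz z hz2)
    linarith
  · intro z hz1 hz2
    have hW := hWz z hz2
    have hre : (1 - conj z).re = 5/2 := by simp [hz1]; norm_num
    have hNc : zzN D (1 - conj z) := by have := hNz z hz2; unfold zzN at *; simpa using this
    have b1 := hr (1 - conj z) hre hNc
    have b2 := (hZ.right (1 - conj z) (zzW_refl hW) hre).2
    have b3 := congrArg norm (hZ.refl z hW)
    rw [norm_mul, Complex.norm_conj, norm_one] at b3
    rw [zz_E_refl hZ hA hW, norm_mul, zzSh, Complex.norm_conj]
    have b4 : ‖Z z‖ ≤ 4 * X^4 := by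
      have := mul_le_mul_of_nonneg_left b2 (norm_nonneg (Z z))
      calc ‖Z z‖ = ‖Z z‖ * 1 := by ring
        _ ≤ _ := this
        _ = 4 * X^4 * (‖Z z‖ * ‖Z (1 - conj z)‖) := by ring
        _ = _ := by rw [b3, mul_one]
    calc _ ≤ 4 * X^4 * ‖zzE D χ ψ Z N (1 - conj z)‖ := by gcongr
      _ = 4 * (‖zzE D χ ψ Z N (1 - conj z)‖ * X^2) * X^2 := by ring
      _ ≤ _ := by gcongr
  · intro z hz1 hz2 hz3
    have hW := hWz z hz3.le
    have d1 := hA.crude z hW hz1 hz2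
    have d2 := hHc z hz1
    have d3 := hHc (1 - conj z) (by simp; linarith)
    have d4 := hZ.crude z hW (by linarith) (by linarith)
    have d5 : ‖Z z * zzSh (zzH D χ ψ N) z‖ ≤ Real.exp (15 * bigL D ^ 9) := by
      rw [norm_mul, zzSh, Complex.norm_conj]
      calc _ ≤ Real.exp (6 * bigL D ^ 9) * Real.exp (9 * bigL D ^ 9) := by gcongr
        _ = _ := by rw [← Real.exp_add]; ring_nf
    have d6 : Real.exp (9 * bigL D ^ 9) ≤ Real.exp (15 * bigL D ^ 9) := Real.exp_le_exp.2 (by linarith)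
    have a6 : 3 ≤ Real.exp (bigL D ^ 9) := by
      have : (1:ℝ) ≤ bigL D := hL1
      linarith [Real.add_one_le_exp (bigL D ^ 9)]
    have a7 : Real.exp (16 * bigL D ^ 9) = Real.exp (bigL D ^ 9) * Real.exp (15 * bigL D ^ 9) := by
      rw [← Real.exp_add]; ring_nf
    have d7 : ‖zzE D χ ψ Z N z‖ ≤ ‖zzA D χ ψ z‖ + ‖zzH D χ ψ N z‖ + ‖Z z * zzSh (zzH D χ ψ N) z‖ :=
      (norm_sub_le _ _).trans (add_le_add_left (norm_sub_le _ _) _)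
    have a9 := Real.exp_pos (15 * bigL D ^ 9)
    rw [a7]; nlinarith
  · have f1 : bigL D ^ 179 ≤ Real.exp (bigL D) := (pow_le_pow_right₀ hL1 (by norm_num)).trans hD.2
    have f2 : Real.exp (-bigL D) ≤ η := by
      rw [hη, Real.exp_neg]; exact inv_anti₀ (by positivity) f1
    have f3 : (bigL D ^ 5) ^ 2 = bigL D ^ 10 := by rw [← pow_mul]
    have f4 := zz_pow_mul_le hD.1 (show 9 < 10 by norm_num)
    norm_num at f4
    rw [f3]
    calc _ ≤ Real.exp (16 * bigL D ^ 9) * Real.exp (bigL D ^ 9 + bigL D) ^ 2 * Real.exp (-bigL D ^ 10) := by gcongr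
      _ = Real.exp (16 * bigL D ^ 9 + 2 * (bigL D ^ 9 + bigL D) - bigL D ^ 10) := by
          rw [← Real.exp_nat_mul, ← Real.exp_add, ← Real.exp_add]; push_cast; ring_nf
      _ ≤ Real.exp (-bigL D) := Real.exp_le_exp.2 (by
          have : 0 ≤ bigL D ^ 9 := by positivity
          linarith)
      _ ≤ _ := by linarith


/-- main secondary term -/
def zzB (D : ℕ) (χ : DirichletCharacter ℂ D) {p : ℕ} (ψ : DirichletCharacter ℂ p) (Z : ℂ → ℂ) (s : ℂ) : ℂ :=
  Z s * zzSh (Ffun D χ ψ) s / Ffun D χ ψ s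

/-- relative error -/
def zzR (D : ℕ) (χ : DirichletCharacter ℂ D) {p : ℕ} (ψ : DirichletCharacter ℂ p) (Z : ℂ → ℂ) (s : ℂ) : ℂ :=
  zzA D χ ψ s / Ffun D χ ψ s - 1 - zzB D χ ψ Z s

set_option maxHeartbeats 1000000 in
theorem zz_E1_bound {D : ℕ} (hD : zzBig D) {χ : DirichletCharacter ℂ D} {p : ℕ}
    {ψ : DirichletCharacter ℂ p} (hp : zzP D p) (hI : Ineq2 D χ ψ) {Z : ℂ → ℂ} (hZ : zzZP D p Z) (hA : zzAP D χ ψ Z)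
    {s : ℂ} (hs : |s.im - 2 * Real.pi * t0 D| ≤ bigL D ^ 405 + 4)
    (h1 : -2 ≤ (s.re - 1/2) * bigL D ^ 9) (h2 : s.re ≤ 1) :
    ‖zzA D χ ψ s - Ffun D χ ψ s - Z s * zzSh (Ffun D χ ψ) s‖ * bigL D ^ 170 ≤ 1 := by
  obtain ⟨x₁, c1, c2, c3, c4, S1, S2⟩ := zz_S_exists hD hp hI
  have hL := hD.pos
  have hL1 := hD.one
  have hbig : (1000:ℝ) ≤ bigL D := le_trans (by norm_num) hD.1
  have hX := zzLen_pos hD hp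
  obtain ⟨X1, X2⟩ := zzLen_exp hD hp
  have hL9 := zz_L9 hD
  norm_num at hL9
  have hL5 := zz_pow_ge hD (show 1 ≤ 5 by norm_num)
  norm_num at hL5
  have hq9 : 1000 ≤ bigL D ^ 9 := by linarith
  have hlo : -1 ≤ s.re - 1/2 := by
    by_contra hc
    push Not at hc
    nlinarith
  have hsN : zzN D s := by
    unfold zzN; generalize bigL D ^ 405 = a at *; linarith
  have hsE : |s.im - 2 * Real.pi * t0 D| ≤ bigL D ^ 405 + bigL D ^ 5 := by
    generalize bigL D ^ 405 = a at *; linarith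
  have hsN' : zzN D (1 - conj s) := by unfold zzN at *; simpa using hsN
  have E := zz_E_bound hD hp hZ hA c2 c3 c4 S1 S2 hsE (by linarith) (by linarith)
  have hDr : (0:ℝ) < D := by exact_mod_cast hD.D_pos
  have hD4 : (1:ℝ) ≤ (D:ℝ)^4 := one_le_pow₀ (by exact_mod_cast hD.D_pos)
  have hx1 : x₁ ≤ Real.exp (bigL D ^ 9 + bigL D + 1) := by
    rw [Real.exp_add _ 1]
    have : (2:ℝ) ≤ Real.exp 1 := by have := Real.add_one_le_exp (1:ℝ); linarith
    have := mul_le_mul this X2 hX.le (Real.exp_nonneg _)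
    linarith
  set u := s.re - 1/2 with hu
  set q := bigL D ^ 9 with hq
  set N := ⌊x₁⌋₊ with hN
  -- general bounds on x ^ v
  have hpow : ∀ v x : ℝ, 0 ≤ v → 1 ≤ x → x ≤ x₁ → x ^ v ≤ Real.exp (2 * q * v) := by
    intro v x hv hx hx'
    calc x ^ v ≤ Real.exp (bigL D ^ 9 + bigL D + 1) ^ v :=
          Real.rpow_le_rpow (by linarith) (hx'.trans hx1) hv
      _ = Real.exp ((q + bigL D + 1) * v) := by rw [← Real.exp_mul]
      _ ≤ _ := Real.exp_le_exp.2 (mul_le_mul_of_nonneg_right (by linarith) hv)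
  have hpow' : ∀ v x : ℝ, 0 ≤ v → 1 ≤ x → x ≤ x₁ → x ^ v ≤ Real.exp ((q + 2 * bigL D) * v) := by
    intro v x hv hx hx'
    calc x ^ v ≤ Real.exp (bigL D ^ 9 + bigL D + 1) ^ v :=
          Real.rpow_le_rpow (by linarith) (hx'.trans hx1) hv
      _ = Real.exp ((q + bigL D + 1) * v) := by rw [← Real.exp_mul]
      _ ≤ _ := Real.exp_le_exp.2 (mul_le_mul_of_nonneg_right (by linarith) hv)
  have hneg : ∀ x : ℝ, 1 ≤ x → x ≤ x₁ → x ^ (-u) ≤ Real.exp 4 := by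
    intro x hx hx'
    rcases le_total 0 u with hu0 | hu0
    · refine (Real.rpow_le_one_of_one_le_of_nonpos hx (by linarith)).trans ?_
      linarith [Real.add_one_le_exp (4:ℝ)]
    · refine (hpow (-u) x (by linarith) hx hx').trans (Real.exp_le_exp.2 ?_)
      linarith
  have hX1 : 1 ≤ zzLen D p := by
    refine le_trans ?_ X1
    rw [← Real.exp_zero]; exact Real.exp_le_exp.2 (by positivity)
  have e1 : ‖zzQ D χ ψ (D^4) N s‖ * bigL D ^ 180 ≤ 9 * Real.exp 4 := by
    refine S1 s hsN (by linarith) (by linarith) _ (fun x hx hx' => ?_)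
    rw [show 1/2 - s.re = -u by rw [hu]; ring]
    exact hneg x (by linarith) hx'
  have e3 : ‖zzE D χ ψ Z N s‖ * bigL D ^ 178 ≤ Real.exp 4 := by
    refine E.trans ?_
    rw [show 1/2 - s.re = -u by rw [hu]; ring]
    exact hneg _ hX1 c1
  have hlam : zzLam D p ≤ 2 * q + 2 + bigL D := by rw [zzLam_eq hD hp]; linarith [hp.hi]
  have hlam2 : 2 * q ≤ zzLam D p := by rw [zzLam_eq hD hp]; linarith [hp.lo]
  have hgr := hZ.growth s hsN (by linarith) (by linarith)
  rw [← hu] at hgr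
  have e2 : ‖Z s‖ * ‖zzQ D χ ψ (D^4) N (1 - conj s)‖ * bigL D ^ 180 ≤ 9 * Real.exp 6 := by
    have hre : 1/2 - (1 - conj s).re = u := by simp [hu]; ring
    have hre2 : (1 - conj s).re = 1/2 - u := by simp [hu]; ring
    rcases le_total 0 u with hu0 | hu0
    · have := S1 (1 - conj s) hsN' (by rw [hre2]; linarith) (by rw [hre2]; linarith) (Real.exp ((q + 2 * bigL D) * u)) (fun x hx hx' => by
        rw [hre]; exact hpow' u x hu0 (by linarith) hx')
      rw [abs_of_nonneg hu0] at hgr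
      calc _ = ‖Z s‖ * (‖zzQ D χ ψ (D^4) N (1 - conj s)‖ * bigL D ^ 180) := by ring
        _ ≤ Real.exp (-zzLam D p * u + 16 * bigL D * u) * (9 * Real.exp ((q + 2 * bigL D) * u)) := by
            refine mul_le_mul hgr this (by positivity) (by positivity)
        _ = 9 * Real.exp ((-zzLam D p + 16 * bigL D + q + 2 * bigL D) * u) := by
            rw [mul_left_comm, ← Real.exp_add]; ring_nf
        _ ≤ 9 * Real.exp 6 := by
            refine mul_le_mul_of_nonneg_left (Real.exp_le_exp.2 ?_) (by norm_num)
            have : -zzLam D p + 16 * bigL D + q + 2 * bigL D ≤ 0 := by linarith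
            nlinarith
    · have := S1 (1 - conj s) hsN' (by rw [hre2]; linarith) (by rw [hre2]; linarith) 1 (fun x hx hx' => by
        rw [hre]; exact Real.rpow_le_one_of_one_le_of_nonpos (by linarith) hu0)
      rw [abs_of_nonpos hu0] at hgr
      calc _ = ‖Z s‖ * (‖zzQ D χ ψ (D^4) N (1 - conj s)‖ * bigL D ^ 180) := by ring
        _ ≤ Real.exp (-zzLam D p * u + 16 * bigL D * -u) * (9 * 1) := by
            refine mul_le_mul hgr this (by positivity) (by positivity)
        _ = 9 * Real.exp (-zzLam D p * u + 16 * bigL D * -u) := by ring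
        _ ≤ 9 * Real.exp 6 := by
            refine mul_le_mul_of_nonneg_left (Real.exp_le_exp.2 ?_) (by norm_num)
            have : zzLam D p + 16 * bigL D ≤ 3 * q := by linarith
            nlinarith
  have hEeq : zzA D χ ψ s - Ffun D χ ψ s - Z s * zzSh (Ffun D χ ψ) s =
      zzE D χ ψ Z N s + zzQ D χ ψ (D^4) N s + Z s * conj (zzQ D χ ψ (D^4) N (1 - conj s)) := by
    unfold zzE zzSh zzH
    rw [map_add]; ring
  have hn : ‖zzA D χ ψ s - Ffun D χ ψ s - Z s * zzSh (Ffun D χ ψ) s‖ ≤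
      ‖zzE D χ ψ Z N s‖ + ‖zzQ D χ ψ (D^4) N s‖ + ‖Z s‖ * ‖zzQ D χ ψ (D^4) N (1 - conj s)‖ := by
    rw [hEeq]
    refine (norm_add_le _ _).trans (add_le_add (norm_add_le _ _) (le_of_eq ?_))
    rw [norm_mul, Complex.norm_conj]
  set y := ‖zzA D χ ψ s - Ffun D χ ψ s - Z s * zzSh (Ffun D χ ψ) s‖
  have h178 : bigL D ^ 178 = bigL D ^ 170 * bigL D ^ 8 := by rw [← pow_add]
  have h180 : bigL D ^ 178 ≤ bigL D ^ 180 := pow_le_pow_right₀ hL1 (by norm_num)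
  have hE6 : Real.exp 4 ≤ Real.exp 6 := Real.exp_le_exp.2 (by norm_num)
  have f0 : y * bigL D ^ 178 ≤ 19 * Real.exp 6 := by
    calc _ ≤ (‖zzE D χ ψ Z N s‖ + ‖zzQ D χ ψ (D^4) N s‖ + ‖Z s‖ * ‖zzQ D χ ψ (D^4) N (1 - conj s)‖) * bigL D ^ 178 :=
          mul_le_mul_of_nonneg_right hn (by positivity)
      _ = ‖zzE D χ ψ Z N s‖ * bigL D ^ 178 + ‖zzQ D χ ψ (D^4) N s‖ * bigL D ^ 178 + ‖Z s‖ * ‖zzQ D χ ψ (D^4) N (1 - conj s)‖ * bigL D ^ 178 := by ring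
      _ ≤ ‖zzE D χ ψ Z N s‖ * bigL D ^ 178 + ‖zzQ D χ ψ (D^4) N s‖ * bigL D ^ 180 + ‖Z s‖ * ‖zzQ D χ ψ (D^4) N (1 - conj s)‖ * bigL D ^ 180 :=
          add_le_add (add_le_add le_rfl (mul_le_mul_of_nonneg_left h180 (norm_nonneg _))) (mul_le_mul_of_nonneg_left h180 (by positivity))
      _ ≤ _ := by linarith
  have f1 : 19 * Real.exp 6 ≤ bigL D ^ 8 := by
    have a1 := zz_exp80 hD
    have a2 : Real.exp 80 = Real.exp 74 * Real.exp 6 := by rw [← Real.exp_add]; norm_num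
    have a3 : 19 ≤ Real.exp 74 := by linarith [Real.add_one_le_exp (74:ℝ)]
    have a4 : bigL D ≤ bigL D ^ 8 := le_self_pow₀ hL1 (by norm_num)
    have a5 := mul_le_mul_of_nonneg_right a3 (Real.exp_pos 6).le
    have a6 := Real.exp_pos 80
    rw [← a2] at a5
    exact a5.trans (by linarith)
  rw [h178, ← mul_assoc] at f0
  have h8 : 0 < bigL D ^ 8 := by positivity
  by_contra hc
  push Not at hc
  have := mul_lt_mul_of_pos_right hc h8
  linarith

theorem zz_V_of {D : ℕ} (hD : zzBig D) {s : ℂ} (hs : |s.im - 2 * Real.pi * t0 D| ≤ bigL D ^ 405 + 4)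
    (h1 : -1 ≤ (s.re - 1/2) * bigL D) (h2 : s.re ≤ 1) : zzV D s := by
  have hL := hD.pos
  refine ⟨?_, ?_, hs.trans ?_⟩
  · have : -(1 / bigL D) ≤ s.re - 1/2 := by
      rw [← neg_div, div_le_iff₀ hL]; exact h1
    linarith
  · have : 0 < 1 / bigL D := by positivity
    linarith
  · linarith

theorem zz_L9' {D : ℕ} (hD : zzBig D) {u c : ℝ} (hc2 : c ≤ 10^99) (h : -c ≤ u * bigL D ^ 9) : -1 ≤ u * bigL D := by
  have hL := hD.pos
  have hL9 := zz_L9 hD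
  by_contra hcon
  push Not at hcon
  have hu : u < 0 := by
    by_contra h0
    push Not at h0
    have := mul_nonneg h0 hL.le
    linarith
  have : u * bigL D ^ 9 ≤ u * (10^99 * bigL D) := mul_le_mul_of_nonpos_left hL9 hu.le
  have h3 : u * (10^99 * bigL D) = 10^99 * (u * bigL D) := by ring
  have h4 : (10:ℝ)^99 * (u * bigL D) < 10^99 * (-1) := mul_lt_mul_of_pos_left hcon (by norm_num)
  linarith

theorem zz_R_bound {D : ℕ} (hD : zzBig D) {χ : DirichletCharacter ℂ D} {p : ℕ}
    {ψ : DirichletCharacter ℂ p} (h : MemPsi1 D χ ψ) {Z : ℂ → ℂ} (hZ : zzZP D p Z) (hA : zzAP D χ ψ Z)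
    {s : ℂ} (hs : |s.im - 2 * Real.pi * t0 D| ≤ bigL D ^ 405 + 4)
    (h1 : -2 ≤ (s.re - 1/2) * bigL D ^ 9) (h2 : s.re ≤ 1) :
    ‖zzR D χ ψ Z s‖ * bigL D ^ 90 ≤ 1 := by
  have hL := hD.pos
  have hp := zzP_of hD h.1
  have b := zz_E1_bound hD hp h.2.2.2.1 hZ hA hs h1 h2
  have hV : zzV D s := zz_V_of hD hs (zz_L9' hD (by norm_num : (2:ℝ) ≤ 10^99) h1) h2
  have hF := zz_F_ne hD h hV
  have hl := zz_F_lower hD h hV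
  have e : zzA D χ ψ s - Ffun D χ ψ s - Z s * zzSh (Ffun D χ ψ) s = zzR D χ ψ Z s * Ffun D χ ψ s := by
    unfold zzR zzB; field_simp
  rw [e, norm_mul] at b
  have h170 : bigL D ^ 170 = bigL D ^ 80 * bigL D ^ 90 := by rw [← pow_add]
  rw [h170] at b
  have h0 : 0 ≤ ‖zzR D χ ψ Z s‖ * bigL D ^ 90 := by positivity
  calc _ = ‖zzR D χ ψ Z s‖ * bigL D ^ 90 * 1 := by ring
    _ ≤ ‖zzR D χ ψ Z s‖ * bigL D ^ 90 * (bigL D ^ 80 * ‖Ffun D χ ψ s‖) := mul_le_mul_of_nonneg_left hl h0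
    _ = ‖zzR D χ ψ Z s‖ * ‖Ffun D χ ψ s‖ * (bigL D ^ 80 * bigL D ^ 90) := by ring
    _ ≤ _ := b


theorem zz_half_abs {D : ℕ} {x : ℝ} (h : |x - 1/2| ≤ 1 / (2 * bigL D)) :
    1/2 - 1 / (2 * bigL D) ≤ x ∧ 1/2 - 1 / (2 * bigL D) ≤ 1 - x := by
  have := abs_le.1 h
  constructor <;> linarith [this.1, this.2]

theorem zz_B_ld {D : ℕ} (hD : zzBig D) {χ : DirichletCharacter ℂ D} {p : ℕ}
    {ψ : DirichletCharacter ℂ p} (h : MemPsi1 D χ ψ) {Z : ℂ → ℂ} (hZ : zzZP D p Z)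
    {s : ℂ} (hs : |s.im - 2 * Real.pi * t0 D| ≤ bigL D ^ 405 + 4)
    (h1 : |s.re - 1/2| ≤ 1 / (2 * bigL D)) :
    DifferentiableAt ℂ (zzB D χ ψ Z) s ∧ zzB D χ ψ Z s ≠ 0 ∧
      ‖deriv (zzB D χ ψ Z) s / zzB D χ ψ Z s + zzLam D p‖ ≤ 3 * bigL D ^ 3 := by
  have hL := hD.pos
  have hbig : (1000:ℝ) ≤ bigL D := le_trans (by norm_num) hD.1
  have hsm : 1 / (2 * bigL D) ≤ 1/2 := by
    rw [div_le_div_iff₀ (by positivity) (by norm_num)]; linarith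
  have ha := abs_le.1 h1
  obtain ⟨g1, g2⟩ := zz_half_abs h1
  have hs' : |(1 - conj s).im - 2 * Real.pi * t0 D| ≤ bigL D ^ 405 + 4 := by simpa using hs
  have hre' : (1 - conj s).re = 1 - s.re := by simp
  have hL5 := zz_pow_ge hD (show 1 ≤ 5 by norm_num)
  norm_num at hL5
  have hN : zzN D s := by unfold zzN; generalize bigL D ^ 405 = a at *; linarith
  have hW : zzW D s := zzN_W hD hN (by simp)
  have hmul : 1 / (2 * bigL D) * bigL D ≤ 1 := by
    rw [div_mul_eq_mul_div, div_le_one (by positivity)]; linarith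
  have hV : zzV D s := zz_V_of hD hs (by nlinarith [ha.1]) (by linarith [ha.2])
  have hV' : zzV D (1 - conj s) := zz_V_of hD hs' (by rw [hre']; nlinarith [ha.2]) (by rw [hre']; linarith [ha.1])
  have F0 := zz_F_ne hD h hV
  have F1 := zz_F_ne hD h hV'
  have l1 := zz_F_logderiv hD h g1 (by linarith [ha.2]) hs
  have l2 := zz_F_logderiv hD h (by rw [hre']; exact g2) (by rw [hre']; linarith [ha.1]) hs'
  have hSh := zzSh_hasDeriv (f := Ffun D χ ψ) (s := s) (zz_F_diff _)
  have hSh0 : zzSh (Ffun D χ ψ) s ≠ 0 := by rw [zzSh]; simpa using F1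
  have hZd := hZ.diff s hW
  have hZ0 := hZ.ne s hW
  have hld := hZ.ld s hN (by linarith [ha.1]) (by linarith [ha.2])
  have hB : zzB D χ ψ Z = fun s => (Z s * zzSh (Ffun D χ ψ) s) / Ffun D χ ψ s := rfl
  have hFd : DifferentiableAt ℂ (Ffun D χ ψ) s := zz_F_diff s
  have hmd : DifferentiableAt ℂ (fun s => Z s * zzSh (Ffun D χ ψ) s) s := hZd.mul hSh.differentiableAt
  refine ⟨?_, ?_, ?_⟩
  · rw [hB]; exact hmd.div hFd F0
  · rw [zzB]; exact div_ne_zero (mul_ne_zero hZ0 hSh0) F0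
  · have e : deriv (zzB D χ ψ Z) s / zzB D χ ψ Z s = deriv Z s / Z s + (-conj (deriv (Ffun D χ ψ) (1 - conj s) / Ffun D χ ψ (1 - conj s)))
        - deriv (Ffun D χ ψ) s / Ffun D χ ψ s := by
      have e1 : logDeriv (zzB D χ ψ Z) s = logDeriv (fun s => Z s * zzSh (Ffun D χ ψ) s) s - logDeriv (Ffun D χ ψ) s := by
        rw [hB]; exact logDeriv_div s (mul_ne_zero hZ0 hSh0) F0 hmd hFd
      have e2 : logDeriv (fun s => Z s * zzSh (Ffun D χ ψ) s) s = logDeriv Z s + logDeriv (zzSh (Ffun D χ ψ)) s :=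
        logDeriv_mul s hZ0 hSh0 hZd hSh.differentiableAt
      have e3 : logDeriv (zzSh (Ffun D χ ψ)) s = -conj (deriv (Ffun D χ ψ) (1 - conj s) / Ffun D χ ψ (1 - conj s)) := by
        rw [logDeriv_apply, hSh.deriv, zzSh, map_div₀, neg_div]
      rw [e2, e3] at e1
      exact e1
    rw [e]
    have : deriv Z s / Z s + (-conj (deriv (Ffun D χ ψ) (1 - conj s) / Ffun D χ ψ (1 - conj s)))
        - deriv (Ffun D χ ψ) s / Ffun D χ ψ s + zzLam D p = (deriv Z s / Z s + zzLam D p) + (-conj (deriv (Ffun D χ ψ) (1 - conj s) / Ffun D χ ψ (1 - conj s)))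
        - deriv (Ffun D χ ψ) s / Ffun D χ ψ s := by ring
    rw [this]
    have t := (norm_sub_le _ _).trans (add_le_add_left (norm_add_le (deriv Z s / Z s + zzLam D p) (-conj (deriv (Ffun D χ ψ) (1 - conj s) / Ffun D χ ψ (1 - conj s)))) ‖deriv (Ffun D χ ψ) s / Ffun D χ ψ s‖)
    rw [norm_neg, Complex.norm_conj] at t
    have : 16 * bigL D ≤ bigL D ^ 3 := by nlinarith [mul_pos hL hL]
    linarith

theorem zz_B_line {D : ℕ} (hD : zzBig D) {χ : DirichletCharacter ℂ D} {p : ℕ}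
    {ψ : DirichletCharacter ℂ p} (h : MemPsi1 D χ ψ) {Z : ℂ → ℂ} (hZ : zzZP D p Z)
    {s : ℂ} (hs : |s.im - 2 * Real.pi * t0 D| ≤ bigL D ^ 405 + 4)
    (h1 : s.re = 1/2) : ‖zzB D χ ψ Z s‖ = 1 := by
  have hL := hD.pos
  have e : 1 - conj s = s := by
    apply Complex.ext
    · simp; linarith
    · simp
  have hL5 := zz_pow_ge hD (show 1 ≤ 5 by norm_num)
  norm_num at hL5
  have hN : zzN D s := by unfold zzN; generalize bigL D ^ 405 = a at *; linarith
  have hW : zzW D s := zzN_W hD hN (by simp)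
  have hV : zzV D s := zz_V_of hD hs (by rw [h1]; simp) (by rw [h1]; norm_num)
  have F0 := norm_ne_zero_iff.2 (zz_F_ne hD h hV)
  have r := congrArg norm (hZ.refl s hW)
  rw [e, norm_mul, Complex.norm_conj, norm_one] at r
  rw [zzB, norm_div, norm_mul, zzSh, Complex.norm_conj, e, mul_div_assoc, div_self F0, mul_one]
  nlinarith [norm_nonneg (Z s)]

theorem zz_B_small {D : ℕ} (hD : zzBig D) {χ : DirichletCharacter ℂ D} {p : ℕ}
    {ψ : DirichletCharacter ℂ p} (h : MemPsi1 D χ ψ) {Z : ℂ → ℂ} (hZ : zzZP D p Z)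
    {s : ℂ} (hs : |s.im - 2 * Real.pi * t0 D| ≤ bigL D ^ 405 + 4)
    (h1 : 1/2 ≤ s.re) (h2 : s.re ≤ 1) :
    ‖zzB D χ ψ Z s‖ ≤ Real.exp (-(bigL D ^ 9 / 2) * (s.re - 1/2)) := by
  have hL := hD.pos
  have hL1 := hD.one
  have hp := zzP_of hD h.1
  have hbig : (1000:ℝ) ≤ bigL D := le_trans (by norm_num) hD.1
  have hlam2 : 2 * bigL D ^ 9 ≤ zzLam D p := by rw [zzLam_eq hD hp]; linarith [hp.lo]
  have hu0 : 0 ≤ s.re - 1/2 := by linarith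
  have hL9 := zz_L9 hD
  norm_num at hL9
  by_cases hc : s.re - 1/2 ≤ 1 / (2 * bigL D)
  · set C : ℂ → ℂ := fun z => zzB D χ ψ Z z * Complex.exp (zzLam D p * (z - 1/2)) with hC
    have hreg : ∀ z ∈ segment ℝ (⟨1/2, s.im⟩ : ℂ) s, |z.im - 2 * Real.pi * t0 D| ≤ bigL D ^ 405 + 4 ∧
        |z.re - 1/2| ≤ 1 / (2 * bigL D) := by
      intro z hz
      obtain ⟨a, b⟩ := zz_seg hz
      refine ⟨by rw [a]; exact hs, ?_⟩
      rw [abs_of_nonneg (by rcases b with b | b <;> linarith [b.1, b.2])]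
      rcases b with b | b <;> linarith [b.1, b.2]
    have hexd : ∀ z : ℂ, HasDerivAt (fun z : ℂ => Complex.exp (zzLam D p * (z - 1/2))) (Complex.exp (zzLam D p * (z - 1/2)) * zzLam D p) z := by
      intro z
      have := (((hasDerivAt_id z).sub_const (1/2 : ℂ)).const_mul (zzLam D p : ℂ)).cexp
      simpa using this
    have key := zz_growth' (f := C) (a := ⟨1/2, s.im⟩) (b := s) (M := 3 * bigL D ^ 3) (by positivity) ?_ ?_ ?_ ?_
    · have k2 := key.2
      rw [zz_seg_norm, abs_of_nonneg hu0] at k2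
      have c1 : ‖C ⟨1/2, s.im⟩‖ = 1 := by
        rw [hC]; simp only
        rw [norm_mul, zz_B_line hD h hZ (by simpa using hs) rfl, Complex.norm_exp]
        simp
      have c2 : ‖C s‖ = ‖zzB D χ ψ Z s‖ * Real.exp (zzLam D p * (s.re - 1/2)) := by
        rw [hC]; simp only
        rw [norm_mul, Complex.norm_exp]
        simp
      rw [c1, c2, one_mul] at k2
      have k3 := mul_le_mul_of_nonneg_right k2 (Real.exp_nonneg (-(zzLam D p * (s.re - 1/2))))
      rw [mul_assoc, ← Real.exp_add, add_neg_cancel, Real.exp_zero, mul_one, ← Real.exp_add] at k3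
      refine k3.trans (Real.exp_le_exp.2 ?_)
      have h39 := zz_pow_mul_le hD.1 (show 3 < 9 by norm_num)
      norm_num at h39
      have h3 : 0 < bigL D ^ 3 := by positivity
      have : 3 * bigL D ^ 3 - zzLam D p ≤ -(bigL D ^ 9 / 2) := by linarith
      nlinarith
    · have r := hreg _ (left_mem_segment ℝ _ _)
      exact mul_ne_zero (zz_B_ld hD h hZ r.1 r.2).2.1 (Complex.exp_ne_zero _)
    · intro z hz
      have r := hreg z hz
      exact (zz_B_ld hD h hZ r.1 r.2).1.mul (hexd z).differentiableAt
    · intro z hz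
      have r := hreg z hz
      exact mul_ne_zero (zz_B_ld hD h hZ r.1 r.2).2.1 (Complex.exp_ne_zero _)
    · intro z hz
      have r := hreg z hz
      obtain ⟨b1, b2, b3⟩ := zz_B_ld hD h hZ r.1 r.2
      have e : deriv C z / C z = deriv (zzB D χ ψ Z) z / zzB D χ ψ Z z + zzLam D p := by
        have e1 := logDeriv_mul z b2 (Complex.exp_ne_zero (zzLam D p * (z - 1/2))) b1 (hexd z).differentiableAt
        have e2 : logDeriv (fun z : ℂ => Complex.exp (zzLam D p * (z - 1/2))) z = zzLam D p := by
          rw [logDeriv_apply, (hexd z).deriv, mul_div_cancel_left₀ _ (Complex.exp_ne_zero _)]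
        rw [e2] at e1
        exact e1
      rw [e]; exact b3
  · push Not at hc
    have hL5 := zz_pow_ge hD (show 1 ≤ 5 by norm_num)
    norm_num at hL5
    have hN : zzN D s := by unfold zzN; generalize bigL D ^ 405 = a at *; linarith
    have hV : zzV D s := zz_V_of hD hs (by have := mul_nonneg hu0 hL.le; linarith) h2
    have F0 := zz_F_ne hD h hV
    have Fl := zz_F_lower hD h hV
    have Fc := zz_F_crude hD (χ := χ) (ψ := ψ) (s := 1 - conj s) (by simp; linarith)
    have hgr := hZ.growth s hN (by linarith) (by linarith)
    rw [abs_of_nonneg hu0] at hgr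
    have hq : bigL D ^ 80 ≤ Real.exp (bigL D) := (pow_le_pow_right₀ hL1 (by norm_num)).trans hD.2
    have hFpos : 0 < ‖Ffun D χ ψ s‖ := norm_pos_iff.2 F0
    set u := s.re - 1/2 with hu
    have hu2 : 1 ≤ u * (2 * bigL D) := by
      rw [div_lt_iff₀ (by positivity)] at hc; exact hc.le
    rw [zzB, norm_div, norm_mul, zzSh, Complex.norm_conj, div_le_iff₀ hFpos]
    have h29 := zz_pow_mul_le hD.1 (show 2 < 9 by norm_num)
    norm_num at h29
    have hfin : -zzLam D p * u + 16 * bigL D * u + 17 * bigL D ≤ -(bigL D ^ 9 / 2) * u := by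
      have a1 : 17 * bigL D ≤ 34 * bigL D ^ 2 * u := by
        have := mul_le_mul_of_nonneg_left hu2 (by positivity : 0 ≤ 17 * bigL D)
        nlinarith
      have a2 : 16 * bigL D + 34 * bigL D ^ 2 - zzLam D p + bigL D ^ 9 / 2 ≤ 0 := by
        have : 0 < bigL D ^ 2 := by positivity
        linarith
      nlinarith
    calc ‖Z s‖ * ‖Ffun D χ ψ (1 - conj s)‖ ≤ Real.exp (-zzLam D p * u + 16 * bigL D * u) * Real.exp (16 * bigL D) := by
          refine mul_le_mul hgr (Fc.trans ?_) (norm_nonneg _) (by positivity)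
          rw [zz_D_exp hD, ← Real.exp_nat_mul]; norm_num
      _ ≤ Real.exp (-zzLam D p * u + 16 * bigL D * u) * Real.exp (16 * bigL D) * (bigL D ^ 80 * ‖Ffun D χ ψ s‖) :=
          le_mul_of_one_le_right (by positivity) Fl
      _ ≤ Real.exp (-zzLam D p * u + 16 * bigL D * u) * Real.exp (16 * bigL D) * (Real.exp (bigL D) * ‖Ffun D χ ψ s‖) := by
          refine mul_le_mul_of_nonneg_left (mul_le_mul_of_nonneg_right hq hFpos.le) (by positivity)
      _ = Real.exp (-zzLam D p * u + 16 * bigL D * u + 17 * bigL D) * ‖Ffun D χ ψ s‖ := by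
          rw [← mul_assoc, ← Real.exp_add, ← Real.exp_add]; ring_nf
      _ ≤ _ := by gcongr


theorem zz_near {D : ℕ} (hD : zzBig D) {x : ℝ} (h : |x - 1/2| * bigL D ^ 9 ≤ 2) :
    |x - 1/2| ≤ 1 / (2 * bigL D) ∧ -2 ≤ (x - 1/2) * bigL D ^ 9 ∧ x ≤ 1 ∧ -1 ≤ (x - 1/2) * bigL D := by
  have hL := hD.pos
  have h9 := zz_L9 hD
  have hL1 := hD.one
  have hL9 : 0 < bigL D ^ 9 := by positivity
  have a1 : |x - 1/2| ≤ 1 / (2 * bigL D) := by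
    rw [le_div_iff₀ (by positivity)]
    have : |x - 1/2| * (10^99 * bigL D) ≤ |x - 1/2| * bigL D ^ 9 :=
      mul_le_mul_of_nonneg_left h9 (abs_nonneg _)
    nlinarith [mul_nonneg (abs_nonneg (x - 1/2)) hL.le]
  have a2 : -2 ≤ (x - 1/2) * bigL D ^ 9 := by
    have := mul_le_mul_of_nonneg_right (neg_abs_le (x - 1/2)) hL9.le
    linarith
  refine ⟨a1, a2, ?_, zz_L9' hD (by norm_num : (2:ℝ) ≤ 10^99) a2⟩
  have : 1 / (2 * bigL D) ≤ 1/2 := by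
    rw [div_le_div_iff₀ (by positivity) (by norm_num)]; linarith
  linarith [le_abs_self (x - 1/2)]

theorem zz_R_diff {D : ℕ} (hD : zzBig D) {χ : DirichletCharacter ℂ D} {p : ℕ}
    {ψ : DirichletCharacter ℂ p} (h : MemPsi1 D χ ψ) {Z : ℂ → ℂ} (hZ : zzZP D p Z) (hA : zzAP D χ ψ Z)
    {s : ℂ} (hs : |s.im - 2 * Real.pi * t0 D| ≤ bigL D ^ 405 + 4)
    (h1 : |s.re - 1/2| * bigL D ^ 9 ≤ 2) :
    DifferentiableAt ℂ (zzR D χ ψ Z) s ∧ DifferentiableAt ℂ (zzB D χ ψ Z) s ∧ Ffun D χ ψ s ≠ 0 ∧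
      ‖zzR D χ ψ Z s‖ * bigL D ^ 90 ≤ 1 := by
  obtain ⟨a, b, c, d⟩ := zz_near hD h1
  have hF := zz_F_ne hD h (zz_V_of hD hs d c)
  have hB := (zz_B_ld hD h hZ hs a).1
  refine ⟨?_, hB, hF, zz_R_bound hD h hZ hA hs b c⟩
  have : zzR D χ ψ Z = fun s => zzA D χ ψ s / Ffun D χ ψ s - 1 - zzB D χ ψ Z s := rfl
  rw [this]
  exact (((hA.diff s).div (zz_F_diff s) hF).sub_const 1).sub hB

theorem zz_R_deriv {D : ℕ} (hD : zzBig D) {χ : DirichletCharacter ℂ D} {p : ℕ}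
    {ψ : DirichletCharacter ℂ p} (h : MemPsi1 D χ ψ) {Z : ℂ → ℂ} (hZ : zzZP D p Z) (hA : zzAP D χ ψ Z)
    {s : ℂ} (hs : |s.im - 2 * Real.pi * t0 D| ≤ bigL D ^ 405 + 2)
    (h1 : |s.re - 1/2| * bigL D ^ 9 ≤ 1) : ‖deriv (zzR D χ ψ Z) s‖ ≤ 1 := by
  have hL := hD.pos
  have hL1 := hD.one
  have hL9 : 0 < bigL D ^ 9 := by positivity
  have hL90 : 0 < bigL D ^ 90 := by positivity
  have h91 : 1 ≤ bigL D ^ 9 := one_le_pow₀ hL1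
  have hr : 0 < 1 / bigL D ^ 9 := by positivity
  have hr1 : 1 / bigL D ^ 9 ≤ 1 := by rw [div_le_one hL9]; exact h91
  have key : ∀ w ∈ Metric.closedBall s (1 / bigL D ^ 9), DifferentiableAt ℂ (zzR D χ ψ Z) w ∧
      ‖zzR D χ ψ Z w‖ * bigL D ^ 90 ≤ 1 := by
    intro w hw
    rw [Metric.mem_closedBall, dist_eq_norm] at hw
    have e1 := (Complex.abs_re_le_norm (w - s)).trans hw
    have e2 := (Complex.abs_im_le_norm (w - s)).trans hw
    rw [Complex.sub_re] at e1
    rw [Complex.sub_im] at e2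
    have c1 : |w.im - 2 * Real.pi * t0 D| ≤ bigL D ^ 405 + 4 := by
      have := abs_sub_le w.im s.im (2 * Real.pi * t0 D)
      generalize bigL D ^ 405 = q at *
      linarith
    have c2 : |w.re - 1/2| * bigL D ^ 9 ≤ 2 := by
      have t1 := abs_sub_le w.re s.re (1/2)
      have t2 := mul_le_mul_of_nonneg_right (t1.trans (add_le_add_left e1 _)) hL9.le
      rw [add_mul, one_div_mul_cancel hL9.ne'] at t2
      linarith
    have := zz_R_diff hD h hZ hA c1 c2
    exact ⟨this.1, this.2.2.2⟩
  have hd : DiffContOnCl ℂ (zzR D χ ψ Z) (Metric.ball s (1 / bigL D ^ 9)) := by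
    refine DifferentiableOn.diffContOnCl ?_
    rw [closure_ball _ hr.ne']
    exact fun w hw => (key w hw).1.differentiableWithinAt
  have := Complex.norm_deriv_le_of_forall_mem_sphere_norm_le (C := 1 / bigL D ^ 90) hr hd (fun w hw => by
    rw [le_div_iff₀ hL90]
    exact (key w (Metric.sphere_subset_closedBall hw)).2)
  refine this.trans ?_
  rw [div_div_eq_mul_div, div_one, div_mul_eq_mul_div, one_mul, div_le_one hL90]
  exact pow_le_pow_right₀ hL1 (by norm_num)

theorem zz_segu {a b z : ℂ} {u y : ℝ} (ha : a.im = y ∧ |a.re - 1/2| ≤ u) (hb : b.im = y ∧ |b.re - 1/2| ≤ u)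
    (hz : z ∈ segment ℝ a b) : z.im = y ∧ |z.re - 1/2| ≤ u := by
  obtain ⟨c, d, hc, hd, hcd, rfl⟩ := hz
  have h1 := abs_le.1 ha.2
  have h2 := abs_le.1 hb.2
  have hd' : d = 1 - c := by linarith
  subst hd'
  simp only [Complex.add_im, Complex.real_smul, Complex.re_ofReal_mul, Complex.im_ofReal_mul, Complex.add_re]
  rw [ha.1, hb.1]
  refine ⟨by ring, abs_le.2 ⟨?_, ?_⟩⟩ <;> nlinarith [h1.1, h1.2, h2.1, h2.2]

/-- a zero to the right is very close to the line -/
theorem zz_zero_close {D : ℕ} (hD : zzBig D) {χ : DirichletCharacter ℂ D} {p : ℕ}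
    {ψ : DirichletCharacter ℂ p} (h : MemPsi1 D χ ψ) {Z : ℂ → ℂ} (hZ : zzZP D p Z) (hA : zzAP D χ ψ Z)
    {s : ℂ} (hs : |s.im - 2 * Real.pi * t0 D| ≤ bigL D ^ 405 + 2) (h1 : 1/2 ≤ s.re) (h2 : s.re ≤ 1)
    (h0 : zzA D χ ψ s = 0) :
    (s.re - 1/2) * bigL D ^ 9 ≤ 1/1000 ∧ ‖zzB D χ ψ Z s + 1‖ ≤ 1/1000 := by
  have hL9 : 0 < bigL D ^ 9 := pow_pos hD.pos _
  have hs4 : |s.im - 2 * Real.pi * t0 D| ≤ bigL D ^ 405 + 4 := by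
    generalize bigL D ^ 405 = q at *
    linarith
  have hu : 0 ≤ (s.re - 1/2) * bigL D ^ 9 := mul_nonneg (by linarith) hL9.le
  have hR := zz_R_bound hD h hZ hA hs4 (by linarith) h2
  have h90 : (10:ℝ)^100 ≤ bigL D ^ 90 := zz_pow_ge hD (by norm_num)
  have hR' : ‖zzR D χ ψ Z s‖ ≤ 1/10000 := by
    have : ‖zzR D χ ψ Z s‖ * 10^100 ≤ 1 := le_trans (mul_le_mul_of_nonneg_left h90 (norm_nonneg _)) hR
    linarith [norm_nonneg (zzR D χ ψ Z s)]
  have e : zzB D χ ψ Z s + 1 = - zzR D χ ψ Z s := by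
    rw [zzR, h0, zero_div]; ring
  have hB1 : ‖zzB D χ ψ Z s + 1‖ ≤ 1/10000 := by rw [e, norm_neg]; exact hR'
  refine ⟨?_, by linarith⟩
  have hb := zz_B_small hD h hZ hs4 h1 h2
  have hn : (1:ℝ) ≤ ‖zzB D χ ψ Z s + 1‖ + ‖zzB D χ ψ Z s‖ := by
    have := norm_sub_le (zzB D χ ψ Z s + 1) (zzB D χ ψ Z s)
    rwa [add_sub_cancel_left, norm_one] at this
  set y := (s.re - 1/2) * bigL D ^ 9 / 2 with hy
  have ey : -(bigL D ^ 9 / 2) * (s.re - 1/2) = -y := by rw [hy]; ring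
  rw [ey, Real.exp_neg] at hb
  have h3 : y + 1 ≤ Real.exp y := Real.add_one_le_exp y
  have h4 : 9999/10000 ≤ (Real.exp y)⁻¹ := by linarith
  have h5 : 9999/10000 * Real.exp y ≤ 1 := by
    have := mul_le_mul_of_nonneg_right h4 (Real.exp_pos y).le
    rwa [inv_mul_cancel₀ (Real.exp_pos y).ne'] at this
  linarith

set_option maxHeartbeats 1000000 in
theorem zz_main {D : ℕ} (hD : zzBig D) {χ : DirichletCharacter ℂ D} {p : ℕ}
    {ψ : DirichletCharacter ℂ p} (h : MemPsi1 D χ ψ) {Z : ℂ → ℂ} (hZ : zzZP D p Z) (hA : zzAP D χ ψ Z)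
    {s : ℂ} (hs : |s.im - 2 * Real.pi * t0 D| ≤ bigL D ^ 405 + 2) (h1 : 1/2 ≤ s.re) (h2 : s.re ≤ 1)
    (h0 : zzA D χ ψ s = 0) : s.re = 1/2 ∧ deriv (zzA D χ ψ) s ≠ 0 := by
  obtain ⟨hu, hB⟩ := zz_zero_close hD h hZ hA hs h1 h2 h0
  have hL := hD.pos
  have hL1 := hD.one
  have hL9 : 0 < bigL D ^ 9 := pow_pos hL _
  have hp := zzP_of hD h.1
  have hlam2 : 2 * bigL D ^ 9 ≤ zzLam D p := by rw [zzLam_eq hD hp]; linarith [hp.lo]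
  have hLL := zz_L9 hD
  have hlam3 : zzLam D p ≤ 3 * bigL D ^ 9 := by rw [zzLam_eq hD hp]; linarith [hp.hi]
  have hL3 : (10:ℝ)^100 * bigL D ^ 3 ≤ bigL D ^ 9 := zz_pow_mul_le hD.1 (by norm_num)
  have hL3' : 0 < bigL D ^ 3 := pow_pos hL _
  have hL9b : (10:ℝ)^100 ≤ bigL D ^ 9 := zz_pow_ge hD (by norm_num)
  set u := s.re - 1/2 with hudef
  have hu0 : 0 ≤ u := by rw [hudef]; linarith
  have ps : s.im = s.im ∧ |s.re - 1/2| ≤ u := ⟨rfl, (abs_of_nonneg hu0).le⟩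
  have ps' : (1 - conj s).im = s.im ∧ |(1 - conj s).re - 1/2| ≤ u := by
    refine ⟨by simp, ?_⟩
    simp only [Complex.sub_re, Complex.one_re, Complex.conj_re]
    rw [show 1 - s.re - 1/2 = -u by rw [hudef]; ring, abs_neg, abs_of_nonneg hu0]
  have im4 : ∀ z : ℂ, z.im = s.im → |z.im - 2 * Real.pi * t0 D| ≤ bigL D ^ 405 + 4 := by
    intro z hz
    rw [hz]
    generalize bigL D ^ 405 = q at *
    linarith
  have re9 : ∀ z : ℂ, |z.re - 1/2| ≤ u → |z.re - 1/2| * bigL D ^ 9 ≤ 1/1000 := fun z hz =>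
    (mul_le_mul_of_nonneg_right hz hL9.le).trans hu
  have ldB : ∀ z : ℂ, z.im = s.im ∧ |z.re - 1/2| ≤ u → DifferentiableAt ℂ (zzB D χ ψ Z) z ∧ zzB D χ ψ Z z ≠ 0 ∧
      ‖deriv (zzB D χ ψ Z) z / zzB D χ ψ Z z + zzLam D p‖ ≤ 3 * bigL D ^ 3 := fun z hz =>
    zz_B_ld hD h hZ (im4 z hz.1) (zz_near hD (by linarith [re9 z hz.2])).1
  have ldn : ∀ z : ℂ, z.im = s.im ∧ |z.re - 1/2| ≤ u →
      ‖deriv (zzB D χ ψ Z) z / zzB D χ ψ Z z‖ ≤ zzLam D p + 3 * bigL D ^ 3 := by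
    intro z hz
    have a := (ldB z hz).2.2
    have b := norm_sub_le (deriv (zzB D χ ψ Z) z / zzB D χ ψ Z z + zzLam D p) (zzLam D p)
    rw [add_sub_cancel_right, Complex.norm_real, Real.norm_eq_abs, abs_of_nonneg (by linarith : 0 ≤ zzLam D p)] at b
    linarith
  have nearB : ∀ z : ℂ, z.im = s.im ∧ |z.re - 1/2| ≤ u → ‖zzB D χ ψ Z z + 1‖ ≤ 1/5 := by
    intro z hz
    have g := (zz_growth' (f := zzB D χ ψ Z) (a := s) (b := z) (M := 4 * bigL D ^ 9) (by linarith) (ldB s ps).2.1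
      (fun w hw => (ldB w (zz_segu ps hz hw)).1) (fun w hw => (ldB w (zz_segu ps hz hw)).2.1)
      (fun w hw => (ldn w (zz_segu ps hz hw)).trans (by linarith))).1
    have d : ‖z - s‖ ≤ 2 * u := by
      have e := Complex.norm_le_abs_re_add_abs_im (z - s)
      rw [Complex.sub_im, Complex.sub_re, hz.1, sub_self, abs_zero, add_zero] at e
      have e2 := abs_sub_le z.re (1/2) s.re
      rw [abs_sub_comm (1/2) s.re] at e2
      linarith [ps.2, hz.2]
    have m : 4 * bigL D ^ 9 * ‖z - s‖ ≤ 1/100 := by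
      have := mul_le_mul_of_nonneg_left d (by linarith : 0 ≤ 4 * bigL D ^ 9)
      nlinarith
    have m' : Real.exp (4 * bigL D ^ 9 * ‖z - s‖) - 1 ≤ 1/50 := by
      have a := Real.exp_le_exp.2 m
      have b : Real.exp (1/100) ≤ 1/50 + 1 := by
        have := Real.exp_bound_div_one_sub_of_interval (x := 1/100) (by norm_num) (by norm_num)
        linarith
      linarith
    have nB : ‖zzB D χ ψ Z s‖ ≤ 2 := by
      have := norm_sub_le (zzB D χ ψ Z s + 1) 1
      rw [add_sub_cancel_right, norm_one] at this
      linarith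
    have g2 : ‖zzB D χ ψ Z z - zzB D χ ψ Z s‖ ≤ 2 * (1/50) := by
      refine g.trans ((mul_le_mul_of_nonneg_left m' (norm_nonneg _)).trans ?_)
      linarith
    have := norm_add_le (zzB D χ ψ Z z - zzB D χ ψ Z s) (zzB D χ ψ Z s + 1)
    rw [show zzB D χ ψ Z z - zzB D χ ψ Z s + (zzB D χ ψ Z s + 1) = zzB D χ ψ Z z + 1 by ring] at this
    linarith
  have reB : ∀ z : ℂ, z.im = s.im ∧ |z.re - 1/2| ≤ u → 2 ≤ (deriv (zzB D χ ψ Z) z).re := by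
    intro z hz
    obtain ⟨-, hne, hl⟩ := ldB z hz
    have hn := nearB z hz
    have hw := ldn z hz
    set w := deriv (zzB D χ ψ Z) z / zzB D χ ψ Z z with hwdef
    have e : deriv (zzB D χ ψ Z) z = zzLam D p - (w + zzLam D p) + (zzB D χ ψ Z z + 1) * w := by
      have : deriv (zzB D χ ψ Z) z = w * zzB D χ ψ Z z := by rw [hwdef, div_mul_cancel₀ _ hne]
      rw [this]; ring
    rw [e, Complex.add_re, Complex.sub_re, Complex.ofReal_re]
    have a1 := (Complex.re_le_norm (w + zzLam D p)).trans hl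
    have a2 : -((1/5) * (zzLam D p + 3 * bigL D ^ 3)) ≤ ((zzB D χ ψ Z z + 1) * w).re := by
      have b := (abs_le.1 (Complex.abs_re_le_norm ((zzB D χ ψ Z z + 1) * w))).1
      have c : ‖(zzB D χ ψ Z z + 1) * w‖ ≤ (1/5) * (zzLam D p + 3 * bigL D ^ 3) := by
        rw [norm_mul]
        exact mul_le_mul hn hw (norm_nonneg _) (by norm_num)
      linarith
    linarith
  set G : ℂ → ℂ := fun z => zzA D χ ψ z / Ffun D χ ψ z with hG
  have hGeq : G = fun z => 1 + zzB D χ ψ Z z + zzR D χ ψ Z z := by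
    funext z; simp only [hG, zzR]; ring
  have Rd : ∀ z : ℂ, z.im = s.im ∧ |z.re - 1/2| ≤ u → _ := fun z hz =>
    zz_R_diff hD h hZ hA (im4 z hz.1) (by linarith [re9 z hz.2])
  have Gd : ∀ z : ℂ, z.im = s.im ∧ |z.re - 1/2| ≤ u → HasDerivAt G
      (deriv (zzB D χ ψ Z) z + deriv (zzR D χ ψ Z) z) z := by
    intro z hz
    rw [hGeq]
    exact ((Rd z hz).2.1.hasDerivAt.const_add 1).add (Rd z hz).1.hasDerivAt
  have Gre : ∀ z : ℂ, z.im = s.im ∧ |z.re - 1/2| ≤ u → 0 < (deriv G z).re := by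
    intro z hz
    rw [(Gd z hz).deriv, Complex.add_re]
    have a := zz_R_deriv hD h hZ hA (by rw [hz.1]; exact hs) (by linarith [re9 z hz.2] : |z.re - 1/2| * bigL D ^ 9 ≤ 1)
    have b := (abs_le.1 (Complex.abs_re_le_norm (deriv (zzR D χ ψ Z) z))).1
    linarith [reB z hz]
  have hW : zzW D s := by
    refine zzN_W hD (s := s) ?_ (by simp)
    unfold zzN
    have := zz_pow_ge hD (show 1 ≤ 5 by norm_num)
    generalize bigL D ^ 405 = q at *
    linarith
  have h0' : zzA D χ ψ (1 - conj s) = 0 := by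
    rw [hA.fe _ (zzW_refl hW), zzSh, zz_refl_refl, h0, map_zero, mul_zero]
  have heq : 1 - conj s = s := zz_inj (f := G) (fun z hz => (Gd z (zz_segu ps' ps hz)).differentiableAt)
    (fun z hz => Gre z (zz_segu ps' ps hz)) (by simp only [hG, h0, h0', zero_div])
  refine ⟨?_, fun hd => ?_⟩
  · have := congrArg Complex.re heq
    simp only [Complex.sub_re, Complex.one_re, Complex.conj_re] at this
    linarith
  · have hF := (Rd s ps).2.2.1
    have a := (hA.diff s).hasDerivAt.div (zz_F_diff (D := D) (χ := χ) (ψ := ψ) s).hasDerivAt hF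
    have b := Gre s ps
    have c : deriv G s = 0 := by
      have := a.deriv
      rw [hd, h0, zero_mul, zero_mul, sub_zero, zero_div] at this
      exact this
    rw [c] at b
    simp at b

theorem zz_final {D : ℕ} (hD : zzBig D) {χ : DirichletCharacter ℂ D} (hχp : χ.IsPrimitive) {p : ℕ}
    {ψ : DirichletCharacter ℂ p} (h : MemPsi1 D χ ψ) {ρ : ℂ} (hρ : InOmega D ρ) (h0 : zzA D χ ψ ρ = 0) :
    ρ.re = 1/2 ∧ deriv (zzA D χ ψ) ρ ≠ 0 := by
  obtain ⟨Z, hZ, hA⟩ := zz_A_struct hD hχp h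
  obtain ⟨hr, hi⟩ := hρ
  rw [Complex.sub_re, s0_re] at hr
  rw [Complex.sub_im, s0_im] at hi
  have hi' : |ρ.im - 2 * Real.pi * t0 D| ≤ bigL D ^ 405 + 2 := hi.le
  have hr' := abs_lt.1 hr
  rcases le_or_gt (1/2) ρ.re with hc | hc
  · exact zz_main hD h hZ hA hi' hc (by linarith [hr'.2]) h0
  · exfalso
    have hW : zzW D ρ := by
      refine zzN_W hD (s := ρ) ?_ (by simp)
      unfold zzN
      have := zz_pow_ge hD (show 1 ≤ 5 by norm_num)
      generalize bigL D ^ 405 = q at *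
      linarith
    have h0' : zzA D χ ψ (1 - conj ρ) = 0 := by
      rw [hA.fe _ (zzW_refl hW), zzSh, zz_refl_refl, h0, map_zero, mul_zero]
    have := (zz_main hD h hZ hA (s := 1 - conj ρ) (by simpa using hi')
      (by simp only [Complex.sub_re, Complex.one_re, Complex.conj_re]; linarith)
      (by simp only [Complex.sub_re, Complex.one_re, Complex.conj_re]; linarith [hr'.1]) h0').1
    simp only [Complex.sub_re, Complex.one_re, Complex.conj_re] at this
    linarith

theorem zz_L_both_diff {D : ℕ} (hD : zzBig D) {χ : DirichletCharacter ℂ D} (hχp : χ.IsPrimitive) {p : ℕ}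
    {ψ : DirichletCharacter ℂ p} (h : MemPsi1 D χ ψ) (s : ℂ) :
    DifferentiableAt ℂ (fun s => Lfun ψ s) s ∧ DifferentiableAt ℂ (fun s => Lfun (chiPsi D χ ψ) s) s := by
  obtain ⟨hS, hψ, -⟩ := h
  have hp := zzP_of hD hS
  have hDpos := hD.D_pos
  have : NeZero p := ⟨hp.pos.ne'⟩
  have : NeZero D := ⟨hDpos.ne'⟩
  have hp1 : 1 < p := hS.1.one_lt
  have hL1 := hD.one
  have hDp : D < p := by
    have h1 : (D:ℝ) = Real.exp (bigL D) := by
      rw [bigL, Real.exp_log (by exact_mod_cast hDpos)]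
    have h2 := hS.2.1
    have h3 : (D:ℝ) < p := by
      rw [h1]
      refine lt_of_le_of_lt (Real.exp_le_exp.2 ?_) h2
      exact le_self_pow₀ hL1 (by norm_num)
    exact_mod_cast h3
  have hcop : Nat.Coprime D p := ((Nat.Prime.coprime_iff_not_dvd hS.1).2 (fun hd => by
    have := Nat.le_of_dvd hDpos hd; omega)).symm
  have hprim := zz_chiPsi_prim hcop hχp hψ
  have hDp1 : 1 < D * p := lt_of_lt_of_le hp1 (Nat.le_mul_of_pos_left p hDpos)
  have hψ1 := zz_prim_ne_one hp1 hψ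
  have hc1 := zz_prim_ne_one hDp1 hprim
  simp only [Lfun_eq]
  exact ⟨DirichletCharacter.differentiable_LFunction hψ1 s, DirichletCharacter.differentiable_LFunction hc1 s⟩


/-- For every `ψ ∈ Ψ₁`, every zero `ρ` of `L(s,ψ)L(s,χψ)` in `Ω` lies on the
critical line and is a simple zero; in particular `L(s,ψ)` and `L(s,χψ)` have no common zero
in `Ω`. -/
theorem statement11 :
    ∃ D₀ : ℕ, ∀ D : ℕ, D₀ ≤ D → ∀ χ : DirichletCharacter ℂ D,
      IsRealChar χ → χ.IsPrimitive →
        ∀ (p : ℕ) (ψ : DirichletCharacter ℂ p), MemPsi1 D χ ψ →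
          ∀ ρ : ℂ, InOmega D ρ → Lfun ψ ρ * Lfun (chiPsi D χ ψ) ρ = 0 →
            ρ.re = 1 / 2 ∧
            deriv (fun s => Lfun ψ s * Lfun (chiPsi D χ ψ) s) ρ ≠ 0 ∧
            ¬(Lfun ψ ρ = 0 ∧ Lfun (chiPsi D χ ψ) ρ = 0) := by
  obtain ⟨D₀, hD₀⟩ := zzBig_ev
  refine ⟨D₀, fun D hDD χ _ hχp p ψ h ρ hρ h0 => ?_⟩
  have hD := hD₀ D hDD
  obtain ⟨h1, h2⟩ := zz_final hD hχp h hρ h0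
  have h2' : deriv (fun s => Lfun ψ s * Lfun (chiPsi D χ ψ) s) ρ ≠ 0 := h2
  refine ⟨h1, h2', fun hz => h2' ?_⟩
  obtain ⟨d1, d2⟩ := zz_L_both_diff hD hχp h ρ
  have := (d1.hasDerivAt.mul d2.hasDerivAt).deriv
  simp only [hz.1, hz.2, mul_zero, zero_mul, add_zero] at this
  exact this

end
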